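/- Let p and q be primes with p ≡ 5 (mod 8) and q ≡ 3 (mod 8), set d = pq, and let r ≥ 1 be the integer with 2^r = 2·h₂(-pq). Then for every integer n ≥ 1, the 2-class group of L_{n,d} is a cyclic group isomorphic to ℤ/2^{n+r-1}ℤ. -/

import Mathlib

open IntermediateField NumberField

/-- The quadratic field `ℚ(√m)` realized inside `ℂ` (for `m` of either sign). -/
noncomputable def quadField (m : ℤ) : IntermediateField ℚ ℂ :=
  IntermediateField.adjoin ℚ {z : ℂ | z ^ 2 = (m : ℂ)}

/-- The 2-class group of a number field `K ⊆ ℂ`: the 2-primary component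
(= 2-Sylow subgroup) of the ideal class group of its ring of integers. -/
noncomputable def twoClassGroup (K : IntermediateField ℚ ℂ) :
    Subgroup (ClassGroup (𝓞 K)) :=
  CommGroup.primaryComponent _ 2

/-- `h₂(m)`: the 2-class number of the quadratic field `ℚ(√m)`. -/
noncomputable def h2 (m : ℤ) : ℕ := Nat.card (twoClassGroup (quadField m))

/-- `L_{n,d} = ℚ(ζ_{2^{n+2}}, √d)`, the `n`-th layer of the cyclotomic
`ℤ₂`-extension of `ℚ(√d, √-1)`. -/
noncomputable def Lfield (n : ℕ) (d : ℤ) : IntermediateField ℚ ℂ :=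
  IntermediateField.adjoin ℚ
    ({z : ℂ | z ^ 2 ^ (n + 2) = 1} ∪ {z : ℂ | z ^ 2 = (d : ℂ)})

/-- `ℚ(ζ_{2^{n+2}} + ζ_{2^{n+2}}⁻¹, √d) = ℚ(2cos(2π/2^{n+2}), √d)`.
For `d > 0` this is the maximal real subfield `L_{n,d}⁺` of `L_{n,d}`;
for `d < 0` it is the `n`-th layer `K_{n,|d|}` of the cyclotomic
`ℤ₂`-extension of the imaginary quadratic field `ℚ(√d)`. -/
noncomputable def LplusField (n : ℕ) (d : ℤ) : IntermediateField ℚ ℂ :=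
  IntermediateField.adjoin ℚ
    ({((2 * Real.cos (2 * Real.pi / 2 ^ (n + 2)) : ℝ) : ℂ)} ∪ {z : ℂ | z ^ 2 = (d : ℂ)})

set_option linter.all false

section

/-- Rank-nullity over `ℤ`. -/
lemma int_rank_nullity {M N : Type*} [AddCommGroup M] [AddCommGroup N] [Module.Finite ℤ M]
    (f : M →ₗ[ℤ] N) :
    Module.finrank ℤ (LinearMap.range f) + Module.finrank ℤ (LinearMap.ker f) =
      Module.finrank ℤ M := by
  rw [← Submodule.finrank_quotient_add_finrank (LinearMap.ker f),
    LinearEquiv.finrank_eq f.quotKerEquivRange]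

lemma finrank_prod_finite (n : ℕ) (T : Type*) [AddCommGroup T] [Finite T] :
    Module.finrank ℤ ((Fin n →₀ ℤ) × T) = n := by
  have : Module.Finite ℤ T := Module.Finite.of_finite
  rw [← int_rank_nullity (LinearMap.fst ℤ (Fin n →₀ ℤ) T),
    LinearMap.range_eq_top.mpr LinearMap.fst_surjective, finrank_top,
    Module.finrank_finsupp_self, Fintype.card_fin]
  have : Module.finrank ℤ (LinearMap.ker (LinearMap.fst ℤ (Fin n →₀ ℤ) T)) = 0 := by
    rw [Module.finrank_eq_zero_iff]
    rintro ⟨⟨a, x⟩, hx⟩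
    refine ⟨(Nat.card T : ℤ), by exact_mod_cast Nat.card_pos.ne', ?_⟩
    have h := card_nsmul_eq_zero' (x := x)
    have ha : a = 0 := hx
    subst ha
    ext1
    simp [h]
  rw [this, add_zero]

/-- The index of `2G` in a finitely generated abelian group. -/
lemma index_two_fg (G : Type*) [AddCommGroup G] [hG : AddGroup.FG G] :
    (nsmulAddMonoidHom 2 : G →+ G).range.index =
      2 ^ (Module.finrank ℤ G) * Nat.card (nsmulAddMonoidHom 2 : G →+ G).ker := by
  obtain ⟨n, ι, fι, p, hp, e, ⟨f⟩⟩ := AddCommGroup.equiv_free_prod_directSum_zmod G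
  haveI : ∀ i, NeZero (p i ^ e i) := fun i => ⟨pow_ne_zero _ (hp i).ne_zero⟩
  set T := DirectSum ι fun i => ZMod (p i ^ e i) with hT
  haveI : Finite T := by
    classical
    exact Finite.of_equiv _ (DirectSum.addEquivProd (fun i => ZMod (p i ^ e i))).symm.toEquiv
  have hrank : Module.finrank ℤ G = n := by
    rw [LinearEquiv.finrank_eq f.toIntLinearEquiv]
    exact finrank_prod_finite n T
  have h1 : (nsmulAddMonoidHom 2 : G →+ G).range.index =
      (nsmulAddMonoidHom 2 : ((Fin n →₀ ℤ) × T) →+ _).range.index := by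
    rw [← AddSubgroup.index_map_equiv _ f]
    congr 1
    ext x
    constructor
    · rintro ⟨y, ⟨z, rfl⟩, rfl⟩
      exact ⟨f z, by simp⟩
    · rintro ⟨y, rfl⟩
      exact ⟨2 • f.symm y, ⟨f.symm y, rfl⟩, by simp⟩
  have h2 : Nat.card (nsmulAddMonoidHom 2 : G →+ G).ker = Nat.card (nsmulAddMonoidHom 2 : T →+ T).ker := by
    refine Nat.card_congr ⟨fun x => ⟨(f x.1).2, ?_⟩, fun t => ⟨f.symm (0, t.1), ?_⟩, ?_, ?_⟩
    · have := x.2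
      rw [AddMonoidHom.mem_ker] at this ⊢
      have h := congrArg (fun y => (f y).2) this
      simpa using h
    · have := t.2
      rw [AddMonoidHom.mem_ker] at this ⊢
      simp only [nsmulAddMonoidHom_apply] at this ⊢
      rw [← map_nsmul, Prod.smul_mk, this]
      simp
    · intro x
      have := x.2
      rw [AddMonoidHom.mem_ker] at this
      have h := congrArg (fun y => (f y).1) this
      have h' : (f x.1).1 = 0 := by simpa using h
      ext
      simp only
      rw [AddEquiv.symm_apply_eq]
      ext1
      · exact h'.symm
      · rfl
    · intro t
      simp
  have h3 : (nsmulAddMonoidHom 2 : ((Fin n →₀ ℤ) × T) →+ _).range =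
      (nsmulAddMonoidHom 2 : (Fin n →₀ ℤ) →+ _).range.prod (nsmulAddMonoidHom 2 : T →+ T).range := by
    ext ⟨a, b⟩
    simp [AddSubgroup.mem_prod]
  have h4 : (nsmulAddMonoidHom 2 : (Fin n →₀ ℤ) →+ _).range.index = 2 ^ n := by
    let g : (Fin n →₀ ℤ) ≃+ (Fin n → ℤ) := (Finsupp.linearEquivFunOnFinite ℤ ℤ (Fin n)).toAddEquiv
    rw [← AddSubgroup.index_map_equiv _ g]
    have : (AddSubgroup.map (↑g) (nsmulAddMonoidHom 2 : (Fin n →₀ ℤ) →+ _).range) =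
        AddSubgroup.pi Set.univ (fun _ : Fin n => AddSubgroup.zmultiples (2 : ℤ)) := by
      ext x
      rw [AddSubgroup.mem_pi]
      constructor
      · rintro ⟨y, ⟨z, rfl⟩, rfl⟩ i _
        rw [Int.mem_zmultiples_iff]
        exact ⟨z i, by simp [g]⟩
      · intro h
        simp only [Int.mem_zmultiples_iff, Set.mem_univ, forall_true_left] at h
        choose c hc using h
        refine ⟨2 • g.symm c, ⟨_, rfl⟩, ?_⟩
        ext i
        simp [hc, g]
    rw [this, AddSubgroup.index_pi]
    simp [Int.index_zmultiples]
  rw [h1, h2, h3, AddSubgroup.index_prod, h4, hrank, AddSubgroup.index_range]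

/-- Multiplicative version of `index_two_fg`. -/
lemma index_sq_fg (G : Type*) [CommGroup G] [hG : Group.FG G] :
    (powMonoidHom 2 : G →* G).range.index =
      2 ^ (Module.finrank ℤ (Additive G)) * Nat.card (powMonoidHom 2 : G →* G).ker := by
  have := index_two_fg (Additive G)
  exact this

lemma finrank_range_of_sq {E A : Type*} [CommGroup E] [CommGroup A] [Group.FG E] [Group.FG A]
    (N : E →* A) (h : ∀ a, ∃ e, N e = a ^ 2) :
    Module.finrank ℤ (Additive N.ker) + Module.finrank ℤ (Additive A) =
      Module.finrank ℤ (Additive E) := by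
  have : Module.Finite ℤ (Additive E) := Module.Finite.iff_addGroup_fg.mpr inferInstance
  have : Module.Finite ℤ (Additive A) := Module.Finite.iff_addGroup_fg.mpr inferInstance
  let f : Additive E →ₗ[ℤ] Additive A := (MonoidHom.toAdditive N).toIntLinearMap
  have h1 := int_rank_nullity f
  let g : Additive A →ₗ[ℤ] Additive A := (2 : ℤ) • LinearMap.id
  have h2 := int_rank_nullity g
  have h3 : Module.finrank ℤ (LinearMap.ker g) = 0 := by
    rw [Module.finrank_eq_zero_iff]
    rintro ⟨x, hx⟩
    refine ⟨2, by norm_num, ?_⟩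
    ext1
    exact hx
  have h4 : LinearMap.range g ≤ LinearMap.range f := by
    rintro _ ⟨x, rfl⟩
    obtain ⟨e, he⟩ := h x.toMul
    refine ⟨Additive.ofMul e, ?_⟩
    change Additive.ofMul (N e) = (2 : ℤ) • x
    rw [he, two_smul, pow_two]
    rfl
  have h5 := Submodule.finrank_mono h4
  have h6 := Submodule.finrank_le (LinearMap.range f)
  have h7 : Module.finrank ℤ (Additive N.ker) = Module.finrank ℤ (LinearMap.ker f) := by
    refine LinearEquiv.finrank_eq (AddEquiv.toIntLinearEquiv ?_)
    exact { toFun := fun x => ⟨Additive.ofMul x.toMul.1, x.toMul.2⟩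
            invFun := fun x => Additive.ofMul ⟨x.1.toMul, x.2⟩
            left_inv := fun x => rfl
            right_inv := fun x => rfl
            map_add' := fun x y => rfl }
  omega

/-- Abstract Herbrand quotient computation for a group with an involution. -/
theorem herbrand_abstract {E A : Type*} [CommGroup E] [CommGroup A] [Group.FG E] [Group.FG A]
    (σ : E →* E) (j : A →* E) (N : E →* A) (hj : Function.Injective j)
    (hN : ∀ u, j (N u) = u * σ u) (hσ : ∀ u, σ (σ u) = u)
    (hfix : ∀ u, σ u = u → ∃ a, j a = u) (hσj : ∀ a, σ (j a) = j a)
    (hrank : Module.finrank ℤ (Additive E) = 2 * Module.finrank ℤ (Additive A) + 1) :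
    2 * N.range.index = (MonoidHom.id E / σ).range.relIndex N.ker ∧ N.range.index ≠ 0 := by
  have hNj : ∀ a, N (j a) = a ^ 2 := by
    intro a
    apply hj
    rw [hN, hσj, map_pow, pow_two]
  have hker : ∀ u, u ∈ N.ker ↔ u * σ u = 1 := by
    intro u
    rw [MonoidHom.mem_ker, ← hN, ← map_one j, hj.eq_iff]
  have hfr := finrank_range_of_sq N (fun a => ⟨j a, hNj a⟩)
  have hfgB : Group.FG N.ker := by
    have : Module.Finite ℤ (Additive E) := Module.Finite.iff_addGroup_fg.mpr inferInstance
    let f : Additive E →ₗ[ℤ] Additive A := (MonoidHom.toAdditive N).toIntLinearMap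
    have h7 : Additive N.ker ≃+ LinearMap.ker f :=
        { toFun := fun x => ⟨Additive.ofMul x.toMul.1, x.toMul.2⟩
          invFun := fun x => Additive.ofMul ⟨x.1.toMul, x.2⟩
          left_inv := fun x => rfl
          right_inv := fun x => rfl
          map_add' := fun x y => rfl }
    have h8 : Module.Finite ℤ (Additive N.ker) := Module.Finite.equiv h7.toIntLinearEquiv.symm
    have h9 : AddGroup.FG (Additive N.ker) := Module.Finite.iff_addGroup_fg.mp h8
    exact GroupFG.iff_add_fg.mpr h9
  have hA := index_sq_fg A
  have hB := index_sq_fg N.ker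
  have htors : Nat.card (powMonoidHom 2 : A →* A).ker = Nat.card (powMonoidHom 2 : N.ker →* N.ker).ker := by
    refine Nat.card_congr (Equiv.ofBijective
      (fun a => ⟨⟨j a.1, ?_⟩, ?_⟩) ⟨?_, ?_⟩)
    · have : a.1 ^ 2 = 1 := a.2
      rw [MonoidHom.mem_ker, hNj, this]
    · have : a.1 ^ 2 = 1 := a.2
      rw [MonoidHom.mem_ker]
      ext1
      simp [← map_pow, this]
    · intro a b hab
      simp only [Subtype.mk.injEq] at hab
      exact Subtype.ext (hj hab)
    · rintro ⟨⟨b, hb⟩, hb2⟩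
      have hb2 : b ^ 2 = 1 := congrArg Subtype.val hb2
      rw [hker] at hb
      have : σ b = b := by
        rw [pow_two] at hb2
        rw [← hb2] at hb
        exact mul_left_cancel hb
      obtain ⟨a, ha⟩ := hfix b this
      refine ⟨⟨a, ?_⟩, ?_⟩
      · rw [MonoidHom.mem_ker]
        apply hj
        simp [ha, hb2]
      · simp [ha]
  have hA0 : (powMonoidHom 2 : A →* A).range.index ≠ 0 := by
    rw [hA]
    have hfin : Finite (powMonoidHom 2 : A →* A).ker := by
      have hfg : Module.Finite ℤ (Additive A) := Module.Finite.iff_addGroup_fg.mpr inferInstance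
      have hfgk : Module.Finite ℤ (LinearMap.ker ((2 : ℤ) • LinearMap.id : Additive A →ₗ[ℤ] Additive A)) :=
        inferInstance
      have := Module.finite_of_fg_torsion (LinearMap.ker ((2 : ℤ) • LinearMap.id : Additive A →ₗ[ℤ] Additive A))
        (by
          rintro ⟨x, hx⟩
          refine ⟨⟨2, by simp⟩, ?_⟩
          ext1
          exact hx)
      exact Finite.of_injective (β := LinearMap.ker ((2 : ℤ) • LinearMap.id : Additive A →ₗ[ℤ] Additive A))
        (fun a => ⟨Additive.ofMul a.1, by
          have h2 : a.1 ^ 2 = 1 := a.2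
          rw [LinearMap.mem_ker]
          change (2 : ℤ) • Additive.ofMul a.1 = 0
          rw [two_smul, ← ofMul_mul, ← pow_two, h2, ofMul_one]⟩) (by
          intro a b hab
          simp only [Subtype.mk.injEq] at hab
          exact Subtype.ext hab)
    exact mul_ne_zero (by positivity) Nat.card_pos.ne'
  set A2 := (powMonoidHom 2 : A →* A).range with hA2
  set D := (MonoidHom.id E / σ).range with hD
  set B2 := (powMonoidHom 2 : N.ker →* N.ker).range.map N.ker.subtype with hB2
  have hBi : B2.relIndex N.ker = (powMonoidHom 2 : N.ker →* N.ker).range.index := by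
    rw [Subgroup.relIndex, hB2, Subgroup.subgroupOf,
      Subgroup.comap_map_eq_self_of_injective N.ker.subtype_injective]
  have h1 : A2 ≤ N.range := by
    rintro _ ⟨a, rfl⟩
    exact ⟨j a, hNj a⟩
  have hmemB2 : ∀ x, x ∈ B2 ↔ ∃ b, b * σ b = 1 ∧ b ^ 2 = x := by
    intro x
    constructor
    · rintro ⟨_, ⟨b, rfl⟩, rfl⟩
      exact ⟨b, (hker _).1 b.2, rfl⟩
    · rintro ⟨b, hb, rfl⟩
      exact ⟨_, ⟨⟨b, (hker _).2 hb⟩, rfl⟩, rfl⟩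
  have h2 : B2 ≤ D := by
    intro x hx
    obtain ⟨b, hb, rfl⟩ := (hmemB2 x).1 hx
    refine ⟨b, ?_⟩
    have : σ b = b⁻¹ := eq_inv_of_mul_eq_one_right hb
    simp [this, pow_two]
  have h3 : D ≤ N.ker := by
    rintro _ ⟨u, rfl⟩
    rw [hker]
    simp [hσ]
  have hX : A2.comap N = B2.comap (MonoidHom.id E / σ) := by
    ext u
    rw [Subgroup.mem_comap, Subgroup.mem_comap, hmemB2]
    constructor
    · rintro ⟨a, ha⟩
      have ha' : u * σ u = (j a) ^ 2 := by rw [← hN, ← ha]; simp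
      refine ⟨u / j a, ?_, ?_⟩
      · rw [map_div, hσj, div_mul_div_comm, ha', pow_two, div_self']
      · simp only [MonoidHom.div_apply, MonoidHom.id_apply]
        rw [div_pow, ← ha', pow_two, mul_div_mul_left_eq_div]
    · rintro ⟨b, hb, hbu⟩
      simp only [MonoidHom.div_apply, MonoidHom.id_apply] at hbu
      have hσb : σ b = b⁻¹ := eq_inv_of_mul_eq_one_right hb
      have hσu : σ u = u / b ^ 2 := by rw [hbu]; simp
      obtain ⟨a, ha⟩ := hfix (u / b) (by
        rw [map_div, hσb, hσu, pow_two]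
        simp [div_eq_mul_inv, mul_assoc])
      refine ⟨a, ?_⟩
      apply hj
      rw [hN, hσu]
      simp [ha, div_pow, pow_two, div_eq_mul_inv, mul_assoc, mul_comm, mul_left_comm]
  have e1 := Subgroup.relIndex_mul_index h1
  have e2 := Subgroup.relIndex_mul_relIndex B2 D N.ker h2 h3
  have e3 : A2.relIndex N.range = B2.relIndex D := by
    rw [← Subgroup.index_comap, hX, Subgroup.index_comap]
  have e4 : B2.relIndex N.ker = 2 * A2.index := by
    rw [hBi, hB, hA, htors]
    have : Module.finrank ℤ (Additive N.ker) = Module.finrank ℤ (Additive A) + 1 := by omega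
    rw [this]
    ring
  rw [e3] at e1
  have hne : B2.relIndex D ≠ 0 := by
    intro h0
    rw [h0, zero_mul] at e1
    exact hA0 e1.symm
  constructor
  · apply Nat.eq_of_mul_eq_mul_left (Nat.pos_of_ne_zero hne)
    rw [e2, e4, ← e1]
    ring
  · intro h0
    rw [h0, mul_zero] at e1
    exact hA0 e1.symm

end

section

/-- A finite commutative group with at most one involution and a nonsquare `x` has cyclic
2-primary component, of order the 2-part of the order of `x`. -/
theorem primaryComponent_cyclic_of_nonsquare {C : Type*} [CommGroup C] [Finite C]
    (h2 : Nat.card {c : C // c ^ 2 = 1} ≤ 2) (x : C) (hx : ∀ y, y ^ 2 ≠ x)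
    (N m : ℕ) (hm : Odd m) (ho : orderOf x = 2 ^ N * m) :
    IsCyclic (CommGroup.primaryComponent C 2) ∧
      Nat.card (CommGroup.primaryComponent C 2) = 2 ^ N := by
  set P := CommGroup.primaryComponent C 2 with hP
  have hxo : orderOf (x ^ m) = 2 ^ N := by
    rw [orderOf_pow_of_dvd hm.pos.ne' (by rw [ho]; exact dvd_mul_left _ _), ho]
    exact Nat.mul_div_cancel _ hm.pos
  have hxP : x ^ m ∈ P := ⟨N, by rw [← hxo, pow_orderOf_eq_one]⟩
  let x' : P := ⟨x ^ m, hxP⟩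
  have hx' : x' ∉ (powMonoidHom 2 : P →* P).range := by
    rintro ⟨y, hy⟩
    have hy : (y : C) ^ 2 = x ^ m := congrArg Subtype.val hy
    obtain ⟨k, rfl⟩ := hm
    apply hx (y * (x ^ k)⁻¹)
    rw [mul_pow, hy, pow_succ, inv_pow, ← pow_mul, mul_comm k 2]
    rw [mul_comm, ← mul_assoc, inv_mul_cancel, one_mul]
  have hidx : (powMonoidHom 2 : P →* P).range.index = 2 := by
    have h1 : (powMonoidHom 2 : P →* P).range.index ≤ 2 := by
      rw [Subgroup.index_range]
      refine le_trans (Nat.card_le_card_of_injective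
        (fun a => (⟨a.1.1, congrArg Subtype.val a.2⟩ : {c : C // c ^ 2 = 1})) ?_) h2
      intro a b hab
      exact Subtype.ext (Subtype.ext (Subtype.mk.inj hab))
    have h0 : (powMonoidHom 2 : P →* P).range.index ≠ 0 := Subgroup.index_ne_zero_of_finite
    have h3 : (powMonoidHom 2 : P →* P).range.index ≠ 1 := by
      intro h
      rw [Subgroup.index_eq_one] at h
      rw [h] at hx'
      exact hx' trivial
    omega
  let Q := Subgroup.zpowers x'
  have hsurj : Function.Surjective (fun y : P ⧸ Q => y ^ 2) := by
    intro y
    induction y using QuotientGroup.induction_on with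
    | H g =>
      by_cases hg : g ∈ (powMonoidHom 2 : P →* P).range
      · obtain ⟨z, hz⟩ := hg
        exact ⟨(z : P ⧸ Q), by rw [← hz]; rfl⟩
      · have : g * x' ∈ (powMonoidHom 2 : P →* P).range := by
          rw [Subgroup.mul_mem_iff_of_index_two hidx]
          simp [hg, hx']
        obtain ⟨z, hz⟩ := this
        refine ⟨(z : P ⧸ Q), ?_⟩
        have hz' : z ^ 2 = g * x' := hz
        show ((z ^ 2 : P) : P ⧸ Q) = g
        rw [hz', QuotientGroup.mk_mul_of_mem]
        exact Subgroup.mem_zpowers x'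
  have hinj : Function.Injective (fun y : P ⧸ Q => y ^ 2) := Finite.injective_iff_surjective.mpr hsurj
  have hinj' : ∀ k : ℕ, ∀ y : P ⧸ Q, y ^ (2 ^ k) = 1 → y = 1 := by
    intro k
    induction k with
    | zero => intro y hy; simpa using hy
    | succ k ih =>
      intro y hy
      apply ih
      apply hinj
      show (y ^ 2 ^ k) ^ 2 = 1 ^ 2
      rw [← pow_mul, ← pow_succ, hy, one_pow]
  have htop : ∀ g : P, g ∈ Q := by
    intro g
    rw [← QuotientGroup.eq_one_iff]
    obtain ⟨k, hk⟩ := g.2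
    apply hinj' k
    rw [← QuotientGroup.mk_pow]
    have : g ^ 2 ^ k = 1 := by
      ext1
      simpa using hk
    rw [this]
    rfl
  refine ⟨⟨x', htop⟩, ?_⟩
  rw [← orderOf_eq_card_of_forall_mem_zpowers htop, ← hxo]
  exact orderOf_injective P.subtype P.subtype_injective x' |>.symm

/-- Existence of the decomposition order = 2-power times odd. -/
lemma exists_two_pow_mul_odd_orderOf {C : Type*} [CommGroup C] [Finite C] (x : C) :
    ∃ N m : ℕ, Odd m ∧ orderOf x = 2 ^ N * m := by
  obtain ⟨k, m, hm, h⟩ := Nat.exists_eq_two_pow_mul_odd (orderOf_pos x).ne'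
  exact ⟨k, m, hm, h⟩

end

section
open NumberField Pointwise

section QuadIdeals

variable {K L : Type*} [Field K] [Field L] [NumberField K] [NumberField L] [Algebra K L]
  [IsGalois K L]

lemma quad_gal_eq (h2 : Module.finrank K L = 2) (σ : L ≃ₐ[K] L) (hσ : σ ≠ 1) (g : L ≃ₐ[K] L) :
    g = 1 ∨ g = σ := by
  have hc : Nat.card (L ≃ₐ[K] L) = 2 := by rw [IsGalois.card_aut_eq_finrank, h2]
  classical
  by_contra h
  push Not at h
  have : Fintype (L ≃ₐ[K] L) := Fintype.ofFinite _
  have h3 : ({1, σ, g} : Finset (L ≃ₐ[K] L)).card ≤ 2 := by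
    rw [← hc, Nat.card_eq_fintype_card]
    exact Finset.card_le_univ _
  rw [Finset.card_eq_three.mpr ⟨1, σ, g, hσ.symm, h.1.symm, h.2.symm, rfl⟩] at h3
  omega

lemma quad_sq (h2 : Module.finrank K L = 2) (σ : L ≃ₐ[K] L) : σ * σ = 1 := by
  have hc : Nat.card (L ≃ₐ[K] L) = 2 := by rw [IsGalois.card_aut_eq_finrank, h2]
  rw [← pow_two, ← hc, pow_card_eq_one']

lemma quad_primesOver (h2 : Module.finrank K L = 2) (σ : L ≃ₐ[K] L) (hσ : σ ≠ 1)
    (P : Ideal (𝓞 L)) [P.IsPrime] (Q : Ideal (𝓞 L)) :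
    Q ∈ (P.under (𝓞 K)).primesOver (𝓞 L) ↔ (Q = P ∨ Q = σ • P) := by
  constructor
  · rintro ⟨h, h'⟩
    obtain ⟨g, hg⟩ := Ideal.exists_smul_eq_of_isGaloisGroup (P.under (𝓞 K)) P Q (L ≃ₐ[K] L)
    rcases quad_gal_eq h2 σ hσ g with rfl | rfl
    · left; rw [← hg, one_smul]
    · right; exact hg.symm
  · rintro (rfl | rfl)
    · exact ⟨inferInstance, inferInstance⟩
    · exact ⟨inferInstance, inferInstance⟩

lemma quad_map_under (h2 : Module.finrank K L = 2) (σ : L ≃ₐ[K] L) (hσ : σ ≠ 1)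
    (P : Ideal (𝓞 L)) [P.IsPrime] (hP : P ≠ ⊥) :
    (σ • P ≠ P ∧ (P.under (𝓞 K)).map (algebraMap (𝓞 K) (𝓞 L)) = P * σ • P) ∨
    (σ • P = P ∧ (P.under (𝓞 K)).map (algebraMap (𝓞 K) (𝓞 L)) = P ∧
      ¬ ∀ x : 𝓞 L, σ • x - x ∈ P) ∨
    (σ • P = P ∧ (P.under (𝓞 K)).map (algebraMap (𝓞 K) (𝓞 L)) = P ^ 2 ∧
      ∀ x : 𝓞 L, σ • x - x ∈ P) := by
  classical
  set p := P.under (𝓞 K) with hp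
  have hp0 : p ≠ ⊥ := Ideal.IsIntegral.comap_ne_bot _ hP
  have hpm : p.IsMaximal := Ideal.IsPrime.isMaximal inferInstance hp0
  have hcount := Ideal.ncard_primesOver_mul_ramificationIdxIn_mul_inertiaDegIn p (𝓞 L) (L ≃ₐ[K] L)
  rw [IsGalois.card_aut_eq_finrank, h2] at hcount
  have hset : p.primesOver (𝓞 L) = {P, σ • P} := by
    ext Q; rw [quad_primesOver h2 σ hσ P Q]; rfl
  have hfac := Ideal.map_algebraMap_eq_finsetProd_pow (R := 𝓞 L) (p := p) hp0
  have hfs : (p.primesOver (𝓞 L)).toFinset = {P, σ • P} := by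
    ext Q; rw [Set.mem_toFinset, hset]; simp
  have he : ∀ Q ∈ p.primesOver (𝓞 L), Q.ramificationIdx (𝓞 K) = p.ramificationIdxIn (𝓞 L) := by
    rintro Q ⟨hQ, hQ'⟩
    exact (Ideal.ramificationIdxIn_eq_ramificationIdx p Q (L ≃ₐ[K] L)).symm
  have hfac2 : Ideal.map (algebraMap (𝓞 K) (𝓞 L)) p =
      ∏ Q ∈ ({P, σ • P} : Finset (Ideal (𝓞 L))), Q ^ p.ramificationIdxIn (𝓞 L) := by
    rw [hfac, hfs]
    refine Finset.prod_congr rfl fun Q hQ => ?_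
    rw [he Q (by rw [hset]; simpa using hQ)]
  by_cases hs : σ • P = P
  · right
    rw [hs, Finset.pair_eq_singleton, Finset.prod_singleton] at hfac2
    rw [hset, hs, Set.pair_eq_singleton, Set.ncard_singleton, one_mul] at hcount
    have hd2 : p.ramificationIdxIn (𝓞 L) ∣ 2 := ⟨_, hcount.symm⟩
    have : PerfectField p.ResidueField := by
      have : Finite (𝓞 K ⧸ p) := Ideal.finiteQuotientOfFreeOfNeBot p hp0
      have hb := Ideal.bijective_algebraMap_quotient_residueField p
      have : Finite p.ResidueField := Finite.of_surjective _ hb.2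
      infer_instance
    have hin := Ideal.card_inertia_eq_ramificationIdxIn (G := L ≃ₐ[K] L) p P
    rcases (Nat.dvd_prime Nat.prime_two).1 hd2 with h | h
    · left
      refine ⟨hs, by rw [hfac2, h, pow_one], ?_⟩
      intro hall
      have hmem : σ ∈ Ideal.inertia (L ≃ₐ[K] L) P := hall
      rw [h, Subgroup.card_eq_one] at hin
      rw [hin, Subgroup.mem_bot] at hmem
      exact hσ hmem
    · right
      refine ⟨hs, by rw [hfac2, h], ?_⟩
      rw [h] at hin
      have htop : Ideal.inertia (L ≃ₐ[K] L) P = ⊤ := by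
        apply Subgroup.eq_top_of_card_eq
        rw [hin, IsGalois.card_aut_eq_finrank, h2]
      have : σ ∈ Ideal.inertia (L ≃ₐ[K] L) P := by rw [htop]; trivial
      exact this
  · left
    refine ⟨hs, ?_⟩
    rw [hset, Set.ncard_pair (Ne.symm hs)] at hcount
    have : p.ramificationIdxIn (𝓞 L) = 1 := by
      have : p.ramificationIdxIn (𝓞 L) * p.inertiaDegIn (𝓞 L) = 1 := by omega
      exact Nat.eq_one_of_mul_eq_one_right this
    rw [hfac2, this, Finset.prod_pair (Ne.symm hs), pow_one, pow_one]

/-- An invariant ideal with even multiplicities at a set containing the ramified primes is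
extended from the base. -/
theorem quad_invariant_ideal (h2 : Module.finrank K L = 2) (σ : L ≃ₐ[K] L) (hσ : σ ≠ 1)
    (T : Finset (Ideal (𝓞 L)))
    (hT : ∀ P : Ideal (𝓞 L), P ∈ T ↔ (P.IsPrime ∧ P ≠ ⊥ ∧ ∀ x : 𝓞 L, σ • x - x ∈ P))
    (I : Ideal (𝓞 L)) (hI0 : I ≠ ⊥) (hI : σ • I = I)
    (hev : ∀ P ∈ T, Even (Multiset.count P (UniqueFactorizationMonoid.normalizedFactors I))) :
    ∃ J : Ideal (𝓞 K), J ≠ ⊥ ∧ J.map (algebraMap (𝓞 K) (𝓞 L)) = I := by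
  classical
  induction hn : Multiset.card (UniqueFactorizationMonoid.normalizedFactors I) using Nat.strong_induction_on generalizing I with
  | _ n ih =>
  subst hn
  by_cases hI1 : IsUnit I
  · refine ⟨⊤, top_ne_bot, ?_⟩
    rw [Ideal.isUnit_iff] at hI1
    rw [hI1, Ideal.map_top]
  have hTs : ∀ Q ∈ T, σ • Q = Q := by
    intro Q hQ
    obtain ⟨hQp, hQ0, hx⟩ := (hT Q).1 hQ
    have hle : σ • Q ≤ Q := by
      intro y hy
      rw [Ideal.mem_pointwise_smul_iff_inv_smul_mem] at hy
      have h3 := hx (σ⁻¹ • y)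
      rw [smul_inv_smul] at h3
      have := Q.add_mem h3 hy
      simpa using this
    have hsQ0 : σ • Q ≠ ⊥ := by
      intro h
      apply hQ0
      have := congrArg (fun Q => σ⁻¹ • Q) h
      simp only [inv_smul_smul] at this
      rw [this]
      exact smul_zero _
    have hsQ : (σ • Q).IsPrime := inferInstance
    exact (hsQ.isMaximal hsQ0).eq_of_le hQp.ne_top hle
  -- extraction step
  have step : ∀ (A B : Ideal (𝓞 L)) (J0 : Ideal (𝓞 K)), J0 ≠ ⊥ → J0.map (algebraMap (𝓞 K) (𝓞 L)) = A →
      I = A * B → ¬ IsUnit A → σ • A = A →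
      (∀ P ∈ T, Even (Multiset.count P (UniqueFactorizationMonoid.normalizedFactors A))) →
      ∃ J : Ideal (𝓞 K), J ≠ ⊥ ∧ J.map (algebraMap (𝓞 K) (𝓞 L)) = I := by
    intro A B J0 hJ0 hA hAB hAu hAs hAe
    have hA0 : A ≠ 0 := by rintro rfl; simp at hAB; exact hI0 hAB
    have hB0 : B ≠ 0 := by rintro rfl; simp at hAB; exact hI0 hAB
    have hnf : UniqueFactorizationMonoid.normalizedFactors I =
        UniqueFactorizationMonoid.normalizedFactors A + UniqueFactorizationMonoid.normalizedFactors B := by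
      rw [hAB, UniqueFactorizationMonoid.normalizedFactors_mul hA0 hB0]
    have hBs : σ • B = B := by
      have h := hI
      rw [hAB, smul_mul', hAs] at h
      exact mul_left_cancel₀ hA0 h
    obtain ⟨J, hJ, hJB⟩ := ih (Multiset.card (UniqueFactorizationMonoid.normalizedFactors B)) (by
        rw [hnf, Multiset.card_add]
        have : 0 < Multiset.card (UniqueFactorizationMonoid.normalizedFactors A) := by
          rw [Multiset.card_pos]
          intro h0
          have := UniqueFactorizationMonoid.normalizedFactors_eq_zero_iff hA0 |>.1 h0
          exact hAu this
        omega) B hB0 hBs (by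
          intro P hPT
          have h1 := hev P hPT
          rw [hnf, Multiset.count_add, Nat.even_add] at h1
          exact h1.1 (hAe P hPT)) rfl
    refine ⟨J0 * J, mul_ne_zero hJ0 hJ, ?_⟩
    rw [Ideal.map_mul, hA, hJB, hAB]
  have hItop : I ≠ ⊤ := fun h => hI1 (by rw [h, Ideal.isUnit_iff])
  obtain ⟨P, hPmax, hIP⟩ := Ideal.exists_le_maximal I hItop
  have hPp : P.IsPrime := hPmax.isPrime
  have hP0 : P ≠ ⊥ := by rintro rfl; exact hI0 (le_bot_iff.mp hIP)
  have hPprime : Prime P := Ideal.prime_of_isPrime hP0 hPp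
  have hPdvd : P ∣ I := Ideal.dvd_iff_le.mpr hIP
  have hcount1 : ∀ Q : Ideal (𝓞 L), Q.IsPrime → Q ≠ ⊥ → UniqueFactorizationMonoid.normalizedFactors Q = {Q} := by
    intro Q hQ hQ0
    have := UniqueFactorizationMonoid.normalizedFactors_irreducible (Ideal.prime_of_isPrime hQ0 hQ).irreducible
    rw [this, normalize_eq]
  have hu0 : P.under (𝓞 K) ≠ ⊥ := Ideal.IsIntegral.comap_ne_bot _ hP0
  have hsP0 : σ • P ≠ ⊥ := by
    intro h
    apply hP0
    have := congrArg (fun Q => σ⁻¹ • Q) h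
    simp only [inv_smul_smul] at this
    rw [this]
    exact smul_zero _
  rcases quad_map_under h2 σ hσ P hP0 with ⟨hs, hmap⟩ | ⟨hs, hmap, hnr⟩ | ⟨hs, hmap, hram⟩
  · have hsPp : (σ • P).IsPrime := inferInstance
    have hsd : σ • P ∣ I := by
      obtain ⟨B, hB⟩ := hPdvd
      rw [← hI, hB, smul_mul']
      exact dvd_mul_right _ _
    obtain ⟨B, hB⟩ := hPdvd
    have : σ • P ∣ B := by
      rw [hB] at hsd
      rcases (Ideal.prime_of_isPrime hsP0 hsPp).dvd_or_dvd hsd with h | h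
      · exfalso
        apply hs
        exact ((Ideal.IsPrime.isMaximal hPp hP0).eq_of_le hsPp.ne_top (Ideal.dvd_iff_le.mp h)).symm
      · exact h
    obtain ⟨B', hB'⟩ := this
    refine step (P * σ • P) B' _ hu0 hmap (by rw [hB, hB', mul_assoc]) ?_ ?_ ?_
    · intro h; exact hPprime.not_unit (isUnit_of_mul_isUnit_left h)
    · rw [smul_mul', smul_smul, quad_sq h2, one_smul, mul_comm]
    · intro Q hQT
      rw [UniqueFactorizationMonoid.normalizedFactors_mul hP0 hsP0, hcount1 P hPp hP0, hcount1 _ hsPp hsP0]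
      have hQs := hTs Q hQT
      have n1 : Q ≠ P := by rintro rfl; exact hs hQs
      have n2 : Q ≠ σ • P := by
        rintro rfl
        rw [smul_smul, quad_sq h2, one_smul] at hQs
        exact hs hQs.symm
      rw [Multiset.count_add, Multiset.count_singleton, Multiset.count_singleton, if_neg n1, if_neg n2]
      exact Even.zero
  · obtain ⟨B, hB⟩ := hPdvd
    have hPT : P ∉ T := fun h => hnr ((hT P).1 h).2.2
    refine step P B _ hu0 hmap hB hPprime.not_unit hs ?_
    intro Q hQT
    rw [hcount1 P hPp hP0, Multiset.count_singleton, if_neg (by rintro rfl; exact hPT hQT)]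
    exact Even.zero
  · have hPT : P ∈ T := (hT P).2 ⟨hPp, hP0, hram⟩
    have h1 := hev P hPT
    have h2' : 2 ≤ Multiset.count P (UniqueFactorizationMonoid.normalizedFactors I) := by
      have : 0 < Multiset.count P (UniqueFactorizationMonoid.normalizedFactors I) := by
        rw [Multiset.count_pos]
        obtain ⟨Q, hQ, hPQ⟩ := UniqueFactorizationMonoid.exists_mem_normalizedFactors_of_dvd hI0
          hPprime.irreducible hPdvd
        rwa [associated_iff_eq.mp hPQ]
      obtain ⟨k, hk⟩ := h1
      omega
    have hd : P ^ 2 ∣ I := by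
      rw [UniqueFactorizationMonoid.dvd_iff_normalizedFactors_le_normalizedFactors (pow_ne_zero 2 hP0) hI0,
        UniqueFactorizationMonoid.normalizedFactors_pow, hcount1 P hPp hP0, Multiset.nsmul_singleton]
      exact Multiset.le_count_iff_replicate_le.mp h2'
    obtain ⟨B, hB⟩ := hd
    refine step (P ^ 2) B _ hu0 hmap hB ?_ ?_ ?_
    · intro h; exact hPprime.not_unit ((isUnit_pow_iff two_ne_zero).mp h)
    · rw [smul_pow', hs]
    · intro Q hQT
      rw [UniqueFactorizationMonoid.normalizedFactors_pow, Multiset.count_nsmul]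
      exact even_two_mul _

end QuadIdeals

end

section
open NumberField Pointwise

section Icls
variable {R : Type*} [CommRing R] [IsDomain R] [IsDedekindDomain R]

open Classical in
/-- Class of an ideal (junk value `1` at the zero ideal). -/
noncomputable def icls (I : Ideal R) : ClassGroup R :=
  if h : I = ⊥ then 1 else ClassGroup.mk0 ⟨I, mem_nonZeroDivisors_of_ne_zero h⟩

lemma icls_of_ne {I : Ideal R} (h : I ≠ ⊥) :
    icls I = ClassGroup.mk0 ⟨I, mem_nonZeroDivisors_of_ne_zero h⟩ := dif_neg h

lemma icls_mul {I J : Ideal R} (hI : I ≠ ⊥) (hJ : J ≠ ⊥) : icls (I * J) = icls I * icls J := by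
  rw [icls_of_ne hI, icls_of_ne hJ, icls_of_ne (mul_ne_zero hI hJ), ← map_mul]
  rfl

lemma icls_one : icls (1 : Ideal R) = 1 := by
  rw [icls_of_ne one_ne_zero]
  exact map_one ClassGroup.mk0

lemma icls_pow {I : Ideal R} (hI : I ≠ ⊥) (n : ℕ) : icls (I ^ n) = icls I ^ n := by
  induction n with
  | zero => rw [pow_zero, pow_zero, icls_one]
  | succ n ih => rw [pow_succ, pow_succ, icls_mul (pow_ne_zero n hI) hI, ih]

lemma icls_eq_one_iff {I : Ideal R} (hI : I ≠ ⊥) : icls I = 1 ↔ ∃ x, x ≠ 0 ∧ I = Ideal.span {x} := by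
  rw [icls_of_ne hI, ClassGroup.mk0_eq_one_iff]
  constructor
  · rintro ⟨x, hx⟩
    refine ⟨x, ?_, hx⟩
    rintro rfl
    apply hI
    rw [hx]
    simp
  · rintro ⟨x, -, hx⟩
    exact ⟨x, hx⟩

lemma icls_span {x : R} (hx : x ≠ 0) : icls (Ideal.span {x}) = 1 := by
  rw [icls_eq_one_iff (by simpa using hx)]
  exact ⟨x, hx, rfl⟩

lemma icls_surj (c : ClassGroup R) : ∃ I : Ideal R, I ≠ ⊥ ∧ icls I = c := by
  obtain ⟨⟨I, hI⟩, rfl⟩ := ClassGroup.mk0_surjective c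
  exact ⟨I, nonZeroDivisors.ne_zero hI, icls_of_ne (nonZeroDivisors.ne_zero hI)⟩

lemma ideal_sq_inj {I J : Ideal R} (hI : I ≠ ⊥) (hJ : J ≠ ⊥) (h : I ^ 2 = J ^ 2) : I = J := by
  have h1 := congrArg UniqueFactorizationMonoid.normalizedFactors h
  rw [UniqueFactorizationMonoid.normalizedFactors_pow, UniqueFactorizationMonoid.normalizedFactors_pow] at h1
  have h2 : UniqueFactorizationMonoid.normalizedFactors I = UniqueFactorizationMonoid.normalizedFactors J := by
    classical
    ext P
    have := congrArg (Multiset.count P) h1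
    rw [Multiset.count_nsmul, Multiset.count_nsmul] at this
    omega
  have := (UniqueFactorizationMonoid.associated_iff_normalizedFactors_eq_normalizedFactors hI hJ).2 h2
  exact associated_iff_eq.mp this

lemma span_sing_ne {x : R} (hx : x ≠ 0) : Ideal.span {x} ≠ (⊥ : Ideal R) := by simpa using hx

end Icls

lemma odd_group_sq {C : Type*} [CommGroup C] (h : Odd (Nat.card C)) (c : C) (hc : c ^ 2 = 1) : c = 1 := by
  have h1 : c ^ Nat.card C = 1 := pow_card_eq_one'
  obtain ⟨k, hk⟩ := h
  rw [hk, pow_succ, pow_mul, hc, one_pow, one_mul] at h1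
  exact h1

section Genus

variable {K L : Type*} [Field K] [Field L] [NumberField K] [NumberField L] [Algebra K L]
  [IsGalois K L]

lemma quad_norm (h2 : Module.finrank K L = 2) (σ : L ≃ₐ[K] L) (hσ : σ ≠ 1) (z : L) :
    algebraMap K L (Algebra.norm K z) = z * σ z := by
  classical
  rw [Algebra.norm_eq_prod_automorphisms]
  have : (Finset.univ : Finset (L ≃ₐ[K] L)) = {1, σ} := by
    ext g
    simp only [Finset.mem_univ, Finset.mem_insert, Finset.mem_singleton, true_iff]
    exact quad_gal_eq h2 σ hσ g
  rw [this, Finset.prod_pair (Ne.symm hσ)]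
  rfl

lemma quad_intNorm (h2 : Module.finrank K L = 2) (σ : L ≃ₐ[K] L) (hσ : σ ≠ 1) (z : 𝓞 L) :
    algebraMap (𝓞 K) (𝓞 L) (Algebra.intNorm (𝓞 K) (𝓞 L) z) = z * σ • z := by
  apply RingOfIntegers.ext
  have h := Algebra.algebraMap_intNorm (K := K) (L := L) (A := 𝓞 K) (B := 𝓞 L) z
  have h' := quad_norm h2 σ hσ (z : L)
  change algebraMap K L (algebraMap (𝓞 K) K (Algebra.intNorm (𝓞 K) (𝓞 L) z)) = z * σ z
  rw [h]
  exact h'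

lemma smul_span_sing (σ : L ≃ₐ[K] L) (x : 𝓞 L) : σ • (Ideal.span {x}) = Ideal.span {σ • x} := by
  rw [Ideal.pointwise_smul_def, Ideal.map_span]; simp

/-- Integral Hilbert 90 for quadratic extensions. -/
lemma quad_hilbert90 (h2 : Module.finrank K L = 2) (σ : L ≃ₐ[K] L) (hσ : σ ≠ 1) (w : L)
    (hw : w * σ w = 1) : ∃ z : 𝓞 L, z ≠ 0 ∧ (z : L) = w * σ z := by
  have key : ∃ z : L, z ≠ 0 ∧ z = w * σ z := by
    by_cases h : w = -1
    · have : ∃ x, σ x ≠ x := by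
        by_contra hh
        push Not at hh
        exact hσ (AlgEquiv.ext hh)
      obtain ⟨x, hx⟩ := this
      refine ⟨σ x - x, sub_ne_zero.mpr hx, ?_⟩
      have : σ (σ x) = x := by
        have := quad_sq h2 σ
        exact congrArg (fun f => f x) this
      rw [h, map_sub, this]
      ring
    · refine ⟨1 + w, ?_, ?_⟩
      · intro h0
        apply h
        linear_combination h0
      · rw [map_add, map_one, mul_add, hw]
        ring
  obtain ⟨z, hz0, hz⟩ := key
  have halg : IsAlgebraic ℤ z := by
    have := Algebra.IsAlgebraic.isAlgebraic (R := ℚ) z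
    exact (IsFractionRing.isAlgebraic_iff ℤ ℚ L).mpr this
  obtain ⟨y, hy, h_intg⟩ := halg.exists_integral_multiple
  refine ⟨⟨y • z, h_intg⟩, ?_, ?_⟩
  · intro h
    have := congrArg (fun t : 𝓞 L => (t : L)) h
    simp [hy, hz0] at this
  · change y • z = w * σ (y • z)
    rw [map_zsmul, mul_smul_comm, ← hz]

variable (K) in
/-- Norm on units. -/
noncomputable def uNorm (L : Type*) [Field L] [NumberField L] [Algebra K L] [IsGalois K L] :
    (𝓞 L)ˣ →* (𝓞 K)ˣ := Units.map (Algebra.intNorm (𝓞 K) (𝓞 L))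

/-- Galois action on units. -/
noncomputable def uSig (σ : L ≃ₐ[K] L) : (𝓞 L)ˣ →* (𝓞 L)ˣ :=
  Units.map (MulSemiringAction.toRingHom (L ≃ₐ[K] L) (𝓞 L) σ : 𝓞 L →* 𝓞 L)

variable (K L) in
/-- Units of `K` that are norms of elements of `L`. -/
noncomputable def uH : Subgroup (𝓞 K)ˣ :=
  Subgroup.comap (Units.map (algebraMap (𝓞 K) K : 𝓞 K →* K))
    (Units.map (Algebra.norm K : L →* K)).range

lemma mem_uH (η : (𝓞 K)ˣ) : η ∈ uH K L ↔ ∃ z : L, Algebra.norm K z = ((η : 𝓞 K) : K) := by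
  rw [uH, Subgroup.mem_comap]
  constructor
  · rintro ⟨z, hz⟩
    exact ⟨z, congrArg Units.val hz⟩
  · rintro ⟨z, hz⟩
    have hz0 : z ≠ 0 := by
      rintro rfl
      rw [Algebra.norm_zero] at hz
      exact η.ne_zero (RingOfIntegers.ext hz.symm)
    exact ⟨Units.mk0 z hz0, Units.ext hz⟩

lemma uNorm_incl (h2 : Module.finrank K L = 2) (σ : L ≃ₐ[K] L) (hσ : σ ≠ 1) (u : (𝓞 L)ˣ) :
    algebraMap (𝓞 K) (𝓞 L) (uNorm K L u : 𝓞 K) = (u : 𝓞 L) * (uSig σ u : 𝓞 L) :=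
  quad_intNorm h2 σ hσ u

lemma uNorm_range_le : (uNorm K L).range ≤ uH K L := by
  rintro _ ⟨u, rfl⟩
  rw [mem_uH]
  refine ⟨((u : 𝓞 L) : L), ?_⟩
  exact (Algebra.algebraMap_intNorm (K := K) (L := L) (A := 𝓞 K) (B := 𝓞 L) u).symm

/-- Step 1: data attached to a 2-torsion class. -/
lemma genus_data (h2 : Module.finrank K L = 2)
    (hodd : Odd (Nat.card (ClassGroup (𝓞 K)))) (c : ClassGroup (𝓞 L)) (hc : c ^ 2 = 1) :
    ∃ (a : Ideal (𝓞 L)) (x : 𝓞 L) (y : 𝓞 K) (η : (𝓞 K)ˣ), a ≠ ⊥ ∧ x ≠ 0 ∧ y ≠ 0 ∧ icls a = c ∧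
      a ^ 2 = Ideal.span {x} ∧ Algebra.intNorm (𝓞 K) (𝓞 L) x = η * y ^ 2 ∧ η ∈ uH K L := by
  obtain ⟨a, ha, rfl⟩ := icls_surj c
  rw [← icls_pow ha, icls_eq_one_iff (pow_ne_zero 2 ha)] at hc
  obtain ⟨x, hx, hax⟩ := hc
  have h1 : Ideal.relNorm (𝓞 K) a ^ 2 = Ideal.span {Algebra.intNorm (𝓞 K) (𝓞 L) x} := by
    rw [← map_pow, hax, Ideal.relNorm_singleton]
  have hna : Ideal.relNorm (𝓞 K) a ≠ ⊥ := by
    rw [Ne, Ideal.relNorm_eq_bot_iff]; exact ha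
  have hnx : Algebra.intNorm (𝓞 K) (𝓞 L) x ≠ 0 := by
    intro h
    rw [h] at h1
    apply hna
    have : Ideal.relNorm (𝓞 K) a ^ 2 = 0 := by rw [h1]; simp
    exact pow_eq_zero_iff two_ne_zero |>.1 this
  have h3 : icls (Ideal.relNorm (𝓞 K) a) = 1 := by
    apply odd_group_sq hodd
    rw [← icls_pow hna, h1, icls_span hnx]
  obtain ⟨y, hy, hay⟩ := (icls_eq_one_iff hna).1 h3
  rw [hay, Ideal.span_singleton_pow, Ideal.span_singleton_eq_span_singleton] at h1
  obtain ⟨η, hη⟩ := h1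
  refine ⟨a, x, y, η, ha, hx, hy, rfl, hax, by rw [← hη, mul_comm], ?_⟩
  rw [mem_uH]
  refine ⟨(x : L) / algebraMap K L (y : K), ?_⟩
  have hyK : (y : K) ≠ 0 := by simpa using hy
  have hyL : algebraMap K L (y : K) ≠ 0 := by simpa using hy
  have h4 : Algebra.norm K ((x : L) / algebraMap K L (y : K)) * (y : K) ^ 2 = Algebra.norm K (x : L) := by
    rw [← h2, ← Algebra.norm_algebraMap (S := L) (y : K), ← map_mul, div_mul_cancel₀ _ hyL]
  have h := Algebra.algebraMap_intNorm (K := K) (L := L) (A := 𝓞 K) (B := 𝓞 L) x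
  rw [← hη, map_mul, map_pow] at h
  have h5 : (y : K) ^ 2 * ((η : 𝓞 K) : K) = Algebra.norm K (x : L) := h
  rw [← h5, mul_comm] at h4
  exact mul_left_cancel₀ (pow_ne_zero 2 hyK) h4

/-- Step 2: two classes with the same invariant differ by an invariant ideal class. -/
lemma genus_step2 (h2 : Module.finrank K L = 2) (σ : L ≃ₐ[K] L) (hσ : σ ≠ 1)
    (a a' : Ideal (𝓞 L)) (x x' : 𝓞 L) (y y' : 𝓞 K) (η η' : (𝓞 K)ˣ)
    (ha : a ≠ ⊥) (ha' : a' ≠ ⊥) (hx : x ≠ 0) (hx' : x' ≠ 0) (hy : y ≠ 0) (hy' : y' ≠ 0)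
    (hax : a ^ 2 = Ideal.span {x}) (hax' : a' ^ 2 = Ideal.span {x'})
    (hn : Algebra.intNorm (𝓞 K) (𝓞 L) x = η * y ^ 2)
    (hn' : Algebra.intNorm (𝓞 K) (𝓞 L) x' = η' * y' ^ 2)
    (ε : (𝓞 L)ˣ) (hε : η = η' * uNorm K L ε) :
    ∃ I : Ideal (𝓞 L), I ≠ ⊥ ∧ σ • I = I ∧ icls I = icls a * icls a' := by
  -- images in `L`
  have hxL : (x : L) ≠ 0 := by simpa using hx
  have hxL' : (x' : L) ≠ 0 := by simpa using hx'
  have e1 : (x : L) * σ x = algebraMap K L ((η : 𝓞 K) : K) * (algebraMap K L (y : K)) ^ 2 := by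
    have := congrArg (fun t : 𝓞 L => (t : L)) (quad_intNorm h2 σ hσ x)
    rw [hn] at this
    simp only [map_mul, map_pow] at this
    exact this.symm
  have e2 : (x' : L) * σ x' = algebraMap K L ((η' : 𝓞 K) : K) * (algebraMap K L (y' : K)) ^ 2 := by
    have := congrArg (fun t : 𝓞 L => (t : L)) (quad_intNorm h2 σ hσ x')
    rw [hn'] at this
    simp only [map_mul, map_pow] at this
    exact this.symm
  have e3 : algebraMap K L ((η : 𝓞 K) : K) = algebraMap K L ((η' : 𝓞 K) : K) * (((ε : 𝓞 L) : L) * σ (ε : 𝓞 L)) := by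
    have := congrArg (fun t : 𝓞 L => (t : L)) (uNorm_incl h2 σ hσ ε)
    rw [hε, Units.val_mul]
    simp only [map_mul] at this ⊢
    rw [← show algebraMap K L (((uNorm K L ε : 𝓞 K)) : K) = ((ε : 𝓞 L) : L) * σ (ε : 𝓞 L) from this]
  have hYne : algebraMap K L (y : K) ≠ 0 := by simpa using hy
  have hYne' : algebraMap K L (y' : K) ≠ 0 := by simpa using hy'
  have hεne : ((ε : 𝓞 L) : L) ≠ 0 := by simpa using ε.ne_zero
  have hηne : algebraMap K L ((η' : 𝓞 K) : K) ≠ 0 := by simpa using η'.ne_zero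
  set X : L := (x : L) with hX
  set X' : L := (x' : L) with hX'
  set Y := algebraMap K L (y : K) with hY
  set Y' := algebraMap K L (y' : K) with hY'
  set H := algebraMap K L ((η : 𝓞 K) : K) with hH
  set H' := algebraMap K L ((η' : 𝓞 K) : K) with hH'
  set Ee : L := ((ε : 𝓞 L) : L) with hEe
  have hsE : σ Ee ≠ 0 := by simpa using hεne
  have hsX : σ X ≠ 0 := by simpa using hxL
  have hsX' : σ X' ≠ 0 := by simpa using hxL'
  have hsY : σ Y = Y := AlgEquiv.commutes _ _
  have hsY' : σ Y' = Y' := AlgEquiv.commutes _ _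
  have hsH' : σ H' = H' := AlgEquiv.commutes _ _
  obtain ⟨z, hz0, hz⟩ := quad_hilbert90 h2 σ hσ (X * X' / (Y * Y' * H' * Ee)) (by
    simp only [map_div₀, map_mul, hsY, hsY', hsH']
    rw [div_mul_div_comm, div_eq_one_iff_eq (by simp [*])]
    calc X * X' * (σ X * σ X') = (X * σ X) * (X' * σ X') := by ring
      _ = _ := by rw [e1, e2, e3]; ring)
  have hsz0 : σ • z ≠ 0 := by
    intro h; apply hz0; rwa [smul_eq_zero_iff_eq] at h
  set I := a * a' * Ideal.span {σ • z} with hI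
  have hI0 : I ≠ ⊥ := mul_ne_zero (mul_ne_zero ha ha') (span_sing_ne hsz0)
  have hsI0 : σ • I ≠ ⊥ := by
    intro h; apply hI0
    have := congrArg (fun Q => σ⁻¹ • Q) h
    simp only [inv_smul_smul] at this
    rw [this]
    exact smul_zero _
  refine ⟨I, hI0, ?_, ?_⟩
  · apply ideal_sq_inj hsI0 hI0
    rw [← smul_pow']
    have hI2 : I ^ 2 = Ideal.span {x * x' * (σ • z) ^ 2} := by
      rw [hI, mul_pow, mul_pow, hax, hax', Ideal.span_singleton_pow, Ideal.span_singleton_mul_span_singleton,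
        Ideal.span_singleton_mul_span_singleton]
    rw [hI2, smul_span_sing, Ideal.span_singleton_eq_span_singleton]
    have : Associated (x * x' * (σ • z) ^ 2) (σ • (x * x' * (σ • z) ^ 2)) := by
      refine ⟨uSig σ ε * ε⁻¹, ?_⟩
      rw [Units.val_mul, ← mul_assoc]
      rw [Units.mul_inv_eq_iff_eq_mul]
      apply RingOfIntegers.ext
      have hss : σ (σ (z : L)) = z := congrArg (fun f => f (z : L)) (quad_sq h2 σ)
      change X * X' * (σ z) ^ 2 * σ Ee = σ (X * X' * (σ z) ^ 2) * Ee
      rw [map_mul, map_mul, map_pow, hss]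
      generalize σ (z : L) = s at hz
      rw [hz]
      field_simp
      calc s ^ 2 * σ Ee * Y ^ 2 * Y' ^ 2 * H' ^ 2 * Ee = (H' * (Ee * σ Ee) * Y ^ 2) * (H' * Y' ^ 2) * s ^ 2 := by ring
        _ = _ := by rw [← e3, ← e1, ← e2]; ring
    exact this.symm
  · rw [hI, icls_mul (mul_ne_zero ha ha') (span_sing_ne hsz0), icls_mul ha ha', icls_span hsz0, mul_one]

/-- If the extension of `J` has 2-torsion class and `h(K)` is odd, then `J` is principal. -/
lemma genus_ext_principal (h2 : Module.finrank K L = 2)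
    (hodd : Odd (Nat.card (ClassGroup (𝓞 K)))) (J : Ideal (𝓞 K)) (hJ : J ≠ ⊥)
    (h : icls (J.map (algebraMap (𝓞 K) (𝓞 L))) ^ 2 = 1) :
    ∃ y, y ≠ 0 ∧ J = Ideal.span {y} := by
  have hm : J.map (algebraMap (𝓞 K) (𝓞 L)) ≠ ⊥ := by
    rw [Ne, Ideal.map_eq_bot_iff_of_injective (FaithfulSMul.algebraMap_injective _ _)]
    exact hJ
  rw [← icls_pow hm, icls_eq_one_iff (pow_ne_zero 2 hm)] at h
  obtain ⟨x, hx, hmx⟩ := h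
  have h1 := congrArg (Ideal.relNorm (𝓞 K)) hmx
  rw [map_pow, Ideal.relNorm_algebraMap, ← IsFractionRing.finrank_eq (𝓞 K) K (𝓞 L) L, h2,
    Ideal.relNorm_singleton] at h1
  have hJ2 : J ^ 2 ≠ ⊥ := pow_ne_zero 2 hJ
  have hnx : Algebra.intNorm (𝓞 K) (𝓞 L) x ≠ 0 := by
    intro h
    rw [h] at h1
    have : (J ^ 2) ^ 2 = 0 := by rw [h1]; simp
    exact hJ2 (pow_eq_zero_iff two_ne_zero |>.1 this)
  rw [← icls_eq_one_iff hJ]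
  apply odd_group_sq hodd
  rw [← icls_pow hJ]
  apply odd_group_sq hodd
  rw [← icls_pow hJ2, h1, icls_span hnx]

end Genus

end

section
open NumberField Pointwise

section Genus2

variable {K L : Type*} [Field K] [Field L] [NumberField K] [NumberField L] [Algebra K L]
  [IsGalois K L]

open Classical in
/-- Parities of the multiplicities at the primes in `T`. -/
noncomputable def parityVec {R : Type*} [CommRing R] [IsDomain R] [IsDedekindDomain R]
    (T : Finset (Ideal R)) (I : Ideal R) : T → ZMod 2 :=
  fun P => (Multiset.count P.1 (UniqueFactorizationMonoid.normalizedFactors I) : ZMod 2)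

lemma parityVec_mul {R : Type*} [CommRing R] [IsDomain R] [IsDedekindDomain R]
    (T : Finset (Ideal R)) {I J : Ideal R} (hI : I ≠ ⊥) (hJ : J ≠ ⊥) :
    parityVec T (I * J) = parityVec T I + parityVec T J := by
  funext P
  simp only [parityVec, Pi.add_apply]
  rw [UniqueFactorizationMonoid.normalizedFactors_mul hI hJ, Multiset.count_add]
  push_cast
  rfl

lemma parityVec_ext (h2 : Module.finrank K L = 2) (σ : L ≃ₐ[K] L) (hσ : σ ≠ 1)
    (T : Finset (Ideal (𝓞 L)))
    (hT : ∀ P : Ideal (𝓞 L), P ∈ T ↔ (P.IsPrime ∧ P ≠ ⊥ ∧ ∀ x : 𝓞 L, σ • x - x ∈ P))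
    (I : Ideal (𝓞 L)) (hI0 : I ≠ ⊥) (hI : σ • I = I) (hv : parityVec T I = 0) :
    ∃ J : Ideal (𝓞 K), J ≠ ⊥ ∧ J.map (algebraMap (𝓞 K) (𝓞 L)) = I := by
  apply quad_invariant_ideal h2 σ hσ T hT I hI0 hI
  intro P hP
  have := congrFun hv ⟨P, hP⟩
  simp only [parityVec, Pi.zero_apply] at this
  rw [ZMod.natCast_eq_zero_iff] at this
  convert even_iff_two_dvd.mpr this

lemma uker_hilbert (h2 : Module.finrank K L = 2) (σ : L ≃ₐ[K] L) (hσ : σ ≠ 1)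
    (u : (uNorm K L).ker) : ∃ β : 𝓞 L, β ≠ 0 ∧ σ • β = (u : (𝓞 L)ˣ) * β := by
  have hu := u.2
  rw [MonoidHom.mem_ker] at hu
  have h1 := uNorm_incl h2 σ hσ u
  rw [hu] at h1
  have h1' : (1 : L) = ((u : (𝓞 L)ˣ) : 𝓞 L) * σ ((u : (𝓞 L)ˣ) : 𝓞 L) := by
    have := congrArg (fun t : 𝓞 L => (t : L)) h1
    simp only [Units.val_one, map_one, map_mul] at this
    exact this
  have hss : ∀ z : L, σ (σ z) = z := fun z => congrArg (fun f => f z) (quad_sq h2 σ)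
  obtain ⟨z, hz0, hz⟩ := quad_hilbert90 h2 σ hσ (σ (((u : (𝓞 L)ˣ) : 𝓞 L) : L)) (by
    rw [hss, mul_comm, ← h1'])
  refine ⟨z, hz0, ?_⟩
  apply RingOfIntegers.ext
  have : σ (z : L) = (((u : (𝓞 L)ˣ) : 𝓞 L) : L) * z := by
    conv_rhs => rw [hz]
    rw [← mul_assoc, ← h1', one_mul]
  exact this

theorem genus_bound (h2 : Module.finrank K L = 2) (σ : L ≃ₐ[K] L) (hσ : σ ≠ 1)
    (hodd : Odd (Nat.card (ClassGroup (𝓞 K))))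
    (T : Finset (Ideal (𝓞 L)))
    (hT : ∀ P : Ideal (𝓞 L), P ∈ T ↔ (P.IsPrime ∧ P ≠ ⊥ ∧ ∀ x : 𝓞 L, σ • x - x ∈ P))
    (hfin : (uNorm K L).range.relIndex (uH K L) ≠ 0) :
    Nat.card {c : ClassGroup (𝓞 L) // c ^ 2 = 1} *
      (MonoidHom.id _ / uSig σ).range.relIndex (uNorm K L).ker ≤
      (uNorm K L).range.relIndex (uH K L) * 2 ^ T.card := by
  classical
  choose β hβ0 hβ using uker_hilbert h2 σ hσ
  have hdata := fun c : {c : ClassGroup (𝓞 L) // c ^ 2 = 1} => genus_data h2 hodd c.1 c.2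
  choose a x y η ha hx hy hcls hax hn hηH using hdata
  let B := (uH K L) ⧸ ((uNorm K L).range.subgroupOf (uH K L))
  let A := (uNorm K L).ker ⧸ ((MonoidHom.id _ / uSig σ).range.subgroupOf (uNorm K L).ker)
  have hBfin : Finite B := Nat.finite_of_card_ne_zero hfin
  let f : {c : ClassGroup (𝓞 L) // c ^ 2 = 1} → B := fun c => QuotientGroup.mk ⟨η c, hηH c⟩
  have hf : ∀ c c', f c = f c' → ∃ I : Ideal (𝓞 L), I ≠ ⊥ ∧ σ • I = I ∧ icls I = c.1 * c'.1 := by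
    intro c c' h
    have h' : (⟨η c', hηH c'⟩ : uH K L)⁻¹ * ⟨η c, hηH c⟩ ∈ (uNorm K L).range.subgroupOf (uH K L) :=
      QuotientGroup.eq.1 h.symm
    rw [Subgroup.mem_subgroupOf] at h'
    obtain ⟨ε, hε⟩ := h'
    simp only [Subgroup.coe_mul, Subgroup.coe_inv] at hε
    obtain ⟨I, hI0, hI, hIc⟩ := genus_step2 h2 σ hσ (a c) (a c') (x c) (x c') (y c) (y c') (η c) (η c')
      (ha c) (ha c') (hx c) (hx c') (hy c) (hy c') (hax c) (hax c') (hn c) (hn c') ε (by rw [hε]; simp)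
    exact ⟨I, hI0, hI, by rw [hIc, hcls, hcls]⟩
  -- choose a base point in each nonempty fibre
  let c0 : B → {c : ClassGroup (𝓞 L) // c ^ 2 = 1} := fun b =>
    if h : ∃ c, f c = b then h.choose else ⟨1, one_pow 2⟩
  have hc0 : ∀ c, f c = f (c0 (f c)) := by
    intro c
    have h : ∃ c', f c' = f c := ⟨c, rfl⟩
    simp only [c0, dif_pos h]
    exact h.choose_spec.symm
  have hI' := fun c => hf c (c0 (f c)) (hc0 c)
  choose I hI0 hIs hIc using hI'
  have hsβ : ∀ u, σ • Ideal.span {β u} = Ideal.span {β u} := by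
    intro u
    rw [smul_span_sing, hβ, Ideal.span_singleton_mul_left_unit (Units.isUnit _)]
  have hadd : ∀ v w : T → ZMod 2, v = w → v + w = 0 := by
    rintro v _ rfl
    funext P
    exact CharTwo.add_self_eq_zero _
  let Φ : {c : ClassGroup (𝓞 L) // c ^ 2 = 1} × A → B × (T → ZMod 2) := fun q =>
    (f q.1, parityVec T (I q.1 * Ideal.span {β q.2.out}))
  have hΦ : Function.Injective Φ := by
    rintro ⟨c, u⟩ ⟨c', u'⟩ h
    simp only [Φ, Prod.mk.injEq] at h
    obtain ⟨hfc, hpar⟩ := h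
    have hb1 := span_sing_ne (hβ0 u.out)
    have hb2 := span_sing_ne (hβ0 u'.out)
    have hcc : c = c' := by
      have hz := hadd _ _ hpar
      rw [← parityVec_mul T (mul_ne_zero (hI0 c) hb1) (mul_ne_zero (hI0 c') hb2)] at hz
      obtain ⟨J, hJ, hJm⟩ := parityVec_ext h2 σ hσ T hT _ (mul_ne_zero (mul_ne_zero (hI0 c) hb1)
        (mul_ne_zero (hI0 c') hb2)) (by simp only [smul_mul', hIs, hsβ]) hz
      have hcl : icls (J.map (algebraMap (𝓞 K) (𝓞 L))) = c.1 * c'.1 := by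
        rw [hJm, icls_mul (mul_ne_zero (hI0 c) hb1) (mul_ne_zero (hI0 c') hb2), icls_mul (hI0 c) hb1,
          icls_mul (hI0 c') hb2, icls_span (hβ0 _), icls_span (hβ0 _), mul_one, mul_one, hIc, hIc, hfc]
        have := (c0 (f c')).2
        rw [mul_mul_mul_comm, ← pow_two (c0 (f c')).1, this, mul_one]
      obtain ⟨y, hy, hJy⟩ := genus_ext_principal h2 hodd J hJ (by
        rw [hcl, mul_pow, c.2, c'.2, one_mul])
      have h1 : c.1 * c'.1 = 1 := by
        rw [← hcl, hJy, Ideal.map_span, Set.image_singleton]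
        apply icls_span
        rw [Ne, FaithfulSMul.algebraMap_eq_zero_iff]
        exact hy
      have h3 := c'.2
      rw [pow_two] at h3
      exact Subtype.ext (mul_right_cancel (h1.trans h3.symm))
    subst hcc
    rw [parityVec_mul T (hI0 c) hb1, parityVec_mul T (hI0 c) hb2] at hpar
    have hpar' := add_left_cancel hpar
    have huu : u = u' := by
      have hz := hadd _ _ hpar'
      rw [← parityVec_mul T hb1 hb2] at hz
      obtain ⟨J, hJ, hJm⟩ := parityVec_ext h2 σ hσ T hT _ (mul_ne_zero hb1 hb2)
        (by simp only [smul_mul', hsβ]) hz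
      obtain ⟨y, hy, hJy⟩ := genus_ext_principal h2 hodd J hJ (by
        rw [hJm, icls_mul hb1 hb2, icls_span (hβ0 _), icls_span (hβ0 _)]; simp)
      rw [hJy, Ideal.map_span, Set.image_singleton, Ideal.span_singleton_mul_span_singleton,
        Ideal.span_singleton_eq_span_singleton] at hJm
      obtain ⟨ε, hε⟩ := hJm
      have hyL : algebraMap (𝓞 K) (𝓞 L) y ≠ 0 := by
        rw [Ne, FaithfulSMul.algebraMap_eq_zero_iff]; exact hy
      have hrel : ((u.out : (𝓞 L)ˣ) : (𝓞 L)ˣ) * (u'.out : (𝓞 L)ˣ) * ε = uSig σ ε := by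
        apply Units.ext
        have h3 := congrArg (fun t => σ • t) hε
        simp only [smul_mul', hβ] at h3
        rw [show σ • (algebraMap (𝓞 K) (𝓞 L) y) = algebraMap (𝓞 K) (𝓞 L) y from smul_algebraMap _ _] at h3
        have h4 : σ • (ε : 𝓞 L) = ((uSig σ ε : (𝓞 L)ˣ) : 𝓞 L) := rfl
        rw [h4] at h3
        apply mul_left_cancel₀ hyL
        rw [h3]
        push_cast
        linear_combination (((u.out : (𝓞 L)ˣ) : 𝓞 L) * ((u'.out : (𝓞 L)ˣ) : 𝓞 L)) * hε
      have hu'n : ((u'.out : (𝓞 L)ˣ)) * uSig σ (u'.out : (𝓞 L)ˣ) = 1 := by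
        have h5 := (u'.out).2
        rw [MonoidHom.mem_ker] at h5
        have h6 := uNorm_incl h2 σ hσ (u'.out : (𝓞 L)ˣ)
        rw [h5] at h6
        apply Units.ext
        rw [Units.val_mul, ← h6]
        simp
      rw [← QuotientGroup.out_eq' u, ← QuotientGroup.out_eq' u', QuotientGroup.eq, Subgroup.mem_subgroupOf]
      refine ⟨ε * (u'.out : (𝓞 L)ˣ), ?_⟩
      have h7 : uSig σ (u'.out : (𝓞 L)ˣ) = ((u'.out : (𝓞 L)ˣ))⁻¹ := eq_inv_of_mul_eq_one_right hu'n
      simp only [MonoidHom.div_apply, MonoidHom.id_apply, map_mul, ← hrel, h7, Subgroup.coe_mul, Subgroup.coe_inv]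
      rw [div_eq_mul_inv]
      simp only [mul_inv, inv_inv]
      generalize ((Quotient.out u : (uNorm K L).ker) : (𝓞 L)ˣ) = U
      generalize ((Quotient.out u' : (uNorm K L).ker) : (𝓞 L)ˣ) = U'
      rw [div_inv_eq_mul, mul_comm (U⁻¹ * U'⁻¹) ε⁻¹, mul_inv_cancel_left, mul_assoc, inv_mul_cancel_left]
    rw [huu]
  have hcard := Nat.card_le_card_of_injective Φ hΦ
  rw [Nat.card_prod, Nat.card_prod] at hcard
  have hc2 : Nat.card (T → ZMod 2) = 2 ^ T.card := by
    rw [Nat.card_fun]; simp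
  rw [hc2] at hcard
  exact hcard

end Genus2

end

section
open NumberField Pointwise

section Genus3

variable {K L : Type*} [Field K] [Field L] [NumberField K] [NumberField L] [Algebra K L]
  [IsGalois K L]

theorem genus_bound' [IsTotallyComplex K] [IsTotallyComplex L]
    (h2 : Module.finrank K L = 2) (σ : L ≃ₐ[K] L) (hσ : σ ≠ 1)
    (hodd : Odd (Nat.card (ClassGroup (𝓞 K))))
    (T : Finset (Ideal (𝓞 L)))
    (hT : ∀ P : Ideal (𝓞 L), P ∈ T ↔ (P.IsPrime ∧ P ≠ ⊥ ∧ ∀ x : 𝓞 L, σ • x - x ∈ P)) :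
    Nat.card {c : ClassGroup (𝓞 L) // c ^ 2 = 1} * (2 * (uH K L).index) ≤ 2 ^ T.card ∧
      (uH K L).index ≠ 0 := by
  have hss : ∀ z : L, σ (σ z) = z := fun z => congrArg (fun f => f z) (quad_sq h2 σ)
  haveI : Group.FG (𝓞 L)ˣ := Group.fg_iff_monoid_fg.mpr inferInstance
  haveI : Group.FG (𝓞 K)ˣ := Group.fg_iff_monoid_fg.mpr inferInstance
  obtain ⟨h, h0⟩ := herbrand_abstract (uSig σ) (Units.map (algebraMap (𝓞 K) (𝓞 L) : 𝓞 K →* 𝓞 L)) (uNorm K L)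
    (Units.map_injective (FaithfulSMul.algebraMap_injective _ _))
    (fun u => Units.ext (uNorm_incl h2 σ hσ u))
    (fun u => Units.ext (RingOfIntegers.ext (hss _)))
    (by
      intro u hu
      have hu' : σ (((u : 𝓞 L) : L)) = ((u : 𝓞 L) : L) := congrArg (fun t : (𝓞 L)ˣ => ((t : 𝓞 L) : L)) hu
      have fixed : ∀ z : 𝓞 L, σ (z : L) = z → ∃ a : 𝓞 K, algebraMap (𝓞 K) (𝓞 L) a = z := by
        intro z hz
        have : (z : L) ∈ Set.range (algebraMap K L) := by
          rw [IsGalois.mem_range_algebraMap_iff_fixed]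
          intro g
          rcases quad_gal_eq h2 σ hσ g with rfl | rfl
          · rfl
          · exact hz
        obtain ⟨w, hw⟩ := this
        have h_intg : IsIntegral ℤ w := by
          rw [← isIntegral_algebraMap_iff (FaithfulSMul.algebraMap_injective K L), hw]
          exact z.2
        exact ⟨⟨w, h_intg⟩, RingOfIntegers.ext hw⟩
      obtain ⟨a, ha⟩ := fixed u hu'
      have hu'' : σ (((u⁻¹ : (𝓞 L)ˣ) : 𝓞 L) : L) = (((u⁻¹ : (𝓞 L)ˣ) : 𝓞 L) : L) := by
        have : uSig σ u⁻¹ = u⁻¹ := by rw [map_inv, hu]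
        exact congrArg (fun t : (𝓞 L)ˣ => ((t : 𝓞 L) : L)) this
      obtain ⟨b, hb⟩ := fixed _ hu''
      have hab : a * b = 1 := by
        apply FaithfulSMul.algebraMap_injective (𝓞 K) (𝓞 L)
        rw [map_mul, ha, hb, map_one, Units.mul_inv]
      exact ⟨⟨a, b, hab, by rw [mul_comm, hab]⟩, Units.ext ha⟩)
    (fun a => Units.ext (smul_algebraMap σ (a : 𝓞 K)))
    (by
      rw [NumberField.Units.finrank_eq, NumberField.Units.finrank_eq, NumberField.Units.rank,
        NumberField.Units.rank, InfinitePlace.card_eq_nrRealPlaces_add_nrComplexPlaces,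
        InfinitePlace.card_eq_nrRealPlaces_add_nrComplexPlaces,
        nrRealPlaces_eq_zero_iff.2 ‹_›, nrRealPlaces_eq_zero_iff.2 ‹_›]
      have e1 := IsTotallyComplex.finrank K
      have e2 := IsTotallyComplex.finrank L
      have e3 := Module.finrank_mul_finrank ℚ K L
      have e4 : 0 < Module.finrank ℚ K := Module.finrank_pos
      rw [h2] at e3
      omega)
  have hr := Subgroup.relIndex_mul_index (uNorm_range_le (K := K) (L := L))
  have hi : (uH K L).index ≠ 0 := by
    intro h1; rw [h1, mul_zero] at hr; exact h0 hr.symm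
  have hri : (uNorm K L).range.relIndex (uH K L) ≠ 0 := by
    intro h1; rw [h1, zero_mul] at hr; exact h0 hr.symm
  refine ⟨?_, hi⟩
  have hb := genus_bound h2 σ hσ hodd T hT hri
  rw [← h, ← hr] at hb
  have : (uNorm K L).range.relIndex (uH K L) * (Nat.card {c : ClassGroup (𝓞 L) // c ^ 2 = 1} * (2 * (uH K L).index)) ≤
      (uNorm K L).range.relIndex (uH K L) * 2 ^ T.card := by
    calc _ = _ := by ring
      _ ≤ _ := hb
  exact Nat.le_of_mul_le_mul_left this (Nat.pos_of_ne_zero hri)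

end Genus3

end

section
open NumberField Pointwise

lemma odd_of_card_two_torsion {C : Type*} [CommGroup C] [Finite C]
    (h : Nat.card {c : C // c ^ 2 = 1} ≤ 1) : Odd (Nat.card C) := by
  by_contra hc
  rw [Nat.not_odd_iff_even] at hc
  haveI : Fact (Nat.Prime 2) := ⟨Nat.prime_two⟩
  obtain ⟨x, hx⟩ := exists_prime_orderOf_dvd_card' (G := C) 2 hc.two_dvd
  have hx2 : x ^ 2 = 1 := by rw [← hx, pow_orderOf_eq_one]
  have : (⟨x, hx2⟩ : {c : C // c ^ 2 = 1}) = ⟨1, one_pow 2⟩ := by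
    have := (Finite.card_le_one_iff_subsingleton).1 h
    exact Subsingleton.elim _ _
  have h1 : x = 1 := congrArg Subtype.val this
  rw [h1, orderOf_one] at hx
  omega

lemma exists_quad_aut {K L : Type*} [Field K] [Field L] [Algebra K L] [FiniteDimensional K L] [IsGalois K L]
    (h2 : Module.finrank K L = 2) : ∃ σ : L ≃ₐ[K] L, σ ≠ 1 := by
  have h := IsGalois.card_aut_eq_finrank K L
  rw [h2] at h
  by_contra hh
  push Not at hh
  have : Subsingleton (L ≃ₐ[K] L) := ⟨fun a b => by rw [hh a, hh b]⟩
  have := (Finite.card_le_one_iff_subsingleton).2 this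
  omega

lemma gauss_pid (K : Type*) [Field K] [NumberField K] [IsCyclotomicExtension {2 ^ 2} ℚ K] :
    IsPrincipalIdealRing (𝓞 K) := by
  haveI : Fact (Nat.Prime 2) := ⟨Nat.prime_two⟩
  apply RingOfIntegers.isPrincipalIdealRing_of_abs_discr_lt
  have ht : Nat.totient (2 ^ 2) = 2 := by decide
  rw [IsCyclotomicExtension.Rat.discr_prime_pow 2 2 K, IsCyclotomicExtension.finrank (n := 2 ^ 2) K
    (Polynomial.cyclotomic.irreducible_rat (by simp)), IsCyclotomicExtension.Rat.nrComplexPlaces_eq_totient_div_two (2 ^ 2) K,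
    ht]
  norm_num [Nat.factorial]
  have := Real.pi_gt_three
  nlinarith

section
variable {L : Type*} [Field L] [NumberField L]

lemma int_mem_prime_liesOver {p : ℕ} (hp : p.Prime) (P : Ideal (𝓞 L)) (hP : P.IsPrime) (hP0 : P ≠ ⊥)
    (h : (p : 𝓞 L) ∈ P) : P.LiesOver (Ideal.span {(p : ℤ)}) := by
  haveI := hP
  have hmax : (Ideal.span {(p : ℤ)}).IsMaximal := by
    apply Ideal.IsPrime.isMaximal
    · rw [Ideal.span_singleton_prime (by exact_mod_cast hp.ne_zero)]
      exact Nat.prime_iff_prime_int.1 hp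
    · simpa using hp.ne_zero
  constructor
  apply hmax.eq_of_le
  · exact (Ideal.IsPrime.under ℤ P).ne_top
  · rw [Ideal.span_le, Set.singleton_subset_iff]
    change algebraMap ℤ (𝓞 L) p ∈ P
    simpa using h

end

theorem odd_class_cyclotomic (m : ℕ) : ∀ (K : Type) [Field K] [NumberField K]
    [IsCyclotomicExtension {2 ^ (m + 2)} ℚ K], Odd (Nat.card (ClassGroup (𝓞 K))) := by
  haveI : Fact (Nat.Prime 2) := ⟨Nat.prime_two⟩
  induction m with
  | zero =>
    intro K _ _ h
    haveI : IsCyclotomicExtension {2 ^ 2} ℚ K := h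
    have := gauss_pid K
    have h1 := (classNumber_eq_one_iff (K := K)).2 this
    rw [NumberField.classNumber, ← Nat.card_eq_fintype_card] at h1
    rw [h1]
    exact odd_one
  | succ m ih =>
    intro L _ _ hcyc
    haveI : IsCyclotomicExtension {2 ^ (m + 2 + 1)} ℚ L := hcyc
    have hζ := IsCyclotomicExtension.zeta_spec (2 ^ (m + 2 + 1)) ℚ L
    set ζ := IsCyclotomicExtension.zeta (2 ^ (m + 2 + 1)) ℚ L with hζdef
    have hζ2 : IsPrimitiveRoot (ζ ^ 2) (2 ^ (m + 2)) := by
      apply hζ.pow (by positivity)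
      rw [pow_succ, mul_comm]
    let K := IntermediateField.adjoin ℚ {ζ ^ 2}
    haveI hKc : IsCyclotomicExtension {2 ^ (m + 2)} ℚ K := hζ2.intermediateField_adjoin_isCyclotomicExtension ℚ
    haveI : IsGalois ℚ L := IsCyclotomicExtension.isGalois {2 ^ (m + 2 + 1)} ℚ L
    have hodd := ih K
    have h2 : Module.finrank K L = 2 := by
      have e1 := IsCyclotomicExtension.finrank (n := 2 ^ (m + 2)) K (Polynomial.cyclotomic.irreducible_rat (by positivity))
      have e2 := IsCyclotomicExtension.finrank (n := 2 ^ (m + 2 + 1)) L (Polynomial.cyclotomic.irreducible_rat (by positivity))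
      have e3 := Module.finrank_mul_finrank ℚ K L
      rw [e1, e2, Nat.totient_prime_pow Nat.prime_two (by omega), Nat.totient_prime_pow Nat.prime_two (by omega)] at e3
      simp only [Nat.add_sub_cancel, mul_one, show m + 2 - 1 = m + 1 from rfl] at e3
      rw [show m + 2 = (m + 1) + 1 from rfl, pow_succ 2 (m + 1)] at e3
      norm_num at e3
      exact e3
    obtain ⟨σ, hσ⟩ := exists_quad_aut h2
    have hne2 : 2 < 2 ^ (m + 2) := by
      calc 2 < 2 ^ 2 := by norm_num
        _ ≤ _ := Nat.pow_le_pow_right (by norm_num) (by omega)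
    have hne3 : 2 < 2 ^ (m + 2 + 1) := by
      calc 2 < 2 ^ (m + 2) := hne2
        _ ≤ _ := Nat.pow_le_pow_right (by norm_num) (by omega)
    haveI : IsTotallyComplex K := IsCyclotomicExtension.Rat.isTotallyComplex K hne2
    haveI : IsTotallyComplex L := IsCyclotomicExtension.Rat.isTotallyComplex L hne3
    have hσζ : σ ζ = -ζ := by
      have h1 : (σ ζ) ^ 2 = ζ ^ 2 := by
        rw [← map_pow]
        exact AlgEquiv.commutes σ (⟨ζ ^ 2, IntermediateField.mem_adjoin_simple_self ℚ _⟩ : K)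
      rcases sq_eq_sq_iff_eq_or_eq_neg.1 h1 with h | h
      · exfalso
        apply hσ
        have htop := IsCyclotomicExtension.adjoin_primitive_root_eq_top (A := ℚ) hζ
        have : (σ.restrictScalars ℚ : L →ₐ[ℚ] L) = AlgHom.id ℚ L := by
          apply AlgHom.ext_of_adjoin_eq_top htop
          intro x hx
          rw [Set.mem_singleton_iff] at hx
          rw [hx]
          exact h
        apply AlgEquiv.ext
        intro x
        exact congrArg (fun f : L →ₐ[ℚ] L => f x) this
      · exact h
    let S : Set (Ideal (𝓞 L)) := {P | P.IsPrime ∧ P ≠ ⊥ ∧ ∀ x : 𝓞 L, σ • x - x ∈ P}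
    have hS : S ⊆ {Ideal.span {hζ.toInteger - 1}} := by
      rintro P ⟨hP, hP0, hPx⟩
      have h1 := hPx hζ.toInteger
      have h3 : σ • hζ.toInteger - hζ.toInteger = -(2 * hζ.toInteger) := by
        apply RingOfIntegers.ext
        change σ ζ - ζ = -(2 * ζ)
        rw [hσζ]; ring
      rw [h3, neg_mem_iff] at h1
      have hu : IsUnit hζ.toInteger := (hζ.toInteger_isPrimitiveRoot).isUnit (by positivity)
      have h4 : (2 : 𝓞 L) ∈ P := by
        rcases hP.mem_or_mem h1 with h | h
        · exact h
        · exact absurd (Ideal.eq_top_of_isUnit_mem P h hu) hP.ne_top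
      haveI := int_mem_prime_liesOver Nat.prime_two P hP hP0 (by exact_mod_cast h4)
      exact IsCyclotomicExtension.Rat.eq_span_zeta_sub_one_of_liesOver 2 (m + 2) L hζ P
    have hfin : S.Finite := (Set.finite_singleton _).subset hS
    obtain ⟨hb, hi⟩ := genus_bound' h2 σ hσ hodd hfin.toFinset (by intro P; rw [Set.Finite.mem_toFinset]; rfl)
    have hcard : hfin.toFinset.card ≤ 1 := by
      rw [← Set.ncard_eq_toFinset_card _ hfin]
      calc S.ncard ≤ ({Ideal.span {hζ.toInteger - 1}} : Set (Ideal (𝓞 L))).ncard := Set.ncard_le_ncard hS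
        _ = 1 := Set.ncard_singleton _
    apply odd_of_card_two_torsion
    have h5 : 2 ^ hfin.toFinset.card ≤ 2 ^ 1 := Nat.pow_le_pow_right (by norm_num) hcard
    have h6 : 1 ≤ (uH K L).index := Nat.one_le_iff_ne_zero.2 hi
    nlinarith

end

section
open NumberField Pointwise

lemma padic_toZMod_zero (p : ℕ) [Fact p.Prime] (z : ℤ_[p]) : PadicInt.toZMod z = 0 ↔ ‖z‖ < 1 := by
  rw [← RingHom.mem_ker, PadicInt.ker_toZMod, IsLocalRing.mem_maximalIdeal]
  exact PadicInt.mem_nonunits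

lemma padic_norm_form (p : ℕ) [Fact p.Prime] (u : ℤ_[p]) (hu : ‖u‖ = 1) (x y d : ℚ_[p])
    (hd : ‖d‖ = (p : ℝ)⁻¹) (h : x ^ 2 - d * y ^ 2 = u) : IsSquare (PadicInt.toZMod u) := by
  have hp1 : (1 : ℝ) < p := by exact_mod_cast (Fact.out : p.Prime).one_lt
  have huQ : ‖(u : ℚ_[p])‖ = 1 := hu
  have hne : ∀ a b : ℤ, (p : ℝ) ^ (2 * a) ≠ (p : ℝ) ^ (2 * b - 1) := by
    intro a b hab
    have := zpow_right_injective₀ (by linarith) (by linarith) hab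
    omega
  have hnd : ∀ z : ℚ_[p], z ≠ 0 → ∃ a : ℤ, ‖z ^ 2‖ = (p : ℝ) ^ (2 * a) ∧ ‖d * z ^ 2‖ = (p : ℝ) ^ (2 * a - 1) := by
    intro z hz
    refine ⟨-z.valuation, ?_, ?_⟩
    · rw [norm_pow, Padic.norm_eq_zpow_neg_valuation hz, ← zpow_natCast, ← zpow_mul]
      congr 1; push_cast; ring
    · rw [norm_mul, hd, norm_pow, Padic.norm_eq_zpow_neg_valuation hz, ← zpow_natCast, ← zpow_mul,
        ← zpow_neg_one, ← zpow_add₀ (by linarith)]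
      congr 1; push_cast; ring
  have key : ‖x ^ 2‖ ≤ 1 ∧ ‖d * y ^ 2‖ < 1 := by
    by_cases hx : x = 0
    · exfalso
      have hy : y ≠ 0 := by
        rintro rfl
        rw [hx] at h
        rw [← h] at huQ
        simp at huQ
      obtain ⟨a, -, ha⟩ := hnd y hy
      have : ‖d * y ^ 2‖ = 1 := by
        rw [← huQ, ← h, hx]
        simp
      rw [ha] at this
      exact hne 0 a (by rw [this]; simp)
    by_cases hy : y = 0
    · constructor
      · rw [← huQ, ← h, hy]; simp
      · rw [hy]; simp
    obtain ⟨a, ha, -⟩ := hnd x hx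
    obtain ⟨b, -, hb⟩ := hnd y hy
    have hneq : ‖x ^ 2‖ ≠ ‖-(d * y ^ 2)‖ := by
      rw [norm_neg, ha, hb]; exact hne a b
    have hmax := Padic.add_eq_max_of_ne hneq
    rw [← sub_eq_add_neg, h, huQ, norm_neg] at hmax
    have h1 : ‖d * y ^ 2‖ ≤ 1 := by rw [hmax]; exact le_max_right _ _
    refine ⟨by rw [hmax]; exact le_max_left _ _, lt_of_le_of_ne h1 ?_⟩
    rw [hb]
    intro h2
    exact hne 0 b (by rw [h2]; simp)
  obtain ⟨h1, h2⟩ := key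
  have hx : ‖x‖ ≤ 1 := by
    rw [norm_pow] at h1
    exact (pow_le_one_iff_of_nonneg (norm_nonneg _) two_ne_zero).1 h1
  let X : ℤ_[p] := ⟨x, hx⟩
  let W : ℤ_[p] := ⟨d * y ^ 2, h2.le⟩
  have hu2 : u = X ^ 2 - W := by
    apply Subtype.ext
    exact h.symm
  have hW : PadicInt.toZMod W = 0 := (padic_toZMod_zero p W).2 h2
  rw [hu2, map_sub, hW, sub_zero, map_pow]
  exact ⟨_, pow_two _⟩

lemma padic_sqrt (p : ℕ) [Fact p.Prime] (hp2 : p ≠ 2) (c : ℤ) (hc : IsSquare (c : ZMod p)) (hc0 : (c : ZMod p) ≠ 0) :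
    ∃ e : ℤ_[p], e ^ 2 = c := by
  obtain ⟨a, ha⟩ := hc
  obtain ⟨b, rfl⟩ := ZMod.ringHom_surjective (PadicInt.toZMod (p := p)) a
  have hdvd := padic_toZMod_zero p
  have := hensels_lemma (p := p) (F := Polynomial.X ^ 2 - Polynomial.C (c : ℤ_[p])) (a := b) ?_
  · obtain ⟨z, hz, -⟩ := this
    refine ⟨z, ?_⟩
    simp at hz
    linear_combination hz
  · have h1 : ‖(b ^ 2 - c : ℤ_[p])‖ < 1 := by
      rw [← hdvd, map_sub, map_pow, map_intCast, ha]; simp [pow_two]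
    have h2 : ‖(2 * b : ℤ_[p])‖ = 1 := by
      have h3 : ¬ ‖(2 * b : ℤ_[p])‖ < 1 := by
        rw [← hdvd, map_mul, mul_eq_zero, not_or]
        constructor
        · rw [map_ofNat]
          intro h
          have : ((2 : ℕ) : ZMod p) = 0 := by exact_mod_cast h
          rw [ZMod.natCast_eq_zero_iff] at this
          exact hp2 ((Nat.prime_dvd_prime_iff_eq Fact.out Nat.prime_two).1 this)
        · intro h
          apply hc0
          rw [ha]; simp [h]
      exact le_antisymm (PadicInt.norm_le_one _) (not_lt.1 h3)
    have e1 : Polynomial.aeval b (Polynomial.X ^ 2 - Polynomial.C (c : ℤ_[p])) = b ^ 2 - c := by simp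
    have e2 : Polynomial.aeval b (Polynomial.derivative (Polynomial.X ^ 2 - Polynomial.C (c : ℤ_[p]))) = 2 * b := by
      rw [Polynomial.derivative_sub, Polynomial.derivative_C, Polynomial.derivative_X_pow]
      simp [one_add_one_eq_two]
    rw [e1, e2, h2]
    simpa using h1

lemma irr_quad {c : ℚ} (hc : ¬ IsSquare c) : Irreducible (Polynomial.X ^ 2 - Polynomial.C c) :=
  X_pow_sub_C_irreducible_of_prime Nat.prime_two (fun b hb => hc ⟨b, by rw [← hb, pow_two]⟩)

lemma minpoly_quad {K : Type*} [Field K] [CharZero K] (α : K) (c : ℚ) (hα : α ^ 2 = (c : K))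
    (hc : ¬ IsSquare c) : minpoly ℚ α = Polynomial.X ^ 2 - Polynomial.C c ∧ IsIntegral ℚ α := by
  have hmon : (Polynomial.X ^ 2 - Polynomial.C c).Monic := Polynomial.monic_X_pow_sub_C c two_ne_zero
  exact ⟨(minpoly.eq_of_irreducible_of_monic (irr_quad hc) (by simp [hα]) hmon).symm, ⟨_, hmon, by simp [hα]⟩⟩

lemma quad_embed {K : Type*} [Field K] [CharZero K] (α : K) (c : ℚ) (hα : α ^ 2 = (c : K))
    (hc : ¬ IsSquare c) {E : Type*} [Field E] [CharZero E] (e : E) (he : e ^ 2 = (c : E)) :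
    ∃ φ : IntermediateField.adjoin ℚ {α} →+* E, φ ⟨α, IntermediateField.mem_adjoin_simple_self ℚ α⟩ = e := by
  obtain ⟨hmin, h_intg⟩ := minpoly_quad α c hα hc
  let φ := (IntermediateField.algHomAdjoinIntegralEquiv ℚ (K := E) h_intg).symm ⟨e, by
    rw [hmin, Polynomial.mem_aroots]
    exact ⟨(irr_quad hc).ne_zero, by simp [he]⟩⟩
  exact ⟨φ.toRingHom, IntermediateField.algHomAdjoinIntegralEquiv_symm_apply_gen ℚ h_intg _⟩

lemma finrank_quad {K : Type*} [Field K] [CharZero K] (α : K) (c : ℚ) (hα : α ^ 2 = (c : K))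
    (hc : ¬ IsSquare c) : Module.finrank ℚ (IntermediateField.adjoin ℚ {α}) = 2 := by
  obtain ⟨hmin, h_intg⟩ := minpoly_quad α c hα hc
  rw [IntermediateField.adjoin.finrank h_intg, hmin, Polynomial.natDegree_X_pow_sub_C]

lemma not_sq_neg {c : ℚ} (hc : c < 0) : ¬ IsSquare c := by
  rintro ⟨b, hb⟩
  nlinarith [mul_self_nonneg b]

section Primes
variable {p q : ℕ}

lemma padic_norm_pq (hp : p.Prime) (hq : q.Prime) (hp8 : p % 8 = 5) (hq8 : q % 8 = 3) [Fact p.Prime] : ‖((p * q : ℕ) : ℚ_[p])‖ = (p : ℝ)⁻¹ := by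
  have h : ‖(q : ℚ_[p])‖ = 1 := by
    rw [Padic.norm_natCast_eq_one_iff, Nat.coprime_primes hp hq]
    rintro rfl; omega
  rw [Nat.cast_mul, norm_mul, h, mul_one, Padic.norm_p]

lemma padic_norm_pq' (hp : p.Prime) (hq : q.Prime) (hp8 : p % 8 = 5) (hq8 : q % 8 = 3) [Fact q.Prime] : ‖((p * q : ℕ) : ℚ_[q])‖ = (q : ℝ)⁻¹ := by
  have h : ‖(p : ℚ_[q])‖ = 1 := by
    rw [Padic.norm_natCast_eq_one_iff, Nat.coprime_primes hq hp]
    rintro rfl; omega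
  rw [Nat.cast_mul, norm_mul, h, one_mul, Padic.norm_p]

lemma nonnorm_i (hp : p.Prime) (hq : q.Prime) (hp8 : p % 8 = 5) (hq8 : q % 8 = 3) {K : Type*} [Field K] [CharZero K] (i : K) (hi : i ^ 2 = -1)
    (X Y : IntermediateField.adjoin ℚ {i}) : (X : K) ^ 2 - ((p * q : ℕ) : K) * (Y : K) ^ 2 ≠ i := by
  intro h
  haveI : Fact p.Prime := ⟨hp⟩
  have hsq : IsSquare ((-1 : ℤ) : ZMod p) := by
    have : IsSquare (-1 : ZMod p) := ZMod.exists_sq_eq_neg_one_iff.2 (by omega)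
    simpa using this
  obtain ⟨e, he⟩ := padic_sqrt p (by rintro rfl; omega) (-1) hsq (by simp)
  have heQ : (e : ℚ_[p]) ^ 2 = ((-1 : ℚ) : ℚ_[p]) := by
    rw [← PadicInt.coe_pow, he]; simp
  obtain ⟨φ, hφ⟩ := quad_embed i (-1) (by rw [hi]; simp) (not_sq_neg (by norm_num)) (e : ℚ_[p]) heQ
  have h' : X ^ 2 - ((p * q : ℕ) : IntermediateField.adjoin ℚ {i}) * Y ^ 2 =
      ⟨i, IntermediateField.mem_adjoin_simple_self ℚ i⟩ := by
    apply Subtype.ext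
    push_cast
    push_cast at h
    exact h
  have h2 := congrArg φ h'
  rw [hφ, map_sub, map_mul, map_pow, map_pow, map_natCast] at h2
  have hne : ‖e‖ = 1 := by
    have : ‖e‖ ^ 2 = 1 := by rw [← norm_pow, he]; simp
    exact (pow_eq_one_iff_of_nonneg (norm_nonneg _) two_ne_zero).1 this
  obtain ⟨w, hw⟩ := padic_norm_form p e hne _ _ _ (padic_norm_pq hp hq hp8 hq8) h2
  have hw4 : w ^ 4 = -1 := by
    have := congrArg PadicInt.toZMod he
    rw [map_pow, hw] at this
    simp at this
    rw [← this]; ring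
  have h8 : w ^ 2 ^ (2 + 1) = 1 := by
    norm_num
    rw [show w ^ 8 = (w ^ 4) ^ 2 by ring, hw4]; simp
  haveI : Fact (2 < p) := ⟨by omega⟩
  have h8' : ¬ w ^ 2 ^ 2 = 1 := by
    norm_num
    rw [hw4]
    exact ZMod.neg_one_ne_one
  haveI : Fact (Nat.Prime 2) := ⟨Nat.prime_two⟩
  have hord := orderOf_eq_prime_pow h8' h8
  have hw0 : w ≠ 0 := by rintro rfl; simp at hw4
  have := ZMod.orderOf_dvd_card_sub_one hw0
  rw [hord] at this
  norm_num at this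
  omega

lemma nonnorm_neg_one (hp : p.Prime) (hq : q.Prime) (hp8 : p % 8 = 5) (hq8 : q % 8 = 3) {K : Type*} [Field K] [CharZero K] (α : K) (hα : α ^ 2 = -2)
    (X Y : IntermediateField.adjoin ℚ {α}) : (X : K) ^ 2 - ((p * q : ℕ) : K) * (Y : K) ^ 2 ≠ -1 := by
  intro h
  haveI : Fact q.Prime := ⟨hq⟩
  have hsq : IsSquare ((-2 : ℤ) : ZMod q) := by
    have : IsSquare (-2 : ZMod q) := (ZMod.exists_sq_eq_neg_two_iff (by rintro rfl; omega)).2 (by omega)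
    simpa using this
  obtain ⟨e, he⟩ := padic_sqrt q (by rintro rfl; omega) (-2) hsq (by
    intro h
    rw [ZMod.intCast_zmod_eq_zero_iff_dvd] at h
    have h2 : (q : ℤ) ∣ 2 := by rwa [dvd_neg] at h
    have := Int.le_of_dvd (by norm_num) h2
    omega)
  have heQ : (e : ℚ_[q]) ^ 2 = ((-2 : ℚ) : ℚ_[q]) := by
    rw [← PadicInt.coe_pow, he, PadicInt.coe_intCast]; norm_num
  obtain ⟨φ, hφ⟩ := quad_embed α (-2) (by rw [hα]; simp) (not_sq_neg (by norm_num)) (e : ℚ_[q]) heQ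
  have h' : X ^ 2 - ((p * q : ℕ) : IntermediateField.adjoin ℚ {α}) * Y ^ 2 = -1 := by
    apply Subtype.ext
    push_cast
    push_cast at h
    exact h
  have h2 := congrArg φ h'
  rw [map_sub, map_mul, map_pow, map_pow, map_natCast, map_neg, map_one] at h2
  have := padic_norm_form q (-1) (by simp) _ _ _ (padic_norm_pq' hp hq hp8 hq8) (h2.trans (by simp))
  rw [map_neg, map_one] at this
  rw [ZMod.exists_sq_eq_neg_one_iff] at this
  omega

end Primes

end

section
open NumberField Pointwise

section Desc
variable {K L : Type*} [Field K] [Field L] [NumberField K] [NumberField L] [Algebra K L]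
  [IsGalois K L]

lemma quad_fixed (h2 : Module.finrank K L = 2) (σ : L ≃ₐ[K] L) (hσ : σ ≠ 1) (z : L) (hz : σ z = z) :
    ∃ w : K, algebraMap K L w = z := by
  have : (z : L) ∈ Set.range (algebraMap K L) := by
    rw [IsGalois.mem_range_algebraMap_iff_fixed]
    intro g
    rcases quad_gal_eq h2 σ hσ g with rfl | rfl
    · rfl
    · exact hz
  exact this

lemma normform_descend (h2 : Module.finrank K L = 2) (σ : L ≃ₐ[K] L) (hσ : σ ≠ 1) (d : ℕ) (x y u : L)
    (h : x ^ 2 - d * y ^ 2 = u) :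
    ∃ X Y : K, (algebraMap K L X) ^ 2 - d * (algebraMap K L Y) ^ 2 = u * σ u := by
  have hss : ∀ z : L, σ (σ z) = z := fun z => congrArg (fun f => f z) (quad_sq h2 σ)
  obtain ⟨X, hX⟩ := quad_fixed h2 σ hσ (x * σ x + d * (y * σ y)) (by
    simp only [map_add, map_mul, hss, map_natCast]; ring)
  obtain ⟨Y, hY⟩ := quad_fixed h2 σ hσ (x * σ y + y * σ x) (by
    simp only [map_add, map_mul, hss]; ring)
  refine ⟨X, Y, ?_⟩
  rw [hX, hY, ← h]
  simp only [map_sub, map_mul, map_pow, map_natCast]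
  ring
end Desc

lemma prim_two_pow_neg {L : Type*} [Field L] (k : ℕ) {ζ : L} (hζ : IsPrimitiveRoot ζ (2 ^ (k + 1))) :
    ζ ^ 2 ^ k = -1 := by
  apply IsPrimitiveRoot.eq_neg_one_of_two_right
  exact hζ.pow (by positivity) (by rw [pow_succ])

section Cyc
variable {L : Type} [Field L] [NumberField L]

lemma aut_zeta_ne {N : ℕ} [NeZero N] [IsCyclotomicExtension {N} ℚ L] {ζ : L} (hζ : IsPrimitiveRoot ζ N)
    (K : IntermediateField ℚ L) (σ : L ≃ₐ[K] L) (hσ : σ ≠ 1) : σ ζ ≠ ζ := by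
  intro h
  apply hσ
  have htop := IsCyclotomicExtension.adjoin_primitive_root_eq_top (A := ℚ) hζ
  have : (σ.restrictScalars ℚ : L →ₐ[ℚ] L) = AlgHom.id ℚ L := by
    apply AlgHom.ext_of_adjoin_eq_top htop
    intro x hx
    rw [Set.mem_singleton_iff] at hx
    rw [hx]
    exact h
  apply AlgEquiv.ext
  intro x
  exact congrArg (fun f : L →ₐ[ℚ] L => f x) this

lemma finrank_cyc_two (m : ℕ) [IsCyclotomicExtension {2 ^ (m + 1)} ℚ L] : Module.finrank ℚ L = 2 ^ m := by
  have e2 := IsCyclotomicExtension.finrank (n := 2 ^ (m + 1)) L (Polynomial.cyclotomic.irreducible_rat (by positivity))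
  rw [e2, Nat.totient_prime_pow Nat.prime_two (by omega)]
  simp

lemma cyc_step (m : ℕ) [IsCyclotomicExtension {2 ^ (m + 3)} ℚ L] {ζ : L} (hζ : IsPrimitiveRoot ζ (2 ^ (m + 3))) :
    Module.finrank (IntermediateField.adjoin ℚ {ζ ^ 2}) L = 2 ∧
    ∃ σ : L ≃ₐ[IntermediateField.adjoin ℚ {ζ ^ 2}] L, σ ≠ 1 ∧ σ ζ = -ζ := by
  have hζ2 : IsPrimitiveRoot (ζ ^ 2) (2 ^ (m + 2)) := by
    apply hζ.pow (by positivity)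
    rw [pow_succ, mul_comm]
  haveI hKc : IsCyclotomicExtension {2 ^ (m + 2)} ℚ (IntermediateField.adjoin ℚ {ζ ^ 2}) :=
    hζ2.intermediateField_adjoin_isCyclotomicExtension ℚ
  haveI : IsGalois ℚ L := IsCyclotomicExtension.isGalois {2 ^ (m + 3)} ℚ L
  have h2 : Module.finrank (IntermediateField.adjoin ℚ {ζ ^ 2}) L = 2 := by
    have e3 := Module.finrank_mul_finrank ℚ (IntermediateField.adjoin ℚ {ζ ^ 2}) L
    haveI : IsCyclotomicExtension {2 ^ (m + 1 + 1)} ℚ (IntermediateField.adjoin ℚ {ζ ^ 2}) := hKc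
    rw [finrank_cyc_two (L := L) (m + 2), finrank_cyc_two (L := IntermediateField.adjoin ℚ {ζ ^ 2}) (m + 1), pow_succ 2 (m + 1)] at e3
    exact Nat.eq_of_mul_eq_mul_left (by positivity) e3
  obtain ⟨σ, hσ⟩ := exists_quad_aut h2
  refine ⟨h2, σ, hσ, ?_⟩
  have h1 : (σ ζ) ^ 2 = ζ ^ 2 := by
    rw [← map_pow]
    exact AlgEquiv.commutes σ (⟨ζ ^ 2, IntermediateField.mem_adjoin_simple_self ℚ _⟩ : IntermediateField.adjoin ℚ {ζ ^ 2})
  rcases sq_eq_sq_iff_eq_or_eq_neg.1 h1 with h | h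
  · exact absurd h (aut_zeta_ne hζ _ σ hσ)
  · exact h

end Cyc

theorem nonnorm_cyc {p q : ℕ} (hp : p.Prime) (hq : q.Prime) (hp8 : p % 8 = 5) (hq8 : q % 8 = 3) (m : ℕ) :
    ∀ (L : Type) [Field L] [NumberField L] [IsCyclotomicExtension {2 ^ (m + 3)} ℚ L] (ζ : L)
      (hζ : IsPrimitiveRoot ζ (2 ^ (m + 3))) (x y : L),
      x ^ 2 - ((p * q : ℕ) : L) * y ^ 2 ≠ ζ ∧ x ^ 2 - ((p * q : ℕ) : L) * y ^ 2 ≠ 1 + ζ + ζ ^ 2 ∧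
      x ^ 2 - ((p * q : ℕ) : L) * y ^ 2 ≠ ζ * (1 + ζ + ζ ^ 2) := by
  induction m with
  | zero =>
    intro L _ _ hcyc ζ hζ x y
    haveI : IsGalois ℚ L := IsCyclotomicExtension.isGalois {2 ^ (0 + 3)} ℚ L
    obtain ⟨h2, σ, hσ, hσζ⟩ := cyc_step 0 hζ
    have h4 : ζ ^ 4 = -1 := prim_two_pow_neg 2 hζ
    have hi : (ζ ^ 2) ^ 2 = -1 := by rw [← pow_mul]; exact h4
    refine ⟨?_, ?_, ?_⟩
    · intro h
      obtain ⟨X, Y, hXY⟩ := normform_descend h2 σ hσ _ x y _ h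
      rw [hσζ] at hXY
      let I : IntermediateField.adjoin ℚ {ζ ^ 2} := ⟨ζ ^ 2, IntermediateField.mem_adjoin_simple_self ℚ _⟩
      apply nonnorm_i hp hq hp8 hq8 (ζ ^ 2) hi (I * X) (I * Y)
      change (ζ ^ 2 * (X : L)) ^ 2 - ((p * q : ℕ) : L) * (ζ ^ 2 * (Y : L)) ^ 2 = ζ ^ 2
      change (X : L) ^ 2 - ((p * q : ℕ) : L) * (Y : L) ^ 2 = _ at hXY
      linear_combination (ζ ^ 2) ^ 2 * hXY - ζ ^ 2 * hi
    · intro h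
      obtain ⟨X, Y, hXY⟩ := normform_descend h2 σ hσ _ x y _ h
      simp only [map_add, map_one, map_pow, hσζ] at hXY
      apply nonnorm_i hp hq hp8 hq8 (ζ ^ 2) hi X Y
      change (X : L) ^ 2 - ((p * q : ℕ) : L) * (Y : L) ^ 2 = _ at hXY
      linear_combination hXY + hi
    · intro h
      have hα : (ζ + ζ ^ 3) ^ 2 = -2 := by
        linear_combination (2 + ζ ^ 2) * h4
      have hf : Module.finrank ℚ (IntermediateField.adjoin ℚ {ζ + ζ ^ 3}) = 2 :=
        finrank_quad _ (-2) (by rw [hα]; simp) (not_sq_neg (by norm_num))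
      have h2' : Module.finrank (IntermediateField.adjoin ℚ {ζ + ζ ^ 3}) L = 2 := by
        have e3 := Module.finrank_mul_finrank ℚ (IntermediateField.adjoin ℚ {ζ + ζ ^ 3}) L
        haveI : IsCyclotomicExtension {2 ^ (2 + 1)} ℚ L := hcyc
        rw [hf, finrank_cyc_two 2] at e3
        omega
      obtain ⟨s, hs⟩ := exists_quad_aut h2'
      have hsζ : s ζ = ζ ^ 3 := by
        have h1 : s (ζ + ζ ^ 3) = ζ + ζ ^ 3 :=
          AlgEquiv.commutes s (⟨_, IntermediateField.mem_adjoin_simple_self ℚ _⟩ : IntermediateField.adjoin ℚ {ζ + ζ ^ 3})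
        have h3 : s (ζ ^ 2 - (ζ + ζ ^ 3) * ζ - 1) = 0 := by
          rw [show ζ ^ 2 - (ζ + ζ ^ 3) * ζ - 1 = 0 by linear_combination -h4]
          exact map_zero _
        rw [map_sub, map_sub, map_mul, h1, map_pow, map_one] at h3
        have h5 : (s ζ - ζ) * (s ζ - ζ ^ 3) = 0 := by
          linear_combination h3 + h4
        rcases mul_eq_zero.1 h5 with h | h
        · exact absurd (sub_eq_zero.1 h) (aut_zeta_ne hζ _ s hs)
        · exact sub_eq_zero.1 h
      obtain ⟨X, Y, hXY⟩ := normform_descend h2' s hs _ x y _ h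
      simp only [map_add, map_mul, map_one, map_pow, hsζ] at hXY
      apply nonnorm_neg_one hp hq hp8 hq8 _ hα X Y
      change (X : L) ^ 2 - ((p * q : ℕ) : L) * (Y : L) ^ 2 = _ at hXY
      rw [hXY]
      linear_combination (1 + ζ^5 + ζ^6 + ζ^7 + ζ^8) * h4
  | succ m ih =>
    intro L _ _ hcyc ζ hζ x y
    haveI : IsCyclotomicExtension {2 ^ (m + 1 + 3)} ℚ L := hcyc
    haveI : IsGalois ℚ L := IsCyclotomicExtension.isGalois {2 ^ (m + 1 + 3)} ℚ L
    obtain ⟨h2, σ, hσ, hσζ⟩ := cyc_step (m + 1) hζ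
    have hζ2 : IsPrimitiveRoot (ζ ^ 2) (2 ^ (m + 3)) := by
      apply hζ.pow (by positivity)
      ring
    haveI hKc : IsCyclotomicExtension {2 ^ (m + 3)} ℚ (IntermediateField.adjoin ℚ {ζ ^ 2}) :=
      hζ2.intermediateField_adjoin_isCyclotomicExtension ℚ
    let Z : IntermediateField.adjoin ℚ {ζ ^ 2} := ⟨ζ ^ 2, IntermediateField.mem_adjoin_simple_self ℚ _⟩
    have hZ : IsPrimitiveRoot Z (2 ^ (m + 3)) := by
      apply IsPrimitiveRoot.of_map_of_injective (f := algebraMap (IntermediateField.adjoin ℚ {ζ ^ 2}) L) hζ2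
      exact FaithfulSMul.algebraMap_injective _ _
    have hI : (Z ^ (2 ^ (m + 1))) ^ 2 = -1 := by
      rw [← pow_mul, ← pow_succ]
      exact prim_two_pow_neg (m + 2) hZ
    have key := ih (IntermediateField.adjoin ℚ {ζ ^ 2}) Z hZ
    have inj : ∀ a b : IntermediateField.adjoin ℚ {ζ ^ 2}, (a : L) = b → a = b := fun a b h => Subtype.ext h
    set I := Z ^ (2 ^ (m + 1)) with hIdef
    refine ⟨?_, ?_, ?_⟩
    · intro h
      obtain ⟨X, Y, hXY⟩ := normform_descend h2 σ hσ _ x y _ h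
      rw [hσζ] at hXY
      have hXY' : X ^ 2 - ((p * q : ℕ) : IntermediateField.adjoin ℚ {ζ ^ 2}) * Y ^ 2 = - Z := by
        apply inj
        push_cast
        push_cast at hXY
        refine hXY.trans ?_
        change _ = - ζ ^ 2
        ring
      apply (key (I * X) (I * Y)).1
      linear_combination I ^ 2 * hXY' - Z * hI
    · intro h
      obtain ⟨X, Y, hXY⟩ := normform_descend h2 σ hσ _ x y _ h
      simp only [map_add, map_one, map_pow, hσζ] at hXY
      apply (key X Y).2.1
      apply inj
      push_cast
      push_cast at hXY
      refine hXY.trans ?_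
      change _ = 1 + ζ ^ 2 + (ζ ^ 2) ^ 2
      ring
    · intro h
      obtain ⟨X, Y, hXY⟩ := normform_descend h2 σ hσ _ x y _ h
      simp only [map_add, map_mul, map_one, map_pow, hσζ] at hXY
      have hXY' : X ^ 2 - ((p * q : ℕ) : IntermediateField.adjoin ℚ {ζ ^ 2}) * Y ^ 2 = - (Z * (1 + Z + Z ^ 2)) := by
        apply inj
        push_cast
        push_cast at hXY
        refine hXY.trans ?_
        change _ = - (ζ ^ 2 * (1 + ζ ^ 2 + (ζ ^ 2) ^ 2))
        ring
      apply (key (I * X) (I * Y)).2.2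
      linear_combination I ^ 2 * hXY' - (Z * (1 + Z + Z ^ 2)) * hI

end

section

section Pell
variable {p q : ℕ}

lemma coprime_split (hp : p.Prime) (hq : q.Prime) (hp8 : p % 8 = 5) (hq8 : q % 8 = 3) (a b c : ℕ) (hab : a.Coprime b) (h : a * b = p * q * c ^ 2) :
    ∃ s t : ℕ, s * t = c ∧ ((a = s ^ 2 ∧ b = p * q * t ^ 2) ∨ (a = p * q * s ^ 2 ∧ b = t ^ 2) ∨
      (a = p * s ^ 2 ∧ b = q * t ^ 2) ∨ (a = q * s ^ 2 ∧ b = p * t ^ 2)) := by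
  have hpq : p.Coprime q := (Nat.coprime_primes hp hq).2 (by rintro rfl; omega)
  have sqs : ∀ a' b' : ℕ, a'.Coprime b' → a' * b' = c ^ 2 → ∃ s t : ℕ, s * t = c ∧ a' = s ^ 2 ∧ b' = t ^ 2 := by
    intro a' b' h1 h2
    obtain ⟨s, hs⟩ := exists_eq_pow_of_mul_eq_pow (Nat.isUnit_iff.2 h1) h2
    obtain ⟨t, ht⟩ := exists_eq_pow_of_mul_eq_pow (Nat.isUnit_iff.2 h1.symm) (by rw [mul_comm]; exact h2)
    refine ⟨s, t, ?_, hs, ht⟩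
    rw [hs, ht, ← mul_pow] at h2
    exact Nat.pow_left_injective two_ne_zero h2
  have hp0 : 0 < p := hp.pos
  have hq0 : 0 < q := hq.pos
  have hpd : p ∣ a ∨ p ∣ b := by
    rw [← hp.dvd_mul, h]; exact ⟨q * c ^ 2, by ring⟩
  have hqd : q ∣ a ∨ q ∣ b := by
    rw [← hq.dvd_mul, h]; exact ⟨p * c ^ 2, by ring⟩
  rcases hpd with h1 | h1 <;> rcases hqd with h2 | h2
  · obtain ⟨a', rfl⟩ := hpq.mul_dvd_of_dvd_of_dvd h1 h2
    obtain ⟨s, t, hst, hs, ht⟩ := sqs a' b (Nat.Coprime.coprime_mul_left hab) (by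
      apply Nat.eq_of_mul_eq_mul_left (Nat.mul_pos hp0 hq0); linarith)
    exact ⟨s, t, hst, Or.inr (Or.inl ⟨by rw [hs], ht⟩)⟩
  · obtain ⟨a', rfl⟩ := h1
    obtain ⟨b', rfl⟩ := h2
    obtain ⟨s, t, hst, hs, ht⟩ := sqs a' b' (Nat.Coprime.coprime_mul_left_right (Nat.Coprime.coprime_mul_left hab)) (by
      apply Nat.eq_of_mul_eq_mul_left (Nat.mul_pos hp0 hq0); linarith)
    exact ⟨s, t, hst, Or.inr (Or.inr (Or.inl ⟨by rw [hs], by rw [ht]⟩))⟩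
  · obtain ⟨b', rfl⟩ := h1
    obtain ⟨a', rfl⟩ := h2
    obtain ⟨s, t, hst, hs, ht⟩ := sqs a' b' (Nat.Coprime.coprime_mul_left_right (Nat.Coprime.coprime_mul_left hab)) (by
      apply Nat.eq_of_mul_eq_mul_left (Nat.mul_pos hp0 hq0); linarith)
    exact ⟨s, t, hst, Or.inr (Or.inr (Or.inr ⟨by rw [hs], by rw [ht]⟩))⟩
  · obtain ⟨b', rfl⟩ := hpq.mul_dvd_of_dvd_of_dvd h1 h2
    obtain ⟨s, t, hst, hs, ht⟩ := sqs a b' (Nat.Coprime.coprime_mul_left_right hab) (by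
      apply Nat.eq_of_mul_eq_mul_left (Nat.mul_pos hp0 hq0); linarith)
    exact ⟨s, t, hst, Or.inl ⟨hs, by rw [ht]⟩⟩

lemma pell_aux (hp : p.Prime) (hq : q.Prime) (hp8 : p % 8 = 5) (hq8 : q % 8 = 3) : ∀ y x : ℕ, 0 < y → x ^ 2 = 1 + p * q * y ^ 2 →
    ∃ u v : ℤ, (p * u ^ 2 - q * v ^ 2 = 1 ∨ p * u ^ 2 - q * v ^ 2 = -1) ∨
      (p * u ^ 2 - q * v ^ 2 = 2 ∨ p * u ^ 2 - q * v ^ 2 = -2) := by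
  haveI : Fact p.Prime := ⟨hp⟩
  haveI : Fact q.Prime := ⟨hq⟩
  intro y
  induction y using Nat.strong_induction_on with
  | _ y ih =>
  intro x hy hxy
  have hpqm : (p * q) % 8 = 7 := by rw [Nat.mul_mod, hp8, hq8]
  have hx1 : 1 < x := by
    by_contra hx
    have : x ^ 2 ≤ 1 ^ 2 := Nat.pow_le_pow_left (by omega) 2
    have h3 : 0 < p * q * y ^ 2 := by
      have := hp.pos; have := hq.pos; positivity
    omega
  rcases Nat.even_or_odd y with ⟨c, hc⟩ | hyo
  · have hxo : Odd x := by
      have h1 : Odd (x ^ 2) := by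
        rw [hxy, hc]
        exact ⟨p * q * 2 * c ^ 2, by ring⟩
      exact Nat.Odd.of_mul_left (by rwa [pow_two] at h1)
    obtain ⟨a, rfl⟩ := hxo
    have hmul : a * (a + 1) = p * q * c ^ 2 := by
      rw [hc] at hxy; nlinarith
    obtain ⟨s, t, hst, h | h | h | h⟩ := coprime_split hp hq hp8 hq8 a (a + 1) c (by simp) hmul
    · exfalso
      have : (q : ℤ) ∣ (s : ℤ) ^ 2 + 1 := ⟨p * t ^ 2, by
        have h2 := h.2; rw [h.1] at h2; zify at h2; linarith⟩
      have h4 : IsSquare (-1 : ZMod q) := by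
        have h5 := (ZMod.intCast_zmod_eq_zero_iff_dvd _ q).2 this
        push_cast at h5
        exact ⟨s, by linear_combination -h5⟩
      rw [ZMod.exists_sq_eq_neg_one_iff] at h4
      omega
    · have hs : 0 < s := by
        rcases Nat.eq_zero_or_pos s with h0 | h0
        · exfalso; rw [h0] at hst; omega
        · exact h0
      have ht : 0 < t := by
        rcases Nat.eq_zero_or_pos t with h0 | h0
        · exfalso; rw [h0] at hst; omega
        · exact h0
      apply ih s (by nlinarith) t hs
      rw [← h.2, ← h.1]; ring
    · refine ⟨s, t, Or.inl (Or.inr ?_)⟩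
      have h2 := h.2; rw [h.1] at h2; zify at h2; linarith
    · refine ⟨t, s, Or.inl (Or.inl ?_)⟩
      have h2 := h.2; rw [h.1] at h2; zify at h2; linarith
  · obtain ⟨a, rfl⟩ : ∃ a, x = a + 1 := ⟨x - 1, by omega⟩
    have hxe : Even (a + 1) := by
      have h1 : Even ((a + 1) ^ 2) := by
        rw [hxy]
        apply Odd.add_odd odd_one
        apply Odd.mul _ hyo.pow
        rw [Nat.odd_iff]; omega
      exact (Nat.even_pow.1 h1).1
    have hao : Odd a := by
      rcases hxe with ⟨k, hk⟩
      exact ⟨k - 1, by omega⟩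
    have hcop : a.Coprime (a + 2) := by
      rw [Nat.coprime_self_add_right]
      exact Nat.Coprime.symm (Nat.prime_two.coprime_iff_not_dvd.2 (by
        intro h; exact (Nat.not_even_iff_odd.2 hao) (even_iff_two_dvd.2 h)))
    have hmul : a * (a + 2) = p * q * y ^ 2 := by nlinarith
    obtain ⟨s, t, hst, h | h | h | h⟩ := coprime_split hp hq hp8 hq8 a (a + 2) y hcop hmul
    · exfalso
      have : (p : ℤ) ∣ (s : ℤ) ^ 2 + 2 := ⟨q * t ^ 2, by
        have h2 := h.2; rw [h.1] at h2; zify at h2; linarith⟩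
      have h4 : IsSquare (-2 : ZMod p) := by
        have h5 := (ZMod.intCast_zmod_eq_zero_iff_dvd _ p).2 this
        push_cast at h5
        exact ⟨s, by linear_combination -h5⟩
      rw [ZMod.exists_sq_eq_neg_two_iff (by rintro rfl; omega)] at h4
      omega
    · exfalso
      have : (p : ℤ) ∣ (t : ℤ) ^ 2 - 2 := ⟨q * s ^ 2, by
        have h2 := h.2; rw [h.1] at h2; zify at h2; linarith⟩
      have h4 : IsSquare (2 : ZMod p) := by
        have h5 := (ZMod.intCast_zmod_eq_zero_iff_dvd _ p).2 this
        push_cast at h5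
        exact ⟨t, by linear_combination -h5⟩
      rw [ZMod.exists_sq_eq_two_iff (by rintro rfl; omega)] at h4
      omega
    · refine ⟨s, t, Or.inr (Or.inr ?_)⟩
      have h2 := h.2; rw [h.1] at h2; zify at h2; linarith
    · refine ⟨t, s, Or.inr (Or.inl ?_)⟩
      have h2 := h.2; rw [h.1] at h2; zify at h2; linarith

lemma not_sq_pq (hp : p.Prime) (hq : q.Prime) (hp8 : p % 8 = 5) (hq8 : q % 8 = 3) : ¬ IsSquare (p * q : ℤ) := by
  rintro ⟨r, hr⟩
  have h1 : r * r % 8 = 7 := by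
    rw [← hr, Int.mul_emod]
    have e1 : (p : ℤ) % 8 = 5 := by omega
    have e2 : (q : ℤ) % 8 = 3 := by omega
    rw [e1, e2]; norm_num
  have h2 : r % 8 = 0 ∨ r % 8 = 1 ∨ r % 8 = 2 ∨ r % 8 = 3 ∨ r % 8 = 4 ∨ r % 8 = 5 ∨ r % 8 = 6 ∨ r % 8 = 7 := by omega
  rw [Int.mul_emod] at h1
  rcases h2 with h | h | h | h | h | h | h | h <;> rw [h] at h1 <;> norm_num at h1

theorem pell_pq (hp : p.Prime) (hq : q.Prime) (hp8 : p % 8 = 5) (hq8 : q % 8 = 3) : ∃ u v : ℤ, (p * u ^ 2 - q * v ^ 2 = 1 ∨ p * u ^ 2 - q * v ^ 2 = -1) ∨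
      (p * u ^ 2 - q * v ^ 2 = 2 ∨ p * u ^ 2 - q * v ^ 2 = -2) := by
  obtain ⟨x, y, h, hy⟩ := Pell.exists_of_not_isSquare (d := (p * q : ℤ)) (by
    have := hp.pos; have := hq.pos; positivity) (not_sq_pq hp hq hp8 hq8)
  apply pell_aux hp hq hp8 hq8 y.natAbs x.natAbs (Int.natAbs_pos.2 hy)
  zify
  rw [sq_abs, sq_abs]
  linarith

end Pell

end

section
open NumberField Pointwise

lemma unram_sq {k : ℕ} (K : Type) [Field K] [NumberField K] [IsCyclotomicExtension {2 ^ k} ℚ K]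
    (l : ℕ) (hl : l.Prime) (hl2 : l ≠ 2) (a m : ℕ) (ha : Odd a) (hm : ¬ l ∣ m) (hm0 : m ≠ 0) (x : 𝓞 K) :
    Ideal.span {x} ^ 2 ≠ Ideal.span {((l ^ a * m : ℕ) : 𝓞 K)} := by
  classical
  intro h
  haveI : Fact l.Prime := ⟨hl⟩
  haveI hmax : (Ideal.span {(l : ℤ)}).IsMaximal := Int.ideal_span_isMaximal_of_prime l
  obtain ⟨⟨P, hP, hPo⟩⟩ := (Ideal.span {(l : ℤ)}).nonempty_primesOver (S := 𝓞 K)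
  have hram := IsCyclotomicExtension.Rat.ramificationIdx_eq_of_not_dvd (m := 2 ^ k) l K P (by
    intro hd
    exact hl2 ((Nat.prime_dvd_prime_iff_eq hl Nat.prime_two).1 (hl.dvd_of_dvd_pow hd)))
  have hl0 : (l : 𝓞 K) ≠ 0 := by exact_mod_cast hl.ne_zero
  have hm00 : (m : 𝓞 K) ≠ 0 := by exact_mod_cast hm0
  have hmap : (Ideal.span {(l : ℤ)}).map (algebraMap ℤ (𝓞 K)) = Ideal.span {(l : 𝓞 K)} := by
    rw [Ideal.map_span, Set.image_singleton]; simp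
  have hne : Ideal.span {(l : 𝓞 K)} ≠ ⊥ := by simpa using hl0
  have hne' : Ideal.span {(m : 𝓞 K)} ≠ ⊥ := by simpa using hm00
  rw [Ideal.IsDedekindDomain.ramificationIdx_eq_normalizedFactors_count (Ideal.span {(l : ℤ)}) P (by rw [hmap]; exact hne), hmap] at hram
  have h0 : (UniqueFactorizationMonoid.normalizedFactors (Ideal.span {(m : 𝓞 K)})).count P = 0 := by
    rw [Multiset.count_eq_zero]
    intro hmem
    have h1 := UniqueFactorizationMonoid.dvd_of_mem_normalizedFactors hmem
    rw [Ideal.dvd_span_singleton] at h1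
    have h2 : ((m : ℤ) : 𝓞 K) ∈ P := by exact_mod_cast h1
    have h3 : (m : ℤ) ∈ Ideal.span {(l : ℤ)} := by
      rw [hPo.over, Ideal.mem_comap]; simpa using h2
    rw [Ideal.mem_span_singleton] at h3
    exact hm (by exact_mod_cast h3)
  have e : Ideal.span {((l ^ a * m : ℕ) : 𝓞 K)} = Ideal.span {(l : 𝓞 K)} ^ a * Ideal.span {(m : 𝓞 K)} := by
    rw [Ideal.span_singleton_pow, Ideal.span_singleton_mul_span_singleton]; push_cast; rfl
  rw [e] at h
  have h4 := congrArg (fun I => (UniqueFactorizationMonoid.normalizedFactors I).count P) h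
  beta_reduce at h4
  rw [UniqueFactorizationMonoid.normalizedFactors_mul (pow_ne_zero _ hne) hne', UniqueFactorizationMonoid.normalizedFactors_pow,
    UniqueFactorizationMonoid.normalizedFactors_pow, Multiset.count_add, Multiset.count_nsmul, Multiset.count_nsmul, h0, hram] at h4
  obtain ⟨b, hb⟩ := ha
  omega

lemma order_lemma (x f n : ℕ) (hx : x % 8 = 3 ∨ x % 8 = 5) (hf : f ≠ 0) (hn : 1 ≤ n)
    (h : 2 ^ (n + 2) ∣ x ^ f - 1) : 2 ^ n ≤ f := by
  haveI : Fact (Nat.Prime 2) := ⟨Nat.prime_two⟩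
  have hx1 : 1 < x := by omega
  rcases Nat.even_or_odd f with he | ho
  · have h1 := padicValNat.pow_two_sub_one hx1 (by omega) hf he
    have hv : padicValNat 2 (x + 1) + padicValNat 2 (x - 1) = 3 := by
      have hle : ∀ y : ℕ, y % 8 = 4 → padicValNat 2 y = 2 := by
        intro y hy
        obtain ⟨z, hz⟩ : ∃ z, y = 2 ^ 2 * z ∧ ¬ 2 ∣ z := ⟨y / 4, by omega, by omega⟩
        have hz0 : z ≠ 0 := by rintro rfl; simp at hz
        rw [hz.1, padicValNat.mul (by norm_num) hz0, padicValNat.prime_pow, padicValNat.eq_zero_of_not_dvd hz.2]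
      have hle' : ∀ y : ℕ, y % 4 = 2 → padicValNat 2 y = 1 := by
        intro y hy
        obtain ⟨z, hz⟩ : ∃ z, y = 2 ^ 1 * z ∧ ¬ 2 ∣ z := ⟨y / 2, by omega, by omega⟩
        have hz0 : z ≠ 0 := by rintro rfl; simp at hz
        rw [hz.1, padicValNat.mul (by norm_num) hz0, padicValNat.prime_pow, padicValNat.eq_zero_of_not_dvd hz.2]
      rcases hx with hx | hx
      · rw [hle (x + 1) (by omega), hle' (x - 1) (by omega)]
      · rw [hle' (x + 1) (by omega), hle (x - 1) (by omega)]
    have hpos : x ^ f - 1 ≠ 0 := by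
      have := Nat.one_lt_pow hf hx1
      omega
    have h2 := (padicValNat_dvd_iff_le hpos).1 h
    have h3 : n ≤ padicValNat 2 f := by omega
    exact Nat.le_of_dvd (Nat.pos_of_ne_zero hf) ((padicValNat_dvd_iff_le hf).2 h3)
  · exfalso
    obtain ⟨b, rfl⟩ := ho
    have h8 : 8 ∣ x ^ (2 * b + 1) - 1 := dvd_trans (by
      rw [show (8 : ℕ) = 2 ^ 3 by norm_num]; exact pow_dvd_pow 2 (by omega)) h
    have h9 : x ^ (2 * b + 1) ≡ x [MOD 8] := by
      rw [pow_succ, pow_mul]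
      have : x ^ 2 ≡ 1 [MOD 8] := by
        unfold Nat.ModEq; rw [Nat.pow_mod]; rcases hx with hx | hx <;> rw [hx]
      simpa using (this.pow b).mul_right x
    have : 1 ≤ x ^ (2 * b + 1) := Nat.one_le_pow _ _ (by omega)
    unfold Nat.ModEq at h9
    omega

/-- A quadratic field generated by `δ`. -/
lemma quad_field_data (F : Type*) [Field F] [NumberField F] (h2 : Module.finrank ℚ F = 2) (δ : F) (c : ℚ)
    (hδ : δ ^ 2 = (c : F)) (hc : ¬ IsSquare c) :
    IsGalois ℚ F ∧ ∃ σ : F ≃ₐ[ℚ] F, σ ≠ 1 ∧ σ δ = -δ := by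
  haveI : Algebra.IsQuadraticExtension ℚ F := { finrank_eq_two' := h2 }
  have hG : IsGalois ℚ F := inferInstance
  refine ⟨hG, ?_⟩
  obtain ⟨σ, hσ⟩ := exists_quad_aut h2
  refine ⟨σ, hσ, ?_⟩
  have h1 : (σ δ) ^ 2 = δ ^ 2 := by rw [← map_pow, hδ, map_ratCast]
  rcases sq_eq_sq_iff_eq_or_eq_neg.1 h1 with h | h
  · exfalso
    obtain ⟨w, hw⟩ := quad_fixed h2 σ hσ δ h
    apply hc
    refine ⟨w, ?_⟩
    have : ((w * w : ℚ) : F) = (c : F) := by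
      rw [← hδ, ← hw]; push_cast; simp [pow_two]
    exact_mod_cast this.symm
  · exact h

lemma quad_field_norm (F : Type*) [Field F] [NumberField F] (h2 : Module.finrank ℚ F = 2) (δ : F) (c : ℚ)
    (hδ : δ ^ 2 = (c : F)) (hc : ¬ IsSquare c) (w : F) :
    ∃ a b : ℚ, Algebra.norm ℚ w = a ^ 2 - c * b ^ 2 := by
  obtain ⟨hG, σ, hσ, hσδ⟩ := quad_field_data F h2 δ c hδ hc
  have hδ0 : δ ≠ 0 := by
    rintro rfl
    apply hc
    have : (c : F) = 0 := by rw [← hδ]; simp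
    have : c = 0 := by exact_mod_cast this
    rw [this]; exact IsSquare.zero
  have hss : ∀ z : F, σ (σ z) = z := fun z => congrArg (fun f => f z) (quad_sq h2 σ)
  obtain ⟨a, ha⟩ := quad_fixed h2 σ hσ ((w + σ w) / 2) (by simp only [map_div₀, map_add, map_ofNat, hss]; ring)
  obtain ⟨b, hb⟩ := quad_fixed h2 σ hσ ((w - σ w) / (2 * δ)) (by
    simp only [map_div₀, map_sub, map_mul, map_ofNat, hss, hσδ]; rw [← neg_div_neg_eq]; ring)
  refine ⟨a, b, ?_⟩
  apply (algebraMap ℚ F).injective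
  rw [quad_norm h2 σ hσ w]
  simp only [map_sub, map_mul, map_pow, ha, hb]
  rw [show algebraMap ℚ F c = δ ^ 2 by rw [hδ]; simp]
  field_simp
  ring

lemma norm_form (L : Type*) [Field L] [NumberField L] (δ : L) (c : ℚ)
    (hδ : δ ^ 2 = (c : L)) (hc : ¬ IsSquare c) (w : L) :
    ∃ a b : ℚ, Algebra.norm ℚ w = a ^ 2 - c * b ^ 2 := by
  have h2 := finrank_quad δ c hδ hc
  have := quad_field_norm (IntermediateField.adjoin ℚ {δ}) h2 ⟨δ, IntermediateField.mem_adjoin_simple_self ℚ δ⟩ c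
    (by apply Subtype.ext; simpa using hδ) hc (Algebra.norm _ w)
  rwa [Algebra.norm_norm] at this

theorem norm_two_nonsquare {p q : ℕ} (hp : p.Prime) (hq : q.Prime) (hp8 : p % 8 = 5) (hq8 : q % 8 = 3)
    (L : Type*) [Field L] [NumberField L] (δ : L) (hδ : δ ^ 2 = -((p * q : ℕ) : L))
    (I : Ideal (𝓞 L)) (hI : Ideal.absNorm I = 2) (y : ClassGroup (𝓞 L)) : y ^ 2 ≠ icls I := by
  intro hy
  obtain ⟨J, hJ0, rfl⟩ := icls_surj y
  have hI0 : I ≠ ⊥ := by rintro rfl; simp at hI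
  have hc0 : (-((p * q : ℕ) : ℚ)) < 0 := by
    have : 0 < p * q := Nat.mul_pos hp.pos hq.pos
    have : (0 : ℚ) < ((p * q : ℕ) : ℚ) := by exact_mod_cast this
    linarith
  have hc := not_sq_neg hc0
  have hδ' : δ ^ 2 = ((-((p * q : ℕ) : ℚ) : ℚ) : L) := by rw [hδ]; push_cast; rfl
  rw [← icls_pow hJ0] at hy
  have hJ2 : J ^ 2 ≠ ⊥ := pow_ne_zero 2 hJ0
  rw [icls_of_ne hJ2, icls_of_ne hI0, ClassGroup.mk0_eq_mk0_iff] at hy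
  obtain ⟨x, y, hx, hy0, hxy⟩ := hy
  simp only at hxy
  have hN := congrArg (fun I => Ideal.absNorm I) hxy
  simp only [map_mul, map_pow, hI, Ideal.absNorm_span_singleton] at hN
  have key : ∀ z : 𝓞 L, z ≠ 0 → ∃ a b : ℚ, (((Algebra.norm ℤ z).natAbs : ℕ) : ℚ) = a ^ 2 + ((p * q : ℕ) : ℚ) * b ^ 2 := by
    intro z hz
    obtain ⟨a, b, hab⟩ := norm_form L δ _ hδ' hc (z : L)
    refine ⟨a, b, ?_⟩
    have h1 : ((Algebra.norm ℤ z : ℤ) : ℚ) = a ^ 2 + ((p * q : ℕ) : ℚ) * b ^ 2 := by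
      rw [Algebra.coe_norm_int, hab]; ring
    have h2 : 0 ≤ Algebra.norm ℤ z := by
      have : (0 : ℚ) ≤ ((Algebra.norm ℤ z : ℤ) : ℚ) := by rw [h1]; positivity
      exact_mod_cast this
    rw [← h1]
    have h3 : (((Algebra.norm ℤ z).natAbs : ℕ) : ℤ) = Algebra.norm ℤ z := Int.natAbs_of_nonneg h2
    have h4 := congrArg (fun t : ℤ => (t : ℚ)) h3
    simpa only [Int.cast_natCast] using h4
  have hx' : (((Algebra.norm ℤ x).natAbs : ℕ) : ℚ) ≠ 0 := by
    simpa [Algebra.norm_eq_zero_iff] using hx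
  have hy' : (((Algebra.norm ℤ y).natAbs : ℕ) : ℚ) ≠ 0 := by
    simpa [Algebra.norm_eq_zero_iff] using hy0
  have hJN : ((Ideal.absNorm J : ℕ) : ℚ) ≠ 0 := by
    simpa [Ideal.absNorm_eq_zero_iff] using hJ0
  have hNQ : (((Algebra.norm ℤ x).natAbs : ℕ) : ℚ) * ((Ideal.absNorm J : ℕ) : ℚ) ^ 2 = (((Algebra.norm ℤ y).natAbs : ℕ) : ℚ) * 2 := by
    exact_mod_cast hN
  obtain ⟨a, b, hab⟩ := key x hx
  obtain ⟨c, e, hce⟩ := key y hy0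
  set X := (((Algebra.norm ℤ x).natAbs : ℕ) : ℚ)
  set Y := (((Algebra.norm ℤ y).natAbs : ℕ) : ℚ)
  set j := ((Ideal.absNorm J : ℕ) : ℚ)
  set D := ((p * q : ℕ) : ℚ)
  have hfin : (j * (a * c + D * (b * e)) / Y) ^ 2 - (-D) * (j * (a * e - b * c) / Y) ^ 2 = 2 := by
    have : (a * c + D * (b * e)) ^ 2 + D * (a * e - b * c) ^ 2 = X * Y := by rw [hab, hce]; ring
    field_simp
    linear_combination j ^ 2 * this + Y * hNQ
  haveI : Fact p.Prime := ⟨hp⟩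
  have h1 := congrArg (fun t : ℚ => (t : ℚ_[p])) hfin
  simp only [Rat.cast_sub, Rat.cast_pow, Rat.cast_mul] at h1
  have hn := padic_norm_pq hp hq hp8 hq8
  have hu : ‖((2 : ℕ) : ℤ_[p])‖ = 1 := by
    rw [PadicInt.norm_def]
    push_cast
    have := (Padic.norm_natCast_eq_one_iff (p := p) (n := 2)).2 ((Nat.coprime_primes hp Nat.prime_two).2 (by rintro rfl; omega))
    exact_mod_cast this
  have hd : ‖(((-D : ℚ)) : ℚ_[p])‖ = (p : ℝ)⁻¹ := by
    rw [← hn]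
    have : (((-D : ℚ)) : ℚ_[p]) = -((p * q : ℕ) : ℚ_[p]) := by simp [D]
    rw [this, norm_neg]
  have h3 := padic_norm_form p ((2 : ℕ) : ℤ_[p]) hu _ _ _ hd (h1.trans (by push_cast; rfl))
  rw [map_natCast] at h3
  have := (ZMod.exists_sq_eq_two_iff (p := p) (by rintro rfl; omega)).1 (by exact_mod_cast h3)
  omega

end

section
open NumberField Pointwise

lemma span_pair_sq {R : Type*} [CommRing R] (z t m : R) (k : ℕ) (hz : z ^ 2 ^ (k + 1) = -1) (ht : t * (1 - t) = 2 * m) :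
    (Ideal.span {1 - z, t}) ^ 2 = Ideal.span {1 - z ^ 2, t} := by
  obtain ⟨w, hw⟩ : (1 - z ^ 2) ∣ (2 : R) := by
    have h := sub_dvd_pow_sub_pow (z ^ 2) 1 (2 ^ k)
    rw [one_pow, ← pow_mul, show 2 * 2 ^ k = 2 ^ (k + 1) by rw [pow_succ, mul_comm], hz] at h
    obtain ⟨c, hc⟩ := h
    exact ⟨c, by linear_combination -hc⟩
  obtain ⟨v, hv⟩ : (1 - z) ∣ (1 + z) := by
    have h := sub_dvd_pow_sub_pow z 1 (2 ^ (k + 1) + 1)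
    rw [one_pow, pow_succ, hz] at h
    obtain ⟨c, hc⟩ := h
    exact ⟨c, by linear_combination -hc⟩
  rw [pow_two, Ideal.span_pair_mul_span_pair]
  apply le_antisymm
  · rw [Ideal.span_le]
    intro x hx
    simp only [Set.mem_insert_iff, Set.mem_singleton_iff] at hx
    rw [SetLike.mem_coe, Ideal.mem_span_pair]
    rcases hx with rfl | rfl | rfl | rfl
    · exact ⟨w * (1 - z) - 1, 0, by linear_combination -(1 - z) * hw⟩
    · exact ⟨0, 1 - z, by ring⟩
    · exact ⟨0, 1 - z, by ring⟩
    · exact ⟨0, t, by ring⟩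
  · rw [Ideal.span_le]
    have h1 : (1 - z) * (1 - z) ∈ Ideal.span {(1 - z) * (1 - z), (1 - z) * t, t * (1 - z), t * t} := Ideal.subset_span (by simp)
    have h2 : t * t ∈ Ideal.span {(1 - z) * (1 - z), (1 - z) * t, t * (1 - z), t * t} := Ideal.subset_span (by simp)
    intro x hx
    simp only [Set.mem_insert_iff, Set.mem_singleton_iff] at hx
    rcases hx with rfl | rfl
    · have := Ideal.mul_mem_left _ v h1
      rw [SetLike.mem_coe]
      convert this using 1
      linear_combination (1 - z) * hv
    · have := Ideal.add_mem _ (Ideal.mul_mem_left _ (w * v * m) h1) h2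
      rw [SetLike.mem_coe]
      convert this using 1
      linear_combination ht + m * hw + m * w * (1 - z) * hv

lemma span_pair_pow {R : Type*} [CommRing R] (t m : R) (ht : t * (1 - t) = 2 * m) (k : ℕ) : ∀ (z : R) (hz : z ^ 2 ^ k = -1),
    (Ideal.span {1 - z, t}) ^ 2 ^ k = Ideal.span {2, t} := by
  induction k with
  | zero =>
    intro z hz
    rw [pow_zero, pow_one] at hz
    rw [pow_zero, pow_one, hz]; norm_num
  | succ k ih =>
    intro z hz
    rw [pow_succ, mul_comm, pow_mul, span_pair_sq z t m k hz ht]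
    apply ih
    rw [← pow_mul, ← hz, pow_succ, mul_comm]

lemma span_pair_mul_conj {R : Type*} [CommRing R] (x t m : R) (ht : t * (1 - t) = x * m) :
    Ideal.span {x, t} * Ideal.span {x, 1 - t} = Ideal.span {x} := by
  rw [Ideal.span_pair_mul_span_pair]
  apply le_antisymm
  · rw [Ideal.span_le]
    intro y hy
    simp only [Set.mem_insert_iff, Set.mem_singleton_iff] at hy
    rw [SetLike.mem_coe, Ideal.mem_span_singleton]
    rcases hy with rfl | rfl | rfl | rfl
    · exact ⟨x, rfl⟩
    · exact ⟨_, rfl⟩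
    · exact ⟨t, mul_comm _ _⟩
    · exact ⟨m, ht⟩
  · rw [Ideal.span_singleton_le_iff_mem]
    have h1 : x * (1 - t) ∈ Ideal.span {x * x, x * (1 - t), t * x, t * (1 - t)} := Ideal.subset_span (by simp)
    have h2 : t * x ∈ Ideal.span {x * x, x * (1 - t), t * x, t * (1 - t)} := Ideal.subset_span (by simp)
    have := Ideal.add_mem _ h1 h2
    convert this using 1
    ring

lemma span_p_sq {R : Type*} [CommRing R] (p q : ℕ) (hpq : Nat.Coprime p q) (e : R) (he : e ^ 2 = -((p * q : ℕ) : R)) :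
    (Ideal.span {(p : R), e}) ^ 2 = Ideal.span {(p : R)} := by
  rw [pow_two, Ideal.span_pair_mul_span_pair]
  push_cast at he
  apply le_antisymm
  · rw [Ideal.span_le]
    intro y hy
    simp only [Set.mem_insert_iff, Set.mem_singleton_iff] at hy
    rw [SetLike.mem_coe, Ideal.mem_span_singleton]
    rcases hy with rfl | rfl | rfl | rfl
    · exact ⟨p, rfl⟩
    · exact ⟨_, rfl⟩
    · exact ⟨e, mul_comm _ _⟩
    · exact ⟨-q, by linear_combination he⟩
  · rw [Ideal.span_singleton_le_iff_mem]
    have h1 : (p : R) * p ∈ Ideal.span {(p : R) * p, (p : R) * e, e * p, e * e} := Ideal.subset_span (by simp)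
    have h2 : e * e ∈ Ideal.span {(p : R) * p, (p : R) * e, e * p, e * e} := Ideal.subset_span (by simp)
    obtain ⟨a, b, hab⟩ : ∃ a b : ℤ, a * p + b * q = 1 := by
      have := (Nat.isCoprime_iff_coprime.2 hpq)
      obtain ⟨a, b, h⟩ := this
      exact ⟨a, b, h⟩
    have hab' : (a : R) * p + b * q = 1 := by exact_mod_cast congrArg (fun t : ℤ => (t : R)) hab
    have := Ideal.add_mem _ (Ideal.mul_mem_left _ (a : R) h1) (Ideal.mul_mem_left _ (-(b : R)) h2)
    convert this using 1
    linear_combination -(p : R) * hab' + b * he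

lemma absNorm_smul {L : Type*} [Field L] [NumberField L] {G : Type*} [Group G] [MulSemiringAction G (𝓞 L)] (g : G) (I : Ideal (𝓞 L)) :
    Ideal.absNorm (g • I) = Ideal.absNorm I := by
  rw [Ideal.absNorm_apply, Ideal.absNorm_apply, Submodule.cardQuot_apply, Submodule.cardQuot_apply]
  have e : (𝓞 L ⧸ I) ≃+* (𝓞 L ⧸ (g • I)) := Ideal.quotientEquiv I (g • I) (MulSemiringAction.toRingEquiv G (𝓞 L) g) (by
    rw [Ideal.pointwise_smul_def]; rfl)
  exact Nat.card_congr e.symm.toEquiv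

lemma smul_span_pair {L : Type*} [Field L] [NumberField L] {G : Type*} [Group G] [MulSemiringAction G (𝓞 L)] (g : G) (x y : 𝓞 L) :
    g • Ideal.span {x, y} = Ideal.span {g • x, g • y} := by
  rw [Ideal.pointwise_smul_def, Ideal.map_span, Set.image_pair]; rfl

/-- pell ideal -/
lemma pell_principal {p q : ℕ} (hp : p.Prime) (hq : q.Prime) (hp8 : p % 8 = 5) (hq8 : q % 8 = 3)
    {R : Type*} [CommRing R] [IsDedekindDomain R] [CharZero R] (e i : R) (hi : i ^ 2 = -1) (he : e ^ 2 = -((p * q : ℕ) : R)) :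
    icls (Ideal.span {(p : R), e}) = 1 := by
  have hcop : Nat.Coprime p q := (Nat.coprime_primes hp hq).2 (by rintro rfl; omega)
  have hsq := span_p_sq p q hcop e he
  have hp0 : (p : R) ≠ 0 := by exact_mod_cast hp.ne_zero
  have hne : Ideal.span {(p : R), e} ≠ ⊥ := by
    intro h
    rw [h] at hsq
    apply span_sing_ne hp0
    rw [← hsq]; simp
  suffices h : ∃ α c : R, c ≠ 0 ∧ Ideal.span {α} ^ 2 = Ideal.span {(p : R)} * Ideal.span {c} ^ 2 by
    obtain ⟨α, c, hc, h⟩ := h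
    rw [← hsq, ← mul_pow] at h
    have hα : α ≠ 0 := by
      rintro rfl
      have h' : (Ideal.span {(p : R), e} * Ideal.span {c}) ^ 2 = ⊥ := by rw [← h]; simp
      have := pow_eq_zero_iff (two_ne_zero) |>.1 h'
      rcases mul_eq_zero.1 this with h | h
      · exact hne h
      · exact span_sing_ne hc h
    have := ideal_sq_inj (span_sing_ne hα) (mul_ne_zero hne (span_sing_ne hc)) h
    have h5 := icls_mul hne (span_sing_ne hc)
    rw [← this, icls_span hα, icls_span hc, mul_one] at h5
    exact h5.symm
  push_cast at he
  obtain ⟨u, v, h⟩ := pell_pq hp hq hp8 hq8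
  rcases h with h | h
  · refine ⟨p * u + v * (i * e), 1, one_ne_zero, ?_⟩
    have h1 : ((p : R) * u ^ 2 - q * v ^ 2) ^ 2 = 1 := by
      rcases h with h | h
      · have : ((p : R) * u ^ 2 - q * v ^ 2) = 1 := by exact_mod_cast congrArg (fun t : ℤ => (t : R)) h
        rw [this]; ring
      · have : ((p : R) * u ^ 2 - q * v ^ 2) = -1 := by exact_mod_cast congrArg (fun t : ℤ => (t : R)) h
        rw [this]; ring
    have hun : IsUnit ((p : R) * u ^ 2 + q * v ^ 2 + 2 * u * v * (i * e)) := by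
      refine IsUnit.of_mul_eq_one ((p : R) * u ^ 2 + q * v ^ 2 - 2 * u * v * (i * e)) ?_
      linear_combination h1 - 4 * u ^ 2 * v ^ 2 * i ^ 2 * he + 4 * u ^ 2 * v ^ 2 * p * q * hi
    rw [Ideal.span_singleton_pow, show (Ideal.span {(1 : R)}) = 1 by simp, one_pow, mul_one]
    rw [show ((p : R) * u + v * (i * e)) ^ 2 = p * ((p : R) * u ^ 2 + q * v ^ 2 + 2 * u * v * (i * e)) by
      linear_combination v ^ 2 * i ^ 2 * he - v ^ 2 * p * q * hi]
    exact Ideal.span_singleton_mul_right_unit hun _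
  · refine ⟨p * u + v * (i * e), 1 + i, ?_, ?_⟩
    · intro h0
      have : i = -1 := by linear_combination h0
      rw [this] at hi
      norm_num at hi
    obtain ⟨w, hw⟩ : ∃ w : ℤ, p * u ^ 2 + q * v ^ 2 = 2 * w := by
      rcases h with h | h
      · exact ⟨q * v ^ 2 + 1, by linear_combination h⟩
      · exact ⟨q * v ^ 2 - 1, by linear_combination h⟩
    have hwR : (p : R) * u ^ 2 + q * v ^ 2 = 2 * w := by exact_mod_cast congrArg (fun t : ℤ => (t : R)) hw
    have h1 : (w : R) ^ 2 - p * q * (u * v) ^ 2 = 1 := by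
      have : w ^ 2 - p * q * (u * v) ^ 2 = 1 := by
        have h4 : 4 * (w ^ 2 - p * q * (u * v) ^ 2) = 4 * 1 := by
          rcases h with h | h
          · linear_combination (-(2 * w) - (p * u ^ 2 + q * v ^ 2)) * hw + (p * u ^ 2 - q * v ^ 2 + 2) * h
          · linear_combination (-(2 * w) - (p * u ^ 2 + q * v ^ 2)) * hw + (p * u ^ 2 - q * v ^ 2 - 2) * h
        linarith
      exact_mod_cast congrArg (fun t : ℤ => (t : R)) this
    have hun : IsUnit (((w : R) + u * v * (i * e)) * (-i)) := by
      refine IsUnit.mul ?_ ?_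
      · refine IsUnit.of_mul_eq_one ((w : R) - u * v * (i * e)) ?_
        linear_combination h1 - u ^ 2 * v ^ 2 * i ^ 2 * he + u ^ 2 * v ^ 2 * p * q * hi
      · exact IsUnit.of_mul_eq_one i (by linear_combination -hi)
    rw [Ideal.span_singleton_pow, Ideal.span_singleton_pow, Ideal.span_singleton_mul_span_singleton]
    rw [show ((p : R) * u + v * (i * e)) ^ 2 = (p * (1 + i) ^ 2) * (((w : R) + u * v * (i * e)) * (-i)) by
      linear_combination v ^ 2 * i ^ 2 * he - v ^ 2 * p * q * hi + p * hwR + (p * ((w : R) + u * v * (i * e)) * (i + 2)) * hi]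
    exact Ideal.span_singleton_mul_right_unit hun _

end

section
open NumberField Pointwise

/-- the abstract situation: `L = ℚ(ζ, δ)`, `δ² = -pq`. -/
structure LD (p q n : ℕ) (L : Type) [Field L] [NumberField L] (ζ δ : L) : Prop where
  hp : p.Prime
  hq : q.Prime
  hp8 : p % 8 = 5
  hq8 : q % 8 = 3
  hn : 1 ≤ n
  hζ : IsPrimitiveRoot ζ (2 ^ (n + 2))
  hδ : δ ^ 2 = -((p * q : ℕ) : L)
  top : IntermediateField.adjoin ℚ {ζ, δ} = ⊤
  gal : IsGalois ℚ L

namespace LD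
variable {p q n : ℕ} {L : Type} [Field L] [NumberField L] {ζ δ : L}

lemma pq0 (D : LD p q n L ζ δ) : (p * q : ℕ) ≠ 0 := Nat.mul_ne_zero D.hp.ne_zero D.hq.ne_zero

lemma ndvd (D : LD p q n L ζ δ) : ¬ p ∣ q := by
  intro h
  have := (Nat.prime_dvd_prime_iff_eq D.hp D.hq).1 h
  have := D.hp8; have := D.hq8
  omega

lemma ndvd' (D : LD p q n L ζ δ) : ¬ q ∣ p := by
  intro h
  have := (Nat.prime_dvd_prime_iff_eq D.hq D.hp).1 h
  have := D.hp8; have := D.hq8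
  omega

lemma δ0 (D : LD p q n L ζ δ) : δ ≠ 0 := by
  rintro rfl
  have h := D.hδ
  have : ((p * q : ℕ) : L) = 0 := by linear_combination h
  exact D.pq0 (by exact_mod_cast this)

lemma cyc (D : LD p q n L ζ δ) : IsCyclotomicExtension {2 ^ (n + 2)} ℚ (IntermediateField.adjoin ℚ {ζ}) :=
  D.hζ.intermediateField_adjoin_isCyclotomicExtension ℚ

lemma δ_int (D : LD p q n L ζ δ) : IsIntegral ℤ δ := by
  refine ⟨Polynomial.X ^ 2 + Polynomial.C ((p * q : ℕ) : ℤ), Polynomial.monic_X_pow_add_C _ two_ne_zero, ?_⟩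
  simp [D.hδ]

lemma δ_not_mem (D : LD p q n L ζ δ) (x : IntermediateField.adjoin ℚ {ζ}) : (x : L) ≠ δ := by
  intro h
  haveI := D.cyc
  have hx : x ^ 2 = -((p * q : ℕ) : IntermediateField.adjoin ℚ {ζ}) := by
    apply Subtype.ext
    have := D.hδ
    rw [← h] at this
    simpa using this
  have hxi : IsIntegral ℤ x := by
    refine ⟨Polynomial.X ^ 2 + Polynomial.C ((p * q : ℕ) : ℤ), Polynomial.monic_X_pow_add_C _ two_ne_zero, ?_⟩
    simp [hx]
  obtain ⟨y, hy⟩ : ∃ y : 𝓞 (IntermediateField.adjoin ℚ {ζ}), (y : IntermediateField.adjoin ℚ {ζ}) = x := ⟨⟨x, hxi⟩, rfl⟩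
  have := unram_sq (k := n + 2) (IntermediateField.adjoin ℚ {ζ}) p D.hp (by have := D.hp8; rintro rfl; omega) 1 q odd_one D.ndvd D.hq.ne_zero y
  apply this
  rw [Ideal.span_singleton_pow, pow_one]
  have h1 : y ^ 2 = -((p * q : ℕ) : 𝓞 (IntermediateField.adjoin ℚ {ζ})) := by
    apply RingOfIntegers.ext
    rw [← hy] at hx
    simpa using hx
  rw [h1, Ideal.span_singleton_neg]

lemma topK (D : LD p q n L ζ δ) : IntermediateField.adjoin (IntermediateField.adjoin ℚ {ζ}) {δ} = ⊤ := by
  have h := D.top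
  have h2 := IntermediateField.adjoin_adjoin_left ℚ ({ζ} : Set L) {δ}
  rw [Set.singleton_union, h] at h2
  apply IntermediateField.restrictScalars_injective ℚ
  exact h2.trans rfl

lemma finrankK (D : LD p q n L ζ δ) : Module.finrank (IntermediateField.adjoin ℚ {ζ}) L = 2 := by
  set K := IntermediateField.adjoin ℚ {ζ}
  have hirr : Irreducible (Polynomial.X ^ 2 - Polynomial.C (-((p * q : ℕ) : K))) := by
    apply X_pow_sub_C_irreducible_of_prime Nat.prime_two
    intro b hb
    have hb' : (b : L) ^ 2 = δ ^ 2 := by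
      rw [D.hδ]; exact_mod_cast congrArg (fun t : K => (t : L)) hb
    rcases sq_eq_sq_iff_eq_or_eq_neg.1 hb' with h | h
    · exact D.δ_not_mem b h
    · exact D.δ_not_mem (-b) (by push_cast; rw [h]; ring)
  have hmin := minpoly.eq_of_irreducible_of_monic hirr (x := δ) (by simp [D.hδ]) (Polynomial.monic_X_pow_sub_C _ two_ne_zero)
  have h_intg : IsIntegral K δ := ⟨_, Polynomial.monic_X_pow_sub_C (-((p * q : ℕ) : K)) two_ne_zero, by simp [D.hδ]⟩
  have := IntermediateField.adjoin.finrank h_intg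
  rw [D.topK, ← hmin, Polynomial.natDegree_X_pow_sub_C, IntermediateField.finrank_top'] at this
  exact this

lemma finrankQ (D : LD p q n L ζ δ) : Module.finrank ℚ L = 2 ^ (n + 2) := by
  haveI := D.cyc
  have e1 := Module.finrank_mul_finrank ℚ (IntermediateField.adjoin ℚ {ζ}) L
  rw [D.finrankK, finrank_cyc_two (n + 1)] at e1
  rw [← e1, pow_succ 2 (n + 1)]

lemma ext_hom (D : LD p q n L ζ δ) {A : Type*} [Semiring A] [Algebra ℚ A] {E : Type*} [Field E] [Algebra ℚ E] (f g : L →ₐ[ℚ] E) (h1 : f ζ = g ζ) (h2 : f δ = g δ) : f = g := by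
  haveI := D.gal
  apply AlgHom.ext
  intro x
  have hx : x ∈ IntermediateField.adjoin ℚ {ζ, δ} := by rw [D.top]; trivial
  induction hx using IntermediateField.adjoin_induction with
  | mem x hx =>
    rcases hx with rfl | hx
    · exact h1
    · rw [Set.mem_singleton_iff.1 hx]; exact h2
  | algebraMap x => simp
  | add x y _ _ hx hy => rw [map_add, map_add, hx, hy]
  | inv x _ hx => rw [map_inv₀, map_inv₀, hx]
  | mul x y _ _ hx hy => rw [map_mul, map_mul, hx, hy]

lemma exists_sigma (D : LD p q n L ζ δ) : ∃ σ : L ≃ₐ[IntermediateField.adjoin ℚ {ζ}] L, σ ≠ 1 ∧ σ ζ = ζ ∧ σ δ = -δ := by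
  haveI := D.gal
  obtain ⟨σ, hσ⟩ := exists_quad_aut D.finrankK
  refine ⟨σ, hσ, AlgEquiv.commutes σ (⟨ζ, IntermediateField.mem_adjoin_simple_self ℚ _⟩ : IntermediateField.adjoin ℚ {ζ}), ?_⟩
  have h1 : (σ δ) ^ 2 = δ ^ 2 := by rw [← map_pow, D.hδ, map_neg, map_natCast]
  rcases sq_eq_sq_iff_eq_or_eq_neg.1 h1 with h | h
  · exfalso
    obtain ⟨w, hw⟩ := quad_fixed D.finrankK σ hσ δ h
    exact D.δ_not_mem w hw
  · exact h

lemma conj_delta (D : LD p q n L ζ δ) {w : ℂ} (hw : w ^ 2 = -((p * q : ℕ) : ℂ)) : (starRingEnd ℂ) w = -w := by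
  have h1 : ((starRingEnd ℂ) w) ^ 2 = w ^ 2 := by
    rw [← map_pow, hw, map_neg, map_natCast]
  rcases sq_eq_sq_iff_eq_or_eq_neg.1 h1 with h | h
  · exfalso
    obtain ⟨r, rfl⟩ := Complex.conj_eq_iff_real.1 h
    have h2 : r ^ 2 = -((p * q : ℕ) : ℝ) := by exact_mod_cast hw
    have h3 : (0 : ℝ) < ((p * q : ℕ) : ℝ) := by exact_mod_cast Nat.pos_of_ne_zero D.pq0
    nlinarith [sq_nonneg r]
  · exact h

lemma conj_zeta (D : LD p q n L ζ δ) {w : ℂ} (hw : w ^ 2 ^ (n + 2) = 1) : (starRingEnd ℂ) w = w⁻¹ := by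
  have h : ‖w‖ = 1 := Complex.norm_eq_one_of_pow_eq_one hw (by positivity)
  rw [Complex.inv_def, Complex.normSq_eq_norm_sq, h]; simp

lemma exists_tau (D : LD p q n L ζ δ) : ∃ τ : L ≃ₐ[ℚ] L, τ ζ = ζ⁻¹ ∧ τ δ = -δ ∧ ∀ (φ : L →+* ℂ) (x : L), φ (τ x) = (starRingEnd ℂ) (φ x) := by
  haveI := D.gal
  let φ₀ : L →+* ℂ := Classical.arbitrary (L →+* ℂ)
  letI : Algebra L ℂ := φ₀.toAlgebra
  haveI : IsScalarTower ℚ L ℂ := IsScalarTower.of_algebraMap_eq (fun x => by simp)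
  let τ := (Complex.conjAe.restrictScalars ℚ).restrictNormal L
  have hτ : ∀ x : L, φ₀ (τ x) = (starRingEnd ℂ) (φ₀ x) := fun x =>
    AlgEquiv.restrictNormal_commutes (Complex.conjAe.restrictScalars ℚ) L x
  have hcz : ∀ φ : L →+* ℂ, (starRingEnd ℂ) (φ ζ) = (φ ζ)⁻¹ := fun φ =>
    D.conj_zeta (by rw [← map_pow, D.hζ.pow_eq_one, map_one])
  have hcd : ∀ φ : L →+* ℂ, (starRingEnd ℂ) (φ δ) = -(φ δ) := fun φ =>
    D.conj_delta (by rw [← map_pow, D.hδ, map_neg, map_natCast])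
  have h1 : τ ζ = ζ⁻¹ := φ₀.injective (by rw [hτ, hcz, map_inv₀])
  have h2 : τ δ = -δ := φ₀.injective (by rw [hτ, hcd, map_neg])
  refine ⟨τ, h1, h2, ?_⟩
  intro φ x
  have := D.ext_hom (A := ℚ) ((φ.comp (τ : L →+* L)).toRatAlgHom) (((starRingEnd ℂ).comp φ).toRatAlgHom) (by
    change φ (τ ζ) = (starRingEnd ℂ) (φ ζ)
    rw [h1, hcz, map_inv₀]) (by
    change φ (τ δ) = (starRingEnd ℂ) (φ δ)
    rw [h2, hcd, map_neg])
  exact congrArg (fun f : L →ₐ[ℚ] ℂ => f x) this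

end LD

end

section
open NumberField Pointwise

lemma four_le_card {Q : Type*} [CommGroup Q] [Finite Q] (hQ : ∀ x : Q, x ^ 2 = 1) (a b : Q) (ha : a ≠ 1) (hb : b ≠ 1)
    (hab : a * b ≠ 1) : 4 ≤ Nat.card Q := by
  classical
  haveI := Fintype.ofFinite Q
  rw [Nat.card_eq_fintype_card]
  have h1 : a ≠ b := by
    rintro rfl
    exact hab (by rw [← pow_two]; exact hQ a)
  have h2 : a ≠ a * b := by
    intro h
    exact hb (mul_left_cancel (a := a) (by rw [← h, mul_one]))
  have h3 : b ≠ a * b := by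
    intro h
    exact ha (mul_right_cancel (b := b) (by rw [← h, one_mul]))
  have : ({1, a, b, a * b} : Finset Q).card = 4 := by
    rw [Finset.card_insert_of_notMem, Finset.card_insert_of_notMem, Finset.card_insert_of_notMem, Finset.card_singleton]
    · simpa using h3
    · simp [h1, h2]
    · simp [ha.symm, hb.symm, hab.symm]
  rw [← this]
  exact Finset.card_le_univ _

namespace LD
variable {p q n : ℕ} {L : Type} [Field L] [NumberField L] {ζ δ : L}

lemma theta_int (D : LD p q n L ζ δ) : IsIntegral ℤ ((1 + δ) / 2) := by
  obtain ⟨c, hc⟩ : ∃ c : ℤ, 4 * c = p * q + 1 := by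
    refine ⟨(p * q + 1) / 4, ?_⟩
    have h1 : (p * q) % 4 = 3 := by
      have := D.hp8; have := D.hq8
      rw [Nat.mul_mod, show p % 4 = 1 by omega, show q % 4 = 3 by omega]
    omega
  refine ⟨Polynomial.X ^ 2 + (-Polynomial.X + Polynomial.C c), ?_, ?_⟩
  · apply Polynomial.monic_X_pow_add
    compute_degree!
  · have hc' : (4 : L) * (c : L) = p * q + 1 := by exact_mod_cast congrArg (fun t : ℤ => (t : L)) hc
    have h := D.hδ
    push_cast at h
    simp only [Polynomial.eval₂_add, Polynomial.eval₂_pow, Polynomial.eval₂_neg, Polynomial.eval₂_X, Polynomial.eval₂_C]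
    simp only [algebraMap_int_eq, Int.coe_castRingHom]
    field_simp
    linear_combination h + hc'

lemma ram (D : LD p q n L ζ δ) (l m : ℕ) (hl : l.Prime) (hlm : ¬ l ∣ m) (hm0 : m ≠ 0) (hpq : l * m = p * q) (P : Ideal (𝓞 L)) (hP : P.IsPrime)
    (hPo : P.LiesOver (Ideal.span {(l : ℤ)})) : 2 ≤ P.ramificationIdx ℤ := by
  classical
  have hl0 : (l : 𝓞 L) ≠ 0 := by exact_mod_cast hl.ne_zero
  have hm00 : (m : 𝓞 L) ≠ 0 := by exact_mod_cast hm0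
  have hmap : (Ideal.span {(l : ℤ)}).map (algebraMap ℤ (𝓞 L)) = Ideal.span {(l : 𝓞 L)} := by
    rw [Ideal.map_span, Set.image_singleton]; simp
  have hne : Ideal.span {(l : 𝓞 L)} ≠ ⊥ := by simpa using hl0
  have hne' : Ideal.span {(m : 𝓞 L)} ≠ ⊥ := by simpa using hm00
  rw [Ideal.IsDedekindDomain.ramificationIdx_eq_normalizedFactors_count (Ideal.span {(l : ℤ)}) P (by rw [hmap]; exact hne), hmap]
  have h0 : (UniqueFactorizationMonoid.normalizedFactors (Ideal.span {(m : 𝓞 L)})).count P = 0 := by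
    rw [Multiset.count_eq_zero]
    intro hmem
    have h1 := UniqueFactorizationMonoid.dvd_of_mem_normalizedFactors hmem
    rw [Ideal.dvd_span_singleton] at h1
    have h2 : ((m : ℤ) : 𝓞 L) ∈ P := by exact_mod_cast h1
    have h3 : (m : ℤ) ∈ Ideal.span {(l : ℤ)} := by
      rw [hPo.over, Ideal.mem_comap]; simpa using h2
    rw [Ideal.mem_span_singleton] at h3
    exact hlm (by exact_mod_cast h3)
  have hlP : (l : 𝓞 L) ∈ P := by
    have h3 : (l : ℤ) ∈ Ideal.span {(l : ℤ)} := Ideal.mem_span_singleton_self _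
    rw [hPo.over, Ideal.mem_comap] at h3
    simpa using h3
  have hP0 : P ≠ ⊥ := by
    rintro rfl
    exact hl0 (by simpa using hlP)
  have h1 : (UniqueFactorizationMonoid.normalizedFactors (Ideal.span {(l : 𝓞 L)})).count P ≠ 0 := by
    rw [Multiset.count_ne_zero, Ideal.mem_normalizedFactors_iff hne]
    exact ⟨hP, by rwa [Ideal.span_singleton_le_iff_mem]⟩
  obtain ⟨d, hd⟩ : ∃ d : 𝓞 L, (d : L) = δ := ⟨⟨δ, D.δ_int⟩, rfl⟩
  have hd2 : d ^ 2 = -(l * m : 𝓞 L) := by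
    apply RingOfIntegers.ext
    have := D.hδ
    rw [← hpq] at this
    push_cast at this
    simpa [hd] using this
  have e : Ideal.span {d} ^ 2 = Ideal.span {(l : 𝓞 L)} * Ideal.span {(m : 𝓞 L)} := by
    rw [Ideal.span_singleton_pow, hd2, Ideal.span_singleton_neg, Ideal.span_singleton_mul_span_singleton]
  have h4 := congrArg (fun I => (UniqueFactorizationMonoid.normalizedFactors I).count P) e
  beta_reduce at h4
  rw [UniqueFactorizationMonoid.normalizedFactors_mul hne hne', UniqueFactorizationMonoid.normalizedFactors_pow,
    Multiset.count_add, Multiset.count_nsmul, h0] at h4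
  omega

lemma z_neg (D : LD p q n L ζ δ) : D.hζ.toInteger ^ 2 ^ (n + 1) = -1 := by
  apply RingOfIntegers.ext
  have := prim_two_pow_neg (n + 1) D.hζ
  exact this

lemma inert (D : LD p q n L ζ δ) (l : ℕ) (hl : l.Prime) (hl8 : l % 8 = 3 ∨ l % 8 = 5) (P : Ideal (𝓞 L)) (hP : P.IsPrime)
    (hPo : P.LiesOver (Ideal.span {(l : ℤ)})) : 2 ^ n ≤ P.inertiaDeg ℤ := by
  haveI : Fact (Nat.Prime 2) := ⟨Nat.prime_two⟩
  haveI hmax : (Ideal.span {(l : ℤ)}).IsMaximal := by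
    haveI : Fact l.Prime := ⟨hl⟩
    exact Int.ideal_span_isMaximal_of_prime l
  haveI : P.IsMaximal := .of_liesOver_isMaximal P (Ideal.span {(l : ℤ)})
  have hl0 : (l : 𝓞 L) ≠ 0 := by exact_mod_cast hl.ne_zero
  have hlP : (l : 𝓞 L) ∈ P := by
    have h3 : (l : ℤ) ∈ Ideal.span {(l : ℤ)} := Ideal.mem_span_singleton_self _
    rw [hPo.over, Ideal.mem_comap] at h3
    simpa using h3
  have hP0 : P ≠ ⊥ := by
    rintro rfl
    exact hl0 (by simpa using hlP)
  have hN := Ideal.absNorm_eq_pow_inertiaDeg' P hl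
  rw [Ideal.inertiaDeg'_eq_inertiaDeg] at hN
  have hf0 : P.inertiaDeg ℤ ≠ 0 := (Ideal.inertiaDeg_pos ..).ne'
  apply order_lemma l _ n hl8 hf0 D.hn
  rw [← hN, Ideal.absNorm_apply, Submodule.cardQuot_apply]
  letI := Ideal.Quotient.field P
  haveI : Finite (𝓞 L ⧸ P) := Ideal.finiteQuotientOfFreeOfNeBot P hP0
  rw [← Nat.card_units]
  have hu : IsUnit (Ideal.Quotient.mk P D.hζ.toInteger) := (((D.hζ.toInteger_isPrimitiveRoot).isUnit (by positivity))).map _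
  obtain ⟨u, hu⟩ := hu
  have hord : orderOf u = 2 ^ (n + 2) := by
    apply orderOf_eq_prime_pow
    · intro h
      have h1 : (Ideal.Quotient.mk P D.hζ.toInteger) ^ 2 ^ (n + 1) = 1 := by
        rw [← hu, ← Units.val_pow_eq_pow_val, h, Units.val_one]
      rw [← map_pow, D.z_neg, map_neg, map_one] at h1
      have h2 : (2 : 𝓞 L) ∈ P := by
        rw [← Ideal.Quotient.eq_zero_iff_mem, map_ofNat]
        linear_combination -h1
      have h4 : (2 : ℤ) ∈ Ideal.span {(l : ℤ)} := by
        rw [hPo.over, Ideal.mem_comap]; simpa using h2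
      rw [Ideal.mem_span_singleton] at h4
      have h5 : l ∣ 2 := by exact_mod_cast h4
      have := (Nat.prime_dvd_prime_iff_eq hl Nat.prime_two).1 h5
      omega
    · apply Units.ext
      push_cast
      rw [hu, ← map_pow, D.hζ.toInteger_isPrimitiveRoot.pow_eq_one, map_one]
  rw [← hord]
  exact orderOf_dvd_natCard u

lemma ncard_le (D : LD p q n L ζ δ) (l m : ℕ) (hl : l.Prime) (hl8 : l % 8 = 3 ∨ l % 8 = 5) (hlm : ¬ l ∣ m) (hm0 : m ≠ 0) (hpq : l * m = p * q) :
    (Ideal.primesOver (Ideal.span {(l : ℤ)}) (𝓞 L)).ncard ≤ 2 := by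
  haveI := D.gal
  haveI hmax : (Ideal.span {(l : ℤ)}).IsMaximal := by
    haveI : Fact l.Prime := ⟨hl⟩
    exact Int.ideal_span_isMaximal_of_prime l
  obtain ⟨⟨P, hP, hPo⟩⟩ := (Ideal.span {(l : ℤ)}).nonempty_primesOver (S := 𝓞 L)
  haveI : IsGaloisGroup (L ≃ₐ[ℚ] L) ℤ (𝓞 L) := inferInstance
  have h1 := Ideal.ncard_primesOver_mul_ramificationIdxIn_mul_inertiaDegIn (Ideal.span {(l : ℤ)}) (𝓞 L) (L ≃ₐ[ℚ] L)
  rw [Ideal.ramificationIdxIn_eq_ramificationIdx (Ideal.span {(l : ℤ)}) P (L ≃ₐ[ℚ] L),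
    Ideal.inertiaDegIn_eq_inertiaDeg (Ideal.span {(l : ℤ)}) P (L ≃ₐ[ℚ] L), IsGalois.card_aut_eq_finrank, D.finrankQ] at h1
  have h2 := D.ram l m hl hlm hm0 hpq P hP hPo
  have h3 := D.inert l hl hl8 P hP hPo
  have h4 : 2 * 2 ^ n ≤ P.ramificationIdx ℤ * P.inertiaDeg ℤ := Nat.mul_le_mul h2 h3
  have h5 : (Ideal.primesOver (Ideal.span {(l : ℤ)}) (𝓞 L)).ncard * (2 * 2 ^ n) ≤ 2 * (2 * 2 ^ n) := by
    calc _ ≤ _ := Nat.mul_le_mul_left _ h4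
      _ = 2 ^ (n + 2) := h1
      _ = _ := by ring
  exact Nat.le_of_mul_le_mul_right h5 (by positivity)

end LD

end

section
open NumberField Pointwise

namespace LD
variable {p q n : ℕ} {L : Type} [Field L] [NumberField L] {ζ δ : L}

lemma norm_shape (D : LD p q n L ζ δ) (σ : L ≃ₐ[IntermediateField.adjoin ℚ {ζ}] L) (hσ : σ ≠ 1) (hσδ : σ δ = -δ) (z : L) :
    ∃ x y : IntermediateField.adjoin ℚ {ζ},
      Algebra.norm (IntermediateField.adjoin ℚ {ζ}) z = x ^ 2 - ((p * q : ℕ) : IntermediateField.adjoin ℚ {ζ}) * y ^ 2 := by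
  haveI := D.gal
  have h2 := D.finrankK
  have hss : ∀ z : L, σ (σ z) = z := fun z => congrArg (fun f => f z) (quad_sq h2 σ)
  have hδ0 := D.δ0
  obtain ⟨x, hx⟩ := quad_fixed h2 σ hσ ((z + σ z) / 2) (by
    rw [map_div₀, map_add, hss, map_ofNat, add_comm])
  obtain ⟨y, hy⟩ := quad_fixed h2 σ hσ ((z - σ z) / (2 * δ)) (by
    rw [map_div₀, map_sub, hss, map_mul, map_ofNat, hσδ]
    field_simp
    ring)
  let i : IntermediateField.adjoin ℚ {ζ} := ⟨ζ, IntermediateField.mem_adjoin_simple_self ℚ _⟩ ^ (2 ^ n)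
  have hi : (algebraMap (IntermediateField.adjoin ℚ {ζ}) L i) ^ 2 = -1 := by
    have := prim_two_pow_neg (n + 1) D.hζ
    change (ζ ^ (2 ^ n)) ^ 2 = -1
    rw [← this]; ring
  refine ⟨x, i * y, ?_⟩
  apply FaithfulSMul.algebraMap_injective (IntermediateField.adjoin ℚ {ζ}) L
  rw [quad_norm h2 σ hσ z, map_sub, map_mul, map_pow, map_pow, map_mul, hx, hy, map_natCast, mul_pow, hi]
  have e : ((p * q : ℕ) : L) = - δ ^ 2 := by rw [D.hδ]; ring
  rw [e]
  field_simp
  ring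

lemma index_ge (D : LD p q n L ζ δ) (hi : (uH (IntermediateField.adjoin ℚ {ζ}) L).index ≠ 0) :
    4 ≤ (uH (IntermediateField.adjoin ℚ {ζ}) L).index := by
  haveI := D.gal
  haveI := D.cyc
  set K := IntermediateField.adjoin ℚ {ζ} with hK
  obtain ⟨σ, hσ, hσζ, hσδ⟩ := D.exists_sigma
  let z : K := ⟨ζ, IntermediateField.mem_adjoin_simple_self ℚ _⟩
  have hz : IsPrimitiveRoot z (2 ^ (n + 2)) :=
    IsPrimitiveRoot.of_map_of_injective (f := algebraMap K L) D.hζ (FaithfulSMul.algebraMap_injective K L)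
  have hzi := hz.toInteger_isPrimitiveRoot
  obtain ⟨u, hu⟩ : IsUnit hz.toInteger := hzi.isUnit (by positivity)
  obtain ⟨v, hv⟩ : IsUnit (∑ i ∈ Finset.range 3, hz.toInteger ^ i) := hzi.geom_sum_isUnit
    (by calc 2 = 2 ^ 1 := rfl
          _ ≤ _ := Nat.pow_le_pow_right (by norm_num) (by omega)) (by
      apply Nat.Coprime.pow_right; norm_num)
  have hu' : ((u : 𝓞 K) : K) = z := by rw [hu]; rfl
  have hv' : ((v : 𝓞 K) : K) = 1 + z + z ^ 2 := by
    rw [hv, Finset.sum_range_succ, Finset.sum_range_succ, Finset.sum_range_succ]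
    simp
    rfl
  have key : ∀ w : (𝓞 K)ˣ, w ∈ uH K L → ∃ x y : K, x ^ 2 - ((p * q : ℕ) : K) * y ^ 2 = ((w : 𝓞 K) : K) := by
    intro w hw
    obtain ⟨t, ht⟩ := (mem_uH w).1 hw
    obtain ⟨x, y, hxy⟩ := D.norm_shape σ hσ hσδ t
    exact ⟨x, y, by rw [← ht, hxy]⟩
  obtain ⟨m, rfl⟩ : ∃ m, n = m + 1 := ⟨n - 1, by have := D.hn; omega⟩
  haveI : IsCyclotomicExtension {2 ^ (m + 3)} ℚ K := D.cyc
  have hnn := nonnorm_cyc D.hp D.hq D.hp8 D.hq8 m K z hz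
  haveI : (uH K L).FiniteIndex := ⟨hi⟩
  haveI : Finite ((𝓞 K)ˣ ⧸ uH K L) := Subgroup.finite_quotient_of_finiteIndex
  rw [Subgroup.index]
  apply four_le_card (a := (u : (𝓞 K)ˣ ⧸ uH K L)) (b := (v : (𝓞 K)ˣ ⧸ uH K L))
  · intro x
    obtain ⟨x, rfl⟩ := QuotientGroup.mk_surjective x
    rw [← QuotientGroup.mk_pow, QuotientGroup.eq_one_iff, mem_uH]
    refine ⟨algebraMap K L ((x : 𝓞 K) : K), ?_⟩
    rw [Algebra.norm_algebraMap, D.finrankK]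
    simp
  · rw [Ne, QuotientGroup.eq_one_iff]
    intro h
    obtain ⟨x, y, hxy⟩ := key _ h
    exact (hnn x y).1 (by rw [hxy, hu'])
  · rw [Ne, QuotientGroup.eq_one_iff]
    intro h
    obtain ⟨x, y, hxy⟩ := key _ h
    exact (hnn x y).2.1 (by rw [hxy, hv'])
  · rw [← QuotientGroup.mk_mul, Ne, QuotientGroup.eq_one_iff]
    intro h
    obtain ⟨x, y, hxy⟩ := key _ h
    refine (hnn x y).2.2 ?_
    rw [hxy, ← hv', ← hu']
    simp

/-- the 2-torsion of the class group of `L` has order at most two -/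
lemma card_le (D : LD p q n L ζ δ) : Nat.card {c : ClassGroup (𝓞 L) // c ^ 2 = 1} ≤ 2 := by
  haveI := D.gal
  haveI := D.cyc
  set K := IntermediateField.adjoin ℚ {ζ} with hK
  obtain ⟨σ, hσ, hσζ, hσδ⟩ := D.exists_sigma
  have hodd := odd_class_cyclotomic n K
  have hne2 : 2 < 2 ^ (n + 2) := by
      calc 2 < 2 ^ 2 := by norm_num
        _ ≤ _ := Nat.pow_le_pow_right (by norm_num) (by omega)
  haveI : IsTotallyComplex K := IsCyclotomicExtension.Rat.isTotallyComplex K hne2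
  haveI : IsTotallyComplex L := isTotallyComplex_of_algebra K L
  let S : Set (Ideal (𝓞 L)) := {P | P.IsPrime ∧ P ≠ ⊥ ∧ ∀ x : 𝓞 L, σ • x - x ∈ P}
  have hS : S ⊆ Ideal.primesOver (Ideal.span {(p : ℤ)}) (𝓞 L) ∪ Ideal.primesOver (Ideal.span {(q : ℤ)}) (𝓞 L) := by
    rintro P ⟨hP, hP0, hPx⟩
    obtain ⟨t, ht⟩ : ∃ t : 𝓞 L, (t : L) = (1 + δ) / 2 := ⟨⟨(1 + δ) / 2, D.theta_int⟩, rfl⟩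
    have h1 := hPx t
    have h3 : (σ • t - t) ^ 2 = -((p : 𝓞 L) * (q : 𝓞 L)) := by
      apply RingOfIntegers.ext
      have h4 : ((σ • t - t : 𝓞 L) : L) = -δ := by
        change σ (t : L) - (t : L) = -δ
        rw [ht, map_div₀, map_add, map_one, map_ofNat, hσδ]; ring
      have h5 : (((σ • t - t) ^ 2 : 𝓞 L) : L) = (-δ) ^ 2 := by rw [← h4]; rfl
      rw [h5, neg_sq, D.hδ]
      simp
    have h4 := P.pow_mem_of_mem h1 2 (by norm_num)
    rw [h3, neg_mem_iff] at h4
    rcases hP.mem_or_mem h4 with h | h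
    · exact Or.inl ⟨hP, int_mem_prime_liesOver D.hp P hP hP0 h⟩
    · exact Or.inr ⟨hP, int_mem_prime_liesOver D.hq P hP hP0 h⟩
  haveI hpm : (Ideal.span {(p : ℤ)}).IsMaximal := by
    haveI : Fact p.Prime := ⟨D.hp⟩
    exact Int.ideal_span_isMaximal_of_prime p
  haveI hqm : (Ideal.span {(q : ℤ)}).IsMaximal := by
    haveI : Fact q.Prime := ⟨D.hq⟩
    exact Int.ideal_span_isMaximal_of_prime q
  have f1 : (Ideal.primesOver (Ideal.span {(p : ℤ)}) (𝓞 L)).Finite := Algebra.QuasiFinite.finite_primesOver _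
  have f2 : (Ideal.primesOver (Ideal.span {(q : ℤ)}) (𝓞 L)).Finite := Algebra.QuasiFinite.finite_primesOver _
  have hfin : S.Finite := (f1.union f2).subset hS
  obtain ⟨hb, hi⟩ := genus_bound' D.finrankK σ hσ hodd hfin.toFinset (by intro P; rw [Set.Finite.mem_toFinset]; rfl)
  have hcard : hfin.toFinset.card ≤ 4 := by
    rw [← Set.ncard_eq_toFinset_card _ hfin]
    have a1 := D.ncard_le p q D.hp (Or.inr D.hp8) D.ndvd D.hq.ne_zero rfl
    have a2 := D.ncard_le q p D.hq (Or.inl D.hq8) D.ndvd' D.hp.ne_zero (mul_comm _ _)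
    calc S.ncard ≤ _ := Set.ncard_le_ncard hS (f1.union f2)
      _ ≤ _ := Set.ncard_union_le _ _
      _ ≤ 2 + 2 := by omega
  have h5 : 2 ^ hfin.toFinset.card ≤ 2 ^ 4 := Nat.pow_le_pow_right (by norm_num) hcard
  have h6 := D.index_ge hi
  have h7 : Nat.card {c : ClassGroup (𝓞 L) // c ^ 2 = 1} * (2 * 4) ≤ 2 * (2 * 4) :=
    (Nat.mul_le_mul_left _ (Nat.mul_le_mul_left _ h6)).trans (hb.trans h5)
  omega

end LD

end

section
open NumberField Pointwise

namespace LD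
variable {p q n : ℕ} {L : Type} [Field L] [NumberField L] {ζ δ : L}

/-- the automorphism fixing `δ` and inverting `ζ` -/
lemma exists_s (D : LD p q n L ζ δ) : ∃ (σ : L ≃ₐ[IntermediateField.adjoin ℚ {ζ}] L) (τ : L ≃ₐ[ℚ] L), σ ≠ 1 ∧ σ ζ = ζ ∧ σ δ = -δ ∧
    τ ζ = ζ⁻¹ ∧ τ δ = -δ ∧ (∀ (φ : L →+* ℂ) (x : L), φ (τ x) = (starRingEnd ℂ) (φ x)) ∧
    (∀ x, σ (τ x) = τ (σ x)) ∧ (∀ x, σ (σ x) = x) ∧ (∀ x, τ (τ x) = x) := by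
  haveI := D.gal
  obtain ⟨σ, hσ, h1, h2⟩ := D.exists_sigma
  obtain ⟨τ, h3, h4, h5⟩ := D.exists_tau
  have hc : ((σ.restrictScalars ℚ : L ≃ₐ[ℚ] L) : L →ₐ[ℚ] L).comp (τ : L →ₐ[ℚ] L) =
      (τ : L →ₐ[ℚ] L).comp ((σ.restrictScalars ℚ : L ≃ₐ[ℚ] L) : L →ₐ[ℚ] L) := by
    apply D.ext_hom (A := ℚ)
    · change σ (τ ζ) = τ (σ ζ)
      rw [h3, map_inv₀, h1, h3]
    · change σ (τ δ) = τ (σ δ)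
      rw [h4, map_neg, h2, map_neg, h4]
  have ht : (τ : L →ₐ[ℚ] L).comp (τ : L →ₐ[ℚ] L) = AlgHom.id ℚ L := by
    apply D.ext_hom (A := ℚ)
    · change τ (τ ζ) = ζ
      rw [h3, map_inv₀, h3, inv_inv]
    · change τ (τ δ) = δ
      rw [h4, map_neg, h4, neg_neg]
  exact ⟨σ, τ, hσ, h1, h2, h3, h4, h5, fun x => congrArg (fun f : L →ₐ[ℚ] L => f x) hc,
    fun z => congrArg (fun f => f z) (quad_sq D.finrankK σ), fun x => congrArg (fun f : L →ₐ[ℚ] L => f x) ht⟩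

lemma i_sq (D : LD p q n L ζ δ) : (ζ ^ (2 ^ n)) ^ 2 = -1 := by
  have := prim_two_pow_neg (n + 1) D.hζ
  rw [← this]; ring

lemma fixed_root (D : LD p q n L ζ δ) (s : L →+* L) (hs : s ζ = ζ⁻¹) (a : ℕ) : ∀ v : L, s v = v → v ^ 2 ^ a = 1 → v = 1 ∨ v = -1 := by
  have hi := D.i_sq
  have hsi : s (ζ ^ (2 ^ n)) = - ζ ^ (2 ^ n) := by
    rw [map_pow, hs, inv_pow]
    apply inv_eq_of_mul_eq_one_right
    linear_combination -hi
  induction a with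
  | zero => intro v _ h; left; simpa using h
  | succ a ih =>
    intro v hv h
    rcases ih (v ^ 2) (by rw [map_pow, hv]) (by rw [← h]; ring) with h1 | h1
    · exact sq_eq_sq_iff_eq_or_eq_neg.1 (h1.trans (one_pow 2).symm)
    · exfalso
      rw [← hi] at h1
      have hi0 : ζ ^ (2 ^ n) ≠ 0 := pow_ne_zero _ (D.hζ.ne_zero (by positivity))
      have h2 : (2 : L) * ζ ^ (2 ^ n) = 0 := by
        rcases sq_eq_sq_iff_eq_or_eq_neg.1 h1 with h | h
        · rw [h, hsi] at hv
          linear_combination -hv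
        · rw [h, map_neg, hsi] at hv
          linear_combination hv
      rcases mul_eq_zero.1 h2 with h | h
      · norm_num at h
      · exact hi0 h

lemma desc (D : LD p q n L ζ δ) (w : IntermediateField.adjoin ℚ {ζ}) (x : 𝓞 L) (hw : algebraMap _ L w = (x : L)) (N : ℕ)
    (h : Ideal.span {x} ^ 2 = Ideal.span {(N : 𝓞 L)}) :
    ∃ y : 𝓞 (IntermediateField.adjoin ℚ {ζ}), Ideal.span {y} ^ 2 = Ideal.span {(N : 𝓞 (IntermediateField.adjoin ℚ {ζ}))} := by
  haveI := D.gal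
  have hwi : IsIntegral ℤ w := by
    have := x.2
    have h1 : IsIntegral ℤ (algebraMap _ L w) := by rw [hw]; exact RingOfIntegers.isIntegral_coe x
    exact (isIntegral_algebraMap_iff (FaithfulSMul.algebraMap_injective _ _)).1 h1
  obtain ⟨y, hy⟩ : ∃ y : 𝓞 (IntermediateField.adjoin ℚ {ζ}), (y : IntermediateField.adjoin ℚ {ζ}) = w := ⟨⟨w, hwi⟩, rfl⟩
  refine ⟨y, ?_⟩
  apply Ideal.map_injective_of_faithfullyFlat (A := 𝓞 (IntermediateField.adjoin ℚ {ζ})) (B := 𝓞 L)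
  have e : algebraMap (𝓞 (IntermediateField.adjoin ℚ {ζ})) (𝓞 L) y = x := by
    apply RingOfIntegers.ext
    rw [← hw, ← hy]; rfl
  rw [Ideal.map_pow, Ideal.map_span, Ideal.map_span, Set.image_singleton, Set.image_singleton, e, h, map_natCast]

lemma key (D : LD p q n L ζ δ) (σ : L ≃ₐ[IntermediateField.adjoin ℚ {ζ}] L) (τ : L ≃ₐ[ℚ] L) (hσ : σ ≠ 1) (h1 : σ ζ = ζ) (h2 : σ δ = -δ)
    (h3 : τ ζ = ζ⁻¹) (h4 : τ δ = -δ) (h5 : ∀ (φ : L →+* ℂ) (x : L), φ (τ x) = (starRingEnd ℂ) (φ x))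
    (h6 : ∀ x, σ (τ x) = τ (σ x)) (h7 : ∀ x, σ (σ x) = x) (g : 𝓞 L) (hg : σ (τ (g : L)) = g)
    (hgp : Ideal.span {g} ^ 2 = Ideal.span {(p : 𝓞 L)}) : False := by
  haveI := D.gal
  haveI := D.cyc
  have hp0 : (p : 𝓞 L) ≠ 0 := by exact_mod_cast D.hp.ne_zero
  have hg0 : g ≠ 0 := by
    rintro rfl
    have h : Ideal.span {(p : 𝓞 L)} = ⊥ := by rw [← hgp]; simp
    rw [Ideal.span_singleton_eq_bot] at h
    exact hp0 h
  have hgL : (g : L) ≠ 0 := by simpa using hg0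
  have hτg : τ (g : L) = σ g := by rw [← hg, h7, hg]
  have htg0 : τ • g ≠ 0 := by
    rw [Ne, smul_eq_zero_iff_eq]; exact hg0
  have e1 : Ideal.span {g} = Ideal.span {τ • g} := by
    apply ideal_sq_inj (by simpa using hg0) (by rw [Ne, Ideal.span_singleton_eq_bot]; exact htg0)
    rw [← smul_span_sing, ← smul_pow', hgp, smul_span_sing]
    congr 2
    apply RingOfIntegers.ext
    change _ = τ ((p : 𝓞 L) : L)
    simp
  obtain ⟨u, hu⟩ := Ideal.span_singleton_eq_span_singleton.1 e1.symm
  have hu' : τ (g : L) * ((u : 𝓞 L) : L) = g := congrArg (fun t : 𝓞 L => (t : L)) hu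
  have hτ0 : τ (g : L) ≠ 0 := by simpa using hg0
  have hun : ∀ φ : L →+* ℂ, ‖φ ((u : 𝓞 L) : L)‖ = 1 := by
    intro φ
    have h := congrArg (fun t => ‖φ t‖) hu'
    beta_reduce at h
    rw [map_mul, norm_mul, h5, RCLike.norm_conj] at h
    have h0 : ‖φ (g : L)‖ ≠ 0 := by simpa using hg0
    exact mul_left_cancel₀ h0 (h.trans (mul_one _).symm)
  obtain ⟨N, hN, huN⟩ := NumberField.Embeddings.pow_eq_one_of_norm_eq_one L ℂ (RingOfIntegers.isIntegral_coe (u : 𝓞 L)) hun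
  obtain ⟨a, k, hk, rfl⟩ := Nat.exists_eq_two_pow_mul_odd hN.ne'
  let s : L →+* L := (σ : L →+* L).comp (τ : L →+* L)
  have hsu : s ((u : 𝓞 L) : L) = (u : 𝓞 L) := by
    change σ (τ ((u : 𝓞 L) : L)) = (u : 𝓞 L)
    have h := congrArg s hu'
    rw [map_mul] at h
    change σ (τ (τ (g : L))) * σ (τ ((u : 𝓞 L) : L)) = σ (τ (g : L)) at h
    rw [h6 (τ (g : L)), hg] at h
    exact mul_left_cancel₀ hτ0 (h.trans hu'.symm)
  have hv := D.fixed_root s (by change σ (τ ζ) = ζ⁻¹; rw [h3, map_inv₀, h1]) a (((u : 𝓞 L) : L) ^ k)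
    (by rw [map_pow, hsu]) (by rw [← huN]; ring)
  have hgk : σ ((g : L) ^ k) * (((u : 𝓞 L) : L) ^ k) = (g : L) ^ k := by
    rw [map_pow, ← mul_pow, ← hτg, hu']
  have hspan : Ideal.span {g ^ k} ^ 2 = Ideal.span {((p ^ k : ℕ) : 𝓞 L)} := by
    rw [← Ideal.span_singleton_pow, ← pow_mul, mul_comm, pow_mul, hgp, Ideal.span_singleton_pow, Nat.cast_pow]
  have hp2 : p ≠ 2 := by have := D.hp8; rintro rfl; omega
  have hq2 : q ≠ 2 := by have := D.hq8; rintro rfl; omega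
  rcases hv with hv | hv
  · rw [hv, mul_one] at hgk
    obtain ⟨w, hw⟩ := quad_fixed D.finrankK σ hσ _ hgk
    obtain ⟨y, hy⟩ := D.desc w (g ^ k) (by rw [hw]; simp) (p ^ k * 1) (by rw [mul_one]; exact hspan)
    exact unram_sq (k := n + 2) _ p D.hp hp2 k 1 hk D.hp.not_dvd_one one_ne_zero y hy
  · have hgk2 : σ (δ * (g : L) ^ k) = δ * (g : L) ^ k := by
      rw [map_mul, h2]
      rw [hv] at hgk
      linear_combination δ * hgk
    obtain ⟨w, hw⟩ := quad_fixed D.finrankK σ hσ _ hgk2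
    obtain ⟨d, hd⟩ : ∃ d : 𝓞 L, (d : L) = δ := ⟨⟨δ, D.δ_int⟩, rfl⟩
    have hd2 : d ^ 2 = -((p * q : ℕ) : 𝓞 L) := by
      apply RingOfIntegers.ext
      have := D.hδ
      simpa [hd] using this
    obtain ⟨y, hy⟩ := D.desc w (d * g ^ k) (by rw [hw]; simp [hd]) (q ^ 1 * p ^ (k + 1)) (by
      rw [← Ideal.span_singleton_mul_span_singleton, mul_pow, hspan, Ideal.span_singleton_pow, hd2, Ideal.span_singleton_neg,
        Ideal.span_singleton_mul_span_singleton]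
      congr 2
      push_cast
      ring)
    exact unram_sq (k := n + 2) _ q D.hq hq2 1 (p ^ (k + 1)) odd_one (fun h => D.ndvd' (D.hq.dvd_of_dvd_pow h))
      (pow_ne_zero _ D.hp.ne_zero) y hy

end LD

end

section
open NumberField Pointwise

lemma pq_not_sq {p q : ℕ} (hp : p.Prime) (hq : q.Prime) (hne : p ≠ q) : ¬ IsSquare ((p * q : ℕ) : ℚ) := by
  rw [Rat.isSquare_natCast_iff]
  rintro ⟨r, hr⟩
  have h1 : p ∣ r * r := ⟨q, hr.symm⟩
  have h2 : p ∣ r := by rcases hp.dvd_mul.1 h1 with h | h <;> exact h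
  obtain ⟨s, rfl⟩ := h2
  have h3 : q = p * (s * s) := Nat.eq_of_mul_eq_mul_left hp.pos (by rw [hr]; ring)
  exact hne ((Nat.prime_dvd_prime_iff_eq hp hq).1 ⟨_, h3⟩)

lemma rat_unit (η : (𝓞 ℚ)ˣ) : ((η : 𝓞 ℚ) : ℚ) = 1 ∨ ((η : 𝓞 ℚ) : ℚ) = -1 := by
  rcases Int.units_eq_one_or (Units.map (Rat.ringOfIntegersEquiv : 𝓞 ℚ →* ℤ) η) with h | h
  · left
    have h1 : Rat.ringOfIntegersEquiv (η : 𝓞 ℚ) = 1 := congrArg Units.val h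
    have h2 : (η : 𝓞 ℚ) = 1 := Rat.ringOfIntegersEquiv.injective (by rw [h1, map_one])
    rw [h2]; rfl
  · right
    have h1 : Rat.ringOfIntegersEquiv (η : 𝓞 ℚ) = -1 := congrArg Units.val h
    have h2 : (η : 𝓞 ℚ) = -1 := Rat.ringOfIntegersEquiv.injective (by rw [h1, map_neg, map_one])
    rw [h2]; rfl

lemma exists_theta {p q : ℕ} (hp8 : p % 8 = 5) (hq8 : q % 8 = 3) (F : Type*) [Field F] [NumberField F] (e : F)
    (he : e ^ 2 = -((p * q : ℕ) : F)) : ∃ (t : 𝓞 F) (m : ℕ), (t : F) = (1 + e) / 2 ∧ t * (1 - t) = 2 * (m : 𝓞 F) := by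
  obtain ⟨c, hc⟩ : ∃ c : ℕ, 8 * c = p * q + 1 := by
    refine ⟨(p * q + 1) / 8, ?_⟩
    have h1 : (p * q) % 8 = 7 := by
      rw [Nat.mul_mod, hp8, hq8]
    omega
  have hc' : (8 : F) * (c : F) = p * q + 1 := by exact_mod_cast congrArg (fun t : ℕ => (t : F)) hc
  push_cast at he
  have h_intg : IsIntegral ℤ ((1 + e) / 2) := by
    refine ⟨Polynomial.X ^ 2 + (-Polynomial.X + Polynomial.C ((2 * c : ℕ) : ℤ)), ?_, ?_⟩
    · apply Polynomial.monic_X_pow_add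
      compute_degree!
    · simp only [Polynomial.eval₂_add, Polynomial.eval₂_pow, Polynomial.eval₂_neg, Polynomial.eval₂_X, Polynomial.eval₂_C]
      simp only [algebraMap_int_eq, Int.coe_castRingHom]
      push_cast
      field_simp
      linear_combination he + hc'
  obtain ⟨t, ht⟩ : ∃ t : 𝓞 F, (t : F) = (1 + e) / 2 := ⟨⟨_, h_intg⟩, rfl⟩
  refine ⟨t, c, ht, ?_⟩
  apply RingOfIntegers.ext
  have h1 : ((t * (1 - t) : 𝓞 F) : F) = (t : F) * (1 - (t : F)) := by simp
  have h2 : ((2 * (c : 𝓞 F) : 𝓞 F) : F) = 2 * (c : F) := by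
    change algebraMap (𝓞 F) F (2 * (c : 𝓞 F)) = _
    rw [map_mul, map_natCast, map_ofNat]
  rw [h1, h2, ht]
  field_simp
  linear_combination -he - hc'

/-- the imaginary quadratic field -/
structure FD (p q : ℕ) (F : Type) [Field F] [NumberField F] (e : F) : Prop where
  hp : p.Prime
  hq : q.Prime
  hp8 : p % 8 = 5
  hq8 : q % 8 = 3
  he : e ^ 2 = -((p * q : ℕ) : F)
  top : IntermediateField.adjoin ℚ {e} = ⊤

namespace FD
variable {p q : ℕ} {F : Type} [Field F] [NumberField F] {e : F}

lemma hne (D : FD p q F e) : p ≠ q := by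
  have := D.hp8; have := D.hq8
  omega

lemma pos (D : FD p q F e) : (0 : ℚ) < ((p * q : ℕ) : ℚ) := by
  exact_mod_cast Nat.mul_pos D.hp.pos D.hq.pos

lemma he' (D : FD p q F e) : e ^ 2 = ((-((p * q : ℕ) : ℚ) : ℚ) : F) := by rw [D.he]; push_cast; rfl

lemma nsq (D : FD p q F e) : ¬ IsSquare (-((p * q : ℕ) : ℚ)) := not_sq_neg (by have := D.pos; linarith)

lemma e0 (D : FD p q F e) : e ≠ 0 := by
  rintro rfl
  have h := D.he
  have : ((p * q : ℕ) : F) = 0 := by linear_combination h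
  exact (Nat.mul_ne_zero D.hp.ne_zero D.hq.ne_zero) (by exact_mod_cast this)

lemma fin2 (D : FD p q F e) : Module.finrank ℚ F = 2 := by
  have h := finrank_quad e _ D.he' D.nsq
  rw [D.top] at h
  rw [← h]
  exact IntermediateField.finrank_top'.symm

lemma gal (D : FD p q F e) : IsGalois ℚ F := (quad_field_data F D.fin2 e _ D.he' D.nsq).1

lemma exists_sigma (D : FD p q F e) : ∃ σ : F ≃ₐ[ℚ] F, σ ≠ 1 ∧ σ e = -e := (quad_field_data F D.fin2 e _ D.he' D.nsq).2

lemma tc (D : FD p q F e) : IsTotallyComplex F := by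
  constructor
  intro v
  by_contra hv
  rw [InfinitePlace.not_isComplex_iff_isReal] at hv
  let φ := InfinitePlace.embedding_of_isReal hv
  have h := congrArg φ D.he
  rw [map_pow, map_neg, map_natCast] at h
  have h1 := sq_nonneg (φ e)
  have h2 : (0 : ℝ) < ((p * q : ℕ) : ℝ) := by exact_mod_cast Nat.mul_pos D.hp.pos D.hq.pos
  linarith

lemma finU (D : FD p q F e) : Finite (𝓞 F)ˣ := by
  haveI := D.tc
  have hr : NumberField.Units.rank F = 0 := by
    rw [NumberField.Units.rank, InfinitePlace.card_eq_nrRealPlaces_add_nrComplexPlaces,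
        nrRealPlaces_eq_zero_iff.2 ‹_›]
    have e2 := IsTotallyComplex.finrank F
    rw [D.fin2] at e2
    omega
  haveI : IsEmpty (Fin (NumberField.Units.rank F)) := by rw [hr]; infer_instance
  apply Finite.of_surjective (fun ze : NumberField.Units.torsion F × (Fin (NumberField.Units.rank F) → ℤ) =>
    (ze.1 : (𝓞 F)ˣ) * ∏ i, NumberField.Units.fundSystem F i ^ ze.2 i)
  intro x
  obtain ⟨ze, h, _⟩ := NumberField.Units.exist_unique_eq_mul_prod F x
  exact ⟨ze, h.symm⟩

lemma uH_bot (D : FD p q F e) : uH ℚ F = ⊥ := by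
  haveI := D.gal
  rw [eq_bot_iff]
  intro η hη
  obtain ⟨z, hz⟩ := (mem_uH η).1 hη
  obtain ⟨a, b, hab⟩ := quad_field_norm F D.fin2 e _ D.he' D.nsq z
  rw [Subgroup.mem_bot]
  apply Units.ext
  apply RingOfIntegers.ext
  rcases rat_unit η with h | h
  · rw [h]; rfl
  · exfalso
    rw [hz, h] at hab
    have := D.pos
    nlinarith [sq_nonneg a, mul_nonneg this.le (sq_nonneg b)]

lemma relidx (D : FD p q F e) (σ : F ≃ₐ[ℚ] F) (hσ : σ ≠ 1) (hσe : σ e = -e) (G : IsGalois ℚ F) :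
    2 ≤ (MonoidHom.id _ / uSig σ).range.relIndex (uNorm ℚ F).ker := by
  haveI := D.finU
  have hH := D.uH_bot
  have hN : ∀ u, uNorm ℚ F u = 1 := by
    intro u
    have : uNorm ℚ F u ∈ uH ℚ F := uNorm_range_le ⟨u, rfl⟩
    rwa [hH, Subgroup.mem_bot] at this
  have h0 : (MonoidHom.id _ / uSig σ).range.relIndex (uNorm ℚ F).ker ≠ 0 := Subgroup.index_ne_zero_of_finite
  have h1 : (MonoidHom.id _ / uSig σ).range.relIndex (uNorm ℚ F).ker ≠ 1 := by
    intro h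
    rw [Subgroup.relIndex_eq_one] at h
    obtain ⟨u, hu⟩ := h (show (-1 : (𝓞 F)ˣ) ∈ _ from hN _)
    rw [MonoidHom.div_apply, MonoidHom.id_apply, div_eq_iff_eq_mul] at hu
    have hu' : ((u : 𝓞 F) : F) = - σ ((u : 𝓞 F) : F) := by
      have h8 : (((-1 * uSig σ u : (𝓞 F)ˣ) : 𝓞 F) : F) = -σ ((u : 𝓞 F) : F) := by
        rw [neg_one_mul, Units.val_neg]; rfl
      exact (congrArg (fun t : (𝓞 F)ˣ => ((t : 𝓞 F) : F)) hu).trans h8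
    have h2 := uNorm_incl D.fin2 σ hσ u
    rw [hN u] at h2
    have h3 : (1 : F) = ((u : 𝓞 F) : F) * σ ((u : 𝓞 F) : F) := by
      have := congrArg (fun t : 𝓞 F => (t : F)) h2
      beta_reduce at this
      rw [Units.val_one, map_one] at this
      exact this
    obtain ⟨b, hb⟩ := quad_fixed D.fin2 σ hσ (((u : 𝓞 F) : F) / e) (by
      rw [map_div₀, hσe]
      nth_rewrite 2 [hu']
      rw [div_neg, neg_div])
    have hb' : (b : F) * e = ((u : 𝓞 F) : F) := by
      rw [← div_mul_cancel₀ ((u : 𝓞 F) : F) D.e0, ← hb]; rfl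
    apply pq_not_sq D.hp D.hq D.hne
    have h4 : ((p * q : ℕ) : F) * (b : F) ^ 2 = 1 := by
      have hs : σ ((u : 𝓞 F) : F) = - ((u : 𝓞 F) : F) := (neg_eq_iff_eq_neg.2 hu').symm
      rw [hs, ← hb'] at h3
      linear_combination -h3 + (b : F) ^ 2 * D.he
    have h5 : ((p * q : ℕ) : ℚ) * b ^ 2 = 1 := by exact_mod_cast h4
    have hb0 : b ≠ 0 := by rintro rfl; simp at h5
    refine ⟨b⁻¹, ?_⟩
    field_simp
    exact h5
  omega

lemma e_int (D : FD p q F e) : IsIntegral ℤ e := by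
  refine ⟨Polynomial.X ^ 2 + Polynomial.C ((p * q : ℕ) : ℤ), Polynomial.monic_X_pow_add_C _ two_ne_zero, ?_⟩
  simp [D.he]

lemma exists_d (D : FD p q F e) : ∃ d : 𝓞 F, (d : F) = e ∧ d ^ 2 = -((p * q : ℕ) : 𝓞 F) := by
  obtain ⟨d, hd⟩ : ∃ d : 𝓞 F, (d : F) = e := ⟨⟨e, D.e_int⟩, rfl⟩
  refine ⟨d, hd, ?_⟩
  apply RingOfIntegers.ext
  have := D.he
  simpa [hd] using this

lemma absNorm_cast (D : FD p q F e) (l : ℕ) : Ideal.absNorm (Ideal.span {(l : 𝓞 F)}) = l ^ 2 := by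
  have h : Algebra.norm ℤ (l : 𝓞 F) = (l : ℤ) ^ 2 := by
    have h1 : ((Algebra.norm ℤ (l : 𝓞 F) : ℤ) : ℚ) = ((l : ℤ) ^ 2 : ℤ) := by
      rw [Algebra.coe_norm_int]
      have h2 : ((l : 𝓞 F) : F) = algebraMap ℚ F (l : ℚ) := by simp
      rw [h2, Algebra.norm_algebraMap, D.fin2]; push_cast; rfl
    exact_mod_cast h1
  rw [Ideal.absNorm_span_singleton, h, Int.natAbs_pow, Int.natAbs_natCast]

lemma prime_eq (D : FD p q F e) (l m : ℕ) (hl : l.Prime) (hlm : Nat.Coprime l m) (hpq : l * m = p * q) (d : 𝓞 F) (hd : d ^ 2 = -((p * q : ℕ) : 𝓞 F))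
    (P : Ideal (𝓞 F)) (hP : P.IsPrime) (hlP : (l : 𝓞 F) ∈ P) : P = Ideal.span {(l : 𝓞 F), d} := by
  have hsq := span_p_sq l m hlm d (by rw [hd, hpq])
  have hN : Ideal.absNorm (Ideal.span {(l : 𝓞 F), d}) = l := by
    have h := congrArg Ideal.absNorm hsq
    rw [map_pow, D.absNorm_cast] at h
    exact Nat.pow_left_injective (n := 2) (by norm_num) h
  have hpr : (Ideal.span {(l : 𝓞 F), d}).IsPrime := Ideal.isPrime_of_irreducible_absNorm (by rw [hN]; exact hl)
  have hne : Ideal.span {(l : 𝓞 F), d} ≠ ⊥ := by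
    intro h
    rw [h] at hN
    simp at hN
    exact hl.ne_zero hN.symm
  have hmax := hpr.isMaximal hne
  refine (hmax.eq_of_le hP.ne_top ?_).symm
  rw [Ideal.span_le]
  intro x hx
  rcases hx with rfl | hx
  · exact hlP
  · rw [Set.mem_singleton_iff] at hx
    rw [hx]
    apply hP.mem_of_pow_mem 2
    rw [hd, neg_mem_iff, ← hpq, Nat.cast_mul]
    exact P.mul_mem_right _ hlP

lemma card_le (D : FD p q F e) : Nat.card {c : ClassGroup (𝓞 F) // c ^ 2 = 1} ≤ 2 := by
  haveI := D.gal
  obtain ⟨σ, hσ, hσe⟩ := D.exists_sigma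
  obtain ⟨d, hd, hd2⟩ := D.exists_d
  obtain ⟨t, m, ht, htm⟩ := exists_theta D.hp8 D.hq8 F e D.he
  have hodd : Odd (Nat.card (ClassGroup (𝓞 ℚ))) := by
    have h1 := Rat.classNumber_eq
    rw [NumberField.classNumber, ← Nat.card_eq_fintype_card] at h1
    rw [h1]
    exact odd_one
  have hcop : Nat.Coprime p q := (Nat.coprime_primes D.hp D.hq).2 D.hne
  let S : Set (Ideal (𝓞 F)) := {P | P.IsPrime ∧ P ≠ ⊥ ∧ ∀ x : 𝓞 F, σ • x - x ∈ P}
  have hS : S ⊆ {Ideal.span {(p : 𝓞 F), d}, Ideal.span {(q : 𝓞 F), d}} := by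
    rintro P ⟨hP, hP0, hPx⟩
    have h1 := hPx t
    have h3 : (σ • t - t) ^ 2 = -((p : 𝓞 F) * (q : 𝓞 F)) := by
      have h4 : σ • t - t = -d := by
        apply RingOfIntegers.ext
        have h5 : ((σ • t - t : 𝓞 F) : F) = -e := by
          change σ (t : F) - (t : F) = _
          rw [ht, map_div₀, map_add, map_one, map_ofNat, hσe]; ring
        rw [h5, ← hd]; simp
      rw [h4, neg_sq, hd2, Nat.cast_mul]
    have h4 := P.pow_mem_of_mem h1 2 (by norm_num)
    rw [h3, neg_mem_iff] at h4
    rcases hP.mem_or_mem h4 with h | h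
    · exact Or.inl (D.prime_eq p q D.hp hcop rfl d hd2 P hP h)
    · exact Or.inr (D.prime_eq q p D.hq hcop.symm (mul_comm _ _) d hd2 P hP h)
  have hfin : S.Finite := (Set.toFinite _).subset hS
  have hb := genus_bound D.fin2 σ hσ hodd hfin.toFinset (by intro P; rw [Set.Finite.mem_toFinset]; rfl)
    (by rw [D.uH_bot, Subgroup.relIndex_bot_right]; norm_num)
  rw [D.uH_bot, Subgroup.relIndex_bot_right, one_mul] at hb
  have hcard : hfin.toFinset.card ≤ 2 := by
    rw [← Set.ncard_eq_toFinset_card _ hfin]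
    exact (Set.ncard_le_ncard hS (Set.toFinite _)).trans ((Set.ncard_insert_le _ _).trans (by rw [Set.ncard_singleton]))
  have h5 : 2 ^ hfin.toFinset.card ≤ 2 ^ 2 := Nat.pow_le_pow_right (by norm_num) hcard
  have h6 := D.relidx σ hσ hσe inferInstance
  have h7 : Nat.card {c : ClassGroup (𝓞 F) // c ^ 2 = 1} * 2 ≤ 2 * 2 :=
    (Nat.mul_le_mul_left _ h6).trans (hb.trans h5)
  omega

end FD

end

section
open NumberField Pointwise

lemma two_torsion_unique {C : Type*} [CommGroup C] [Finite C] (h2 : Nat.card {c : C // c ^ 2 = 1} ≤ 2) (x y : C)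
    (hx : x ≠ 1) (hy : y ≠ 1) (hx2 : x ^ 2 = 1) (hy2 : y ^ 2 = 1) : x = y := by
  classical
  by_contra hxy
  haveI := Fintype.ofFinite C
  have h : ({⟨1, one_pow 2⟩, ⟨x, hx2⟩, ⟨y, hy2⟩} : Finset {c : C // c ^ 2 = 1}).card = 3 := by
    rw [Finset.card_insert_of_notMem, Finset.card_insert_of_notMem, Finset.card_singleton]
    · simpa using hxy
    · simp [hx.symm, hy.symm]
  have h' := Finset.card_le_univ ({⟨1, one_pow 2⟩, ⟨x, hx2⟩, ⟨y, hy2⟩} : Finset {c : C // c ^ 2 = 1})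
  rw [h, ← Nat.card_eq_fintype_card] at h'
  omega

lemma orderOf_even_of_nonsquare {C : Type*} [CommGroup C] [Finite C] (x : C) (hx : ∀ y, y ^ 2 ≠ x) (N m : ℕ) (hm : Odd m)
    (ho : orderOf x = 2 ^ N * m) : N ≠ 0 := by
  rintro rfl
  rw [pow_zero, one_mul] at ho
  obtain ⟨k, rfl⟩ := hm
  apply hx (x ^ (k + 1))
  rw [← pow_mul, show (k + 1) * 2 = (2 * k + 1) + 1 by ring, pow_succ, ← ho, pow_orderOf_eq_one, one_mul]

namespace FD
variable {p q : ℕ} {F : Type} [Field F] [NumberField F] {e : F}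

lemma absNorm_b (D : FD p q F e) (t : 𝓞 F) (m : ℕ) (ht : (t : F) = (1 + e) / 2) (htm : t * (1 - t) = 2 * (m : 𝓞 F)) :
    Ideal.absNorm (Ideal.span {2, t}) = 2 := by
  obtain ⟨σ, hσ, hσe⟩ := D.exists_sigma
  have h1 : σ • Ideal.span {2, t} = Ideal.span {2, 1 - t} := by
    rw [smul_span_pair]
    have h2 : σ • (2 : 𝓞 F) = 2 := by
      apply RingOfIntegers.ext
      exact map_ofNat σ 2
    have h3 : σ • t = 1 - t := by
      apply RingOfIntegers.ext
      have h4 : ((1 - t : 𝓞 F) : F) = 1 - (t : F) := by simp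
      rw [h4]
      change σ (t : F) = _
      rw [ht, map_div₀, map_add, map_one, map_ofNat, hσe]; ring
    rw [h2, h3]
  have h2 := span_pair_mul_conj 2 t (m : 𝓞 F) htm
  rw [← h1] at h2
  have h3 := congrArg Ideal.absNorm h2
  have h4 := D.absNorm_cast 2
  push_cast at h4
  rw [map_mul, absNorm_smul, h4, ← pow_two] at h3
  exact Nat.pow_left_injective (n := 2) (by norm_num) h3

lemma main (D : FD p q F e) (d : 𝓞 F) (hd2 : d ^ 2 = -((p * q : ℕ) : 𝓞 F))
    (t : 𝓞 F) (m : ℕ) (ht : (t : F) = (1 + e) / 2) (htm : t * (1 - t) = 2 * (m : 𝓞 F))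
    (hnp : icls (Ideal.span {(p : 𝓞 F), d}) ≠ 1) :
    ∃ N k : ℕ, Odd k ∧ Nat.card (CommGroup.primaryComponent (ClassGroup (𝓞 F)) 2) = 2 ^ (N + 1) ∧
      icls (Ideal.span {2, t}) ^ (2 ^ N * k) = icls (Ideal.span {(p : 𝓞 F), d}) := by
  have hns := norm_two_nonsquare D.hp D.hq D.hp8 D.hq8 F e D.he _ (D.absNorm_b t m ht htm)
  set x := icls (Ideal.span {2, t}) with hx
  obtain ⟨N, k, hk, ho⟩ := exists_two_pow_mul_odd_orderOf x
  have hN := orderOf_even_of_nonsquare x hns N k hk ho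
  obtain ⟨N, rfl⟩ := Nat.exists_eq_succ_of_ne_zero hN
  have hc := (primaryComponent_cyclic_of_nonsquare D.card_le x hns _ k hk ho).2
  refine ⟨N, k, hk, hc, ?_⟩
  have hp0 : (p : 𝓞 F) ≠ 0 := by exact_mod_cast D.hp.ne_zero
  have hcop : Nat.Coprime p q := (Nat.coprime_primes D.hp D.hq).2 D.hne
  have hI0 : Ideal.span {(p : 𝓞 F), d} ≠ ⊥ := by
    intro h
    have : (p : 𝓞 F) ∈ (⊥ : Ideal (𝓞 F)) := by rw [← h]; exact Ideal.subset_span (by simp)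
    exact hp0 (by simpa using this)
  have hk0 := hk.pos
  apply two_torsion_unique D.card_le _ _ _ hnp
  · rw [← pow_mul, show 2 ^ N * k * 2 = 2 ^ (N + 1) * k by ring]
    change x ^ (2 ^ (Nat.succ N) * k) = 1
    rw [← ho, pow_orderOf_eq_one]
  · rw [← icls_pow hI0, span_p_sq p q hcop d hd2, icls_span hp0]
  · intro h
    have h1 := orderOf_dvd_of_pow_eq_one h
    rw [ho] at h1
    have h2 := Nat.le_of_dvd (by positivity) h1
    have h3 : 2 ^ (N + 1) * k = 2 * (2 ^ N * k) := by ring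
    have h4 : 0 < 2 ^ N * k := by positivity
    change 2 ^ (N + 1) * k ≤ _ at h2
    omega

end FD

namespace LD
variable {p q n : ℕ} {L : Type} [Field L] [NumberField L] {ζ δ : L}

lemma norm_one_sub (D : LD p q n L ζ δ) : Ideal.absNorm (Ideal.span {1 - D.hζ.toInteger}) = 4 := by
  haveI := D.gal
  haveI := D.cyc
  set K := IntermediateField.adjoin ℚ {ζ} with hK
  let z : K := ⟨ζ, IntermediateField.mem_adjoin_simple_self ℚ _⟩
  have hz : IsPrimitiveRoot z (2 ^ (n + 2)) :=
    IsPrimitiveRoot.of_map_of_injective (f := algebraMap K L) D.hζ (FaithfulSMul.algebraMap_injective K L)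
  have h1 := hz.norm_sub_one_two (K := ℚ) (by omega) (Polynomial.cyclotomic.irreducible_rat (by positivity))
  have h2 : Algebra.norm ℚ (1 - ζ) = 4 := by
    rw [← Algebra.norm_norm (S := K)]
    have h3 : (1 - ζ) = algebraMap K L (1 - z) := by simp [z]
    rw [h3, Algebra.norm_algebraMap, D.finrankK, map_pow]
    have h4 : Algebra.norm ℚ (1 - z) ^ 2 = Algebra.norm ℚ (z - 1) ^ 2 := by
      rw [← map_pow, ← map_pow]; congr 1; ring
    rw [h4, h1]; norm_num
  have h5 : Algebra.norm ℤ (1 - D.hζ.toInteger) = 4 := by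
    have h6 : ((Algebra.norm ℤ (1 - D.hζ.toInteger) : ℤ) : ℚ) = (4 : ℤ) := by
      rw [Algebra.coe_norm_int]
      have h7 : ((1 - D.hζ.toInteger : 𝓞 L) : L) = 1 - ζ := by simp; rfl
      rw [h7, h2]; norm_num
    exact_mod_cast h6
  rw [Ideal.absNorm_span_singleton, h5]; rfl

lemma absNorm_B (D : LD p q n L ζ δ) (t : 𝓞 L) (m : ℕ) (ht : (t : L) = (1 + δ) / 2) (htm : t * (1 - t) = 2 * (m : 𝓞 L)) :
    Ideal.absNorm (Ideal.span {1 - D.hζ.toInteger, t}) = 2 := by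
  haveI := D.gal
  obtain ⟨σ, hσ, hσζ, hσδ⟩ := D.exists_sigma
  have h1 : σ • Ideal.span {1 - D.hζ.toInteger, t} = Ideal.span {1 - D.hζ.toInteger, 1 - t} := by
    rw [smul_span_pair]
    have h2 : σ • (1 - D.hζ.toInteger) = 1 - D.hζ.toInteger := by
      rw [smul_sub, smul_one]
      congr 1
      apply RingOfIntegers.ext
      exact hσζ
    have h3 : σ • t = 1 - t := by
      apply RingOfIntegers.ext
      have h4 : ((1 - t : 𝓞 L) : L) = 1 - (t : L) := by simp
      rw [h4]
      change σ (t : L) = _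
      rw [ht, map_div₀, map_add, map_one, map_ofNat, hσδ]; ring
    rw [h2, h3]
  obtain ⟨c, hc⟩ : (1 - D.hζ.toInteger) ∣ (2 : 𝓞 L) := by
    have h := sub_dvd_pow_sub_pow 1 D.hζ.toInteger (2 ^ (n + 1))
    rw [D.z_neg, one_pow] at h
    convert h using 1; ring
  have h2 := span_pair_mul_conj (1 - D.hζ.toInteger) t (c * (m : 𝓞 L)) (by rw [htm, hc]; ring)
  rw [← h1] at h2
  have h3 := congrArg Ideal.absNorm h2
  rw [map_mul, absNorm_smul, D.norm_one_sub, ← pow_two] at h3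
  exact Nat.pow_left_injective (n := 2) (by norm_num) h3

lemma smul_B (D : LD p q n L ζ δ) (s : L ≃ₐ[ℚ] L) (hs1 : s ζ = ζ⁻¹) (hs2 : s δ = δ) (t : 𝓞 L) (ht : (t : L) = (1 + δ) / 2) :
    s • Ideal.span {1 - D.hζ.toInteger, t} = Ideal.span {1 - D.hζ.toInteger, t} := by
  have hz0 : ζ ≠ 0 := D.hζ.ne_zero (by positivity)
  have hst : s • t = t := by
    apply RingOfIntegers.ext
    change s (t : L) = t
    rw [ht, map_div₀, map_add, map_one, map_ofNat, hs2]
  have hsz : (s • D.hζ.toInteger) * D.hζ.toInteger = 1 := by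
    apply RingOfIntegers.ext
    change s ζ * ζ = 1
    rw [hs1, inv_mul_cancel₀ hz0]
  rw [smul_span_pair, hst, smul_sub, smul_one]
  set w := s • D.hζ.toInteger
  set z := D.hζ.toInteger
  have key : ∀ a b : 𝓞 L, a * b = 1 → Ideal.span {1 - a, t} ≤ Ideal.span {1 - b, t} := by
    intro a b hab
    rw [Ideal.span_le]
    intro x hx
    rcases hx with rfl | hx
    · rw [SetLike.mem_coe, Ideal.mem_span_pair]
      exact ⟨-a, 0, by linear_combination hab⟩
    · exact Ideal.subset_span (Or.inr hx)
  exact le_antisymm (key _ _ hsz) (key _ _ (by rw [mul_comm]; exact hsz))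

end LD

end

section
open NumberField Pointwise

lemma icls_eq_icls {R : Type*} [CommRing R] [IsDedekindDomain R] {I J : Ideal R} (hI : I ≠ ⊥) (hJ : J ≠ ⊥)
    (h : icls I = icls J) : ∃ a b : R, a ≠ 0 ∧ b ≠ 0 ∧ Ideal.span {a} * I = Ideal.span {b} * J := by
  rw [icls_of_ne hI, icls_of_ne hJ, ClassGroup.mk0_eq_mk0_iff] at h
  obtain ⟨a, b, ha, hb, h⟩ := h
  exact ⟨a, b, ha, hb, h⟩

lemma fixed_F {F L : Type} [Field F] [NumberField F] [Field L] [NumberField L] [Algebra F L] (e : F)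
    (htop : IntermediateField.adjoin ℚ {e} = ⊤) (s : L ≃ₐ[ℚ] L) (hs : s (algebraMap F L e) = algebraMap F L e) (x : F) :
    s (algebraMap F L x) = algebraMap F L x := by
  have hx : x ∈ IntermediateField.adjoin ℚ {e} := by rw [htop]; trivial
  induction hx using IntermediateField.adjoin_induction with
  | mem y hy => rw [Set.mem_singleton_iff] at hy; rw [hy, hs]
  | algebraMap y => simp
  | add y z _ _ hy hz => rw [map_add, map_add, hy, hz]
  | inv y _ hy => rw [map_inv₀, map_inv₀, hy]
  | mul y z _ _ hy hz => rw [map_mul, map_mul, hy, hz]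

lemma contra_aux {R Γ : Type} [CommRing R] [IsDedekindDomain R] [Group Γ] [MulSemiringAction Γ R] (p q : ℕ) (hcop : Nat.Coprime p q) (hp0 : (p : R) ≠ 0)
    (s : Γ) (hss : ∀ x : R, s • (s • x) = x)
    (key : ∀ g : R, s • g = g → Ideal.span {g} ^ 2 = Ideal.span {(p : R)} → False)
    (dL : R) (hdL2 : dL ^ 2 = -((p * q : ℕ) : R)) (B : Ideal R) (hsB : s • B = B)
    (aL bL : R) (hbL : bL ≠ 0) (hsa : s • aL = aL) (hsb : s • bL = bL) (M : ℕ)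
    (habL : Ideal.span {aL} * B ^ (2 * M) = Ideal.span {bL} * Ideal.span {(p : R), dL})
    (j : ℕ) (γ : R) (hγ : B ^ (M * (2 * j + 1)) = Ideal.span {γ}) : False := by
  have spne : ∀ x : R, x ≠ 0 → Ideal.span {x} ≠ ⊥ := fun x hx => by rwa [Ne, Ideal.span_singleton_eq_bot]
  have hsγ : Ideal.span {s • γ} = Ideal.span {γ} := by
    have h : s • (Ideal.span {γ}) = Ideal.span {s • γ} := by
      rw [Ideal.pointwise_smul_def, Ideal.map_span]; simp
    rw [← h, ← hγ, smul_pow', hsB]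
  have hpow : Ideal.span {γ * s • γ} = (B ^ (2 * M)) ^ (2 * j + 1) := by
    rw [← Ideal.span_singleton_mul_span_singleton, hsγ, ← hγ, ← pow_add, ← pow_mul]
    congr 1; ring
  obtain ⟨y, hy⟩ : ∃ y, y = bL ^ (2 * j + 1) * (p : R) ^ j := ⟨_, rfl⟩
  obtain ⟨G, hG⟩ : ∃ G, G = aL ^ (2 * j + 1) * (γ * s • γ) := ⟨_, rfl⟩
  have hpp : (Ideal.span {(p : R), dL}) ^ (2 * j + 1) = Ideal.span {(p : R) ^ j} * Ideal.span {(p : R), dL} := by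
    rw [pow_succ, pow_mul, span_p_sq p q hcop dL hdL2, Ideal.span_singleton_pow]
  have hGy : Ideal.span {G} = Ideal.span {y} * Ideal.span {(p : R), dL} := by
    have e1 : Ideal.span {G} = Ideal.span {aL ^ (2 * j + 1)} * Ideal.span {γ * s • γ} := by
      rw [hG]; exact (Ideal.span_singleton_mul_span_singleton _ _).symm
    have e2 : Ideal.span {y} = Ideal.span {bL ^ (2 * j + 1)} * Ideal.span {(p : R) ^ j} := by
      rw [hy]; exact (Ideal.span_singleton_mul_span_singleton _ _).symm
    rw [e1, e2, hpow, ← Ideal.span_singleton_pow aL, ← Ideal.span_singleton_pow bL, ← mul_pow, habL, mul_pow, hpp, mul_assoc]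
  have hy0 : y ≠ 0 := by rw [hy]; exact mul_ne_zero (pow_ne_zero _ hbL) (pow_ne_zero _ hp0)
  have hG1 : G ∈ Ideal.span {y} := by
    have h1 : G ∈ Ideal.span {y} * Ideal.span {(p : R), dL} := by rw [← hGy]; exact Ideal.mem_span_singleton_self G
    have h2 : Ideal.span {y} * Ideal.span {(p : R), dL} ≤ Ideal.span {y} := Ideal.mul_le_left
    exact h2 h1
  have hG2 : ∃ g, G = y * g := by
    obtain ⟨g, hg⟩ := Ideal.mem_span_singleton'.1 hG1
    exact ⟨g, by rw [← hg, mul_comm]⟩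
  obtain ⟨g, hg⟩ := hG2
  have hgs : Ideal.span {g} = Ideal.span {(p : R), dL} := by
    rw [hg, ← Ideal.span_singleton_mul_span_singleton] at hGy
    exact mul_left_cancel₀ (spne _ hy0) hGy
  have hsp : s • (p : R) = (p : R) := by
    exact map_natCast (MulSemiringAction.toRingHom Γ R s) p
  have hsy : s • y = y := by rw [hy, smul_mul', smul_pow', smul_pow', hsb, hsp]
  have hsG : s • G = G := by rw [hG, smul_mul', smul_mul', smul_pow', hsa, hss, mul_comm γ]
  apply key g
  · rw [hg, smul_mul', hsy] at hsG
    exact mul_left_cancel₀ hy0 hsG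
  · rw [hgs, span_p_sq p q hcop dL hdL2]

namespace LD
variable {p q n : ℕ} {L : Type} [Field L] [NumberField L] {ζ δ : L}

set_option maxHeartbeats 1000000 in
lemma order_main (D : LD p q n L ζ δ) {F : Type} [Field F] [NumberField F] [Algebra F L] {e : F} (E : FD p q F e) (he : algebraMap F L e = δ) :
    IsCyclic (CommGroup.primaryComponent (ClassGroup (𝓞 L)) 2) ∧
    Nat.card (CommGroup.primaryComponent (ClassGroup (𝓞 L)) 2) =
      2 ^ n * Nat.card (CommGroup.primaryComponent (ClassGroup (𝓞 F)) 2) := by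
  haveI := D.gal
  obtain ⟨σ, τ, hσ, h1, h2, h3, h4, h5, h6, h7, h8⟩ := D.exists_s
  obtain ⟨s, hs⟩ : ∃ s : L ≃ₐ[ℚ] L, ∀ x, s x = σ (τ x) := ⟨(σ.restrictScalars ℚ) * τ, fun x => rfl⟩
  have hsζ : s ζ = ζ⁻¹ := by rw [hs, h3, map_inv₀, h1]
  have hsδ : s δ = δ := by rw [hs, h4, map_neg, h2, neg_neg]
  have hss : ∀ x : 𝓞 L, s • (s • x) = x := by
    intro x
    apply RingOfIntegers.ext
    change s (s (x : L)) = x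
    rw [hs, hs, ← h6 (τ (x : L)), h7]
    exact h8 x
  have key : ∀ g : 𝓞 L, s • g = g → Ideal.span {g} ^ 2 = Ideal.span {(p : 𝓞 L)} → False := by
    intro g hg hgp
    refine D.key σ τ hσ h1 h2 h3 h4 h5 h6 h7 g ?_ hgp
    rw [← hs]
    exact congrArg (fun t : 𝓞 L => (t : L)) hg
  have hfix : ∀ x : 𝓞 F, s • (algebraMap (𝓞 F) (𝓞 L) x) = algebraMap (𝓞 F) (𝓞 L) x := by
    intro x
    apply RingOfIntegers.ext
    exact fixed_F e E.top s (by rw [he, hsδ]) (x : F)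
  obtain ⟨d, hd, hd2⟩ := E.exists_d
  obtain ⟨t, m, ht, htm⟩ := exists_theta E.hp8 E.hq8 F e E.he
  have hp0 : (p : 𝓞 L) ≠ 0 := by exact_mod_cast D.hp.ne_zero
  have hp0F : (p : 𝓞 F) ≠ 0 := by exact_mod_cast D.hp.ne_zero
  have hcop : Nat.Coprime p q := (Nat.coprime_primes D.hp D.hq).2 E.hne
  have inj : Function.Injective (algebraMap (𝓞 F) (𝓞 L)) := FaithfulSMul.algebraMap_injective _ _
  set dL := algebraMap (𝓞 F) (𝓞 L) d with hdL
  set tL := algebraMap (𝓞 F) (𝓞 L) t with htL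
  have hdL2 : dL ^ 2 = -((p * q : ℕ) : 𝓞 L) := by rw [hdL, ← map_pow, hd2, map_neg, map_natCast]
  have htLv : (tL : L) = (1 + δ) / 2 := by
    change algebraMap F L (t : F) = _
    rw [ht, map_div₀, map_add, map_one, map_ofNat, he]
  have htLm : tL * (1 - tL) = 2 * (m : 𝓞 L) := by
    have := congrArg (algebraMap (𝓞 F) (𝓞 L)) htm
    rw [map_mul, map_sub, map_one, map_mul, map_ofNat, map_natCast] at this
    exact this
  have mapp : (Ideal.span {(p : 𝓞 F), d}).map (algebraMap (𝓞 F) (𝓞 L)) = Ideal.span {(p : 𝓞 L), dL} := by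
    rw [Ideal.map_span, Set.image_pair, map_natCast]
  have mapb : (Ideal.span {2, t}).map (algebraMap (𝓞 F) (𝓞 L)) = Ideal.span {2, tL} := by
    rw [Ideal.map_span, Set.image_pair, map_ofNat]
  have hne : ∀ {R : Type} [CommRing R] (a b : R), a ≠ 0 → Ideal.span {a, b} ≠ ⊥ := by
    intro R _ a b ha h
    have : a ∈ (⊥ : Ideal R) := by rw [← h]; exact Ideal.subset_span (by simp)
    exact ha (by simpa using this)
  -- the ramified prime is not principal in F
  have hnp : icls (Ideal.span {(p : 𝓞 F), d}) ≠ 1 := by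
    intro h
    obtain ⟨x, hx0, hx⟩ := (icls_eq_one_iff (hne _ _ hp0F)).1 h
    apply key _ (hfix x)
    have h9 := span_p_sq p q hcop dL hdL2
    rw [← mapp, hx, Ideal.map_span, Set.image_singleton] at h9
    exact h9
  obtain ⟨N, k, hk, hcardF, hbp⟩ := E.main d hd2 t m ht htm hnp
  set z := D.hζ.toInteger with hz
  set B := Ideal.span {1 - z, tL} with hB
  have hBN := D.absNorm_B tL m htLv htLm
  have hB0 : B ≠ ⊥ := by
    intro h
    rw [← hz, ← hB, h] at hBN
    simp at hBN
  have hBpow : B ^ 2 ^ (n + 1) = Ideal.span {2, tL} := span_pair_pow tL m htLm (n + 1) z D.z_neg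
  have hsB : s • B = B := D.smul_B s hsζ hsδ tL htLv
  have h20 : (2 : 𝓞 F) ≠ 0 := two_ne_zero
  rw [← icls_pow (hne _ _ h20)] at hbp
  obtain ⟨a, b, ha, hb, hab⟩ := icls_eq_icls (pow_ne_zero _ (hne _ _ h20)) (hne _ _ hp0F) hbp
  have habL := congrArg (Ideal.map (algebraMap (𝓞 F) (𝓞 L))) hab
  rw [Ideal.map_mul, Ideal.map_mul, Ideal.map_pow, mapp, mapb, ← hBpow, Ideal.map_span, Ideal.map_span, Set.image_singleton,
    Set.image_singleton, ← pow_mul] at habL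
  have haL : algebraMap (𝓞 F) (𝓞 L) a ≠ 0 := by rwa [Ne, map_eq_zero_iff _ inj]
  have hbL : algebraMap (𝓞 F) (𝓞 L) b ≠ 0 := by rwa [Ne, map_eq_zero_iff _ inj]
  have hsa := hfix a
  have hsb := hfix b
  set aL := algebraMap (𝓞 F) (𝓞 L) a
  set bL := algebraMap (𝓞 F) (𝓞 L) b
  have spne : ∀ x : 𝓞 L, x ≠ 0 → Ideal.span {x} ≠ ⊥ := fun x hx => by rwa [Ne, Ideal.span_singleton_eq_bot]
  have hpL0 : Ideal.span {(p : 𝓞 L), dL} ≠ ⊥ := hne _ _ hp0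
  have hpell : icls (Ideal.span {(p : 𝓞 L), dL}) = 1 := by
    apply pell_principal D.hp D.hq D.hp8 D.hq8 dL (z ^ 2 ^ n) _ hdL2
    rw [← pow_mul, ← pow_succ]
    exact D.z_neg
  set X := icls B with hX
  have hX1 : X ^ (2 ^ (n + 1) * (2 ^ N * k)) = 1 := by
    have h9 := congrArg icls habL
    rw [icls_mul (spne _ haL) (pow_ne_zero _ hB0), icls_mul (spne _ hbL) hpL0, icls_span haL, icls_span hbL, hpell,
      icls_pow hB0, one_mul, one_mul] at h9
    exact h9
  have hX2 : ∀ j : ℕ, X ^ (2 ^ n * (2 ^ N * k) * (2 * j + 1)) ≠ 1 := by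
    intro j hj
    rw [hX, ← icls_pow hB0] at hj
    obtain ⟨γ, hγ0, hγ⟩ := (icls_eq_one_iff (pow_ne_zero _ hB0)).1 hj
    exact contra_aux p q hcop hp0 s hss key dL hdL2 B hsB aL bL hbL hsa hsb (2 ^ n * (2 ^ N * k))
      (by rw [show 2 * (2 ^ n * (2 ^ N * k)) = 2 ^ (n + 1) * (2 ^ N * k) by ring]; exact habL) j γ hγ
  obtain ⟨A, l, hl, hord⟩ := exists_two_pow_mul_odd_orderOf X
  have hA : A = n + (N + 1) := by
    apply le_antisymm
    · have h9 := orderOf_dvd_of_pow_eq_one hX1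
      rw [hord] at h9
      have h10 : 2 ^ A ∣ 2 ^ (n + (N + 1)) * k := by
        refine (Dvd.intro _ rfl).trans (h9.trans (dvd_of_eq ?_)); ring
      have h11 : 2 ^ A ∣ 2 ^ (n + (N + 1)) :=
        (Nat.Coprime.pow_left A (Nat.coprime_two_left.2 hk)).dvd_of_dvd_mul_right h10
      exact (Nat.pow_dvd_pow_iff_le_right (by norm_num)).1 h11
    · by_contra hlt
      push Not at hlt
      obtain ⟨j, hj⟩ := hl
      apply hX2 j
      apply orderOf_dvd_iff_pow_eq_one.1
      rw [hord, ← hj]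
      apply Nat.mul_dvd_mul_right
      have h9 : 2 ^ A ∣ 2 ^ (n + N) := Nat.pow_dvd_pow 2 (by omega)
      refine h9.trans ⟨k, by ring⟩
  have hns := norm_two_nonsquare D.hp D.hq D.hp8 D.hq8 L δ D.hδ B hBN
  obtain ⟨c1, c2⟩ := primaryComponent_cyclic_of_nonsquare D.card_le X hns A l hl hord
  refine ⟨c1, ?_⟩
  rw [c2, hcardF, hA, pow_add]

end LD

end

open Polynomial in
lemma Lfield_eq (n : ℕ) (d : ℤ) :
    Lfield n d = IntermediateField.adjoin ℚ (((X ^ 2 ^ (n + 2) - 1) * (X ^ 2 - C (d : ℚ)) : ℚ[X]).rootSet ℂ) := by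
  unfold Lfield
  congr 1
  have hne : ((X ^ 2 ^ (n + 2) - 1) * (X ^ 2 - C (d : ℚ)) : ℚ[X]) ≠ 0 := by
    apply mul_ne_zero
    · exact (X_pow_sub_C_ne_zero (by positivity) 1)
    · exact (X_pow_sub_C_ne_zero (by positivity) _)
  ext z
  rw [mem_rootSet_of_ne hne]
  simp [sub_eq_zero]

lemma adjoin_rootSet_inst {k E : Type} [Field k] [CharZero k] [Field E] [Algebra k E] [IsAlgClosed E] (f : Polynomial k) :
    FiniteDimensional k (IntermediateField.adjoin k (f.rootSet E)) ∧
      IsGalois k (IntermediateField.adjoin k (f.rootSet E)) := by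
  haveI h := IntermediateField.adjoin_rootSet_isSplittingField (IsAlgClosed.splits (f.map (algebraMap k E)))
  haveI hf := Polynomial.IsSplittingField.finiteDimensional (IntermediateField.adjoin k (f.rootSet E)) f
  haveI hn := Normal.of_isSplittingField f (F := k) (E := IntermediateField.adjoin k (f.rootSet E))
  exact ⟨hf, ⟨⟩⟩

lemma Lfield_inst (n : ℕ) (d : ℤ) : NumberField (Lfield n d) ∧ IsGalois ℚ (Lfield n d) := by
  rw [Lfield_eq]
  obtain ⟨h, h'⟩ := adjoin_rootSet_inst (E := ℂ) ((Polynomial.X ^ 2 ^ (n + 2) - 1) * (Polynomial.X ^ 2 - Polynomial.C (d : ℚ)))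
  constructor
  · refine { to_charZero := inferInstance, to_finiteDimensional := ?_ }
    convert h
  · convert h'
    exact Subsingleton.elim _ _

lemma quadField_eq (m : ℤ) (e : ℂ) (he : e ^ 2 = m) : quadField m = IntermediateField.adjoin ℚ {e} := by
  apply le_antisymm
  · apply IntermediateField.adjoin_le_iff.2
    intro z hz
    have h1 : z ^ 2 = e ^ 2 := by rw [he]; exact hz
    have he' : e ∈ IntermediateField.adjoin ℚ {e} := IntermediateField.mem_adjoin_simple_self _ _
    rcases sq_eq_sq_iff_eq_or_eq_neg.1 h1 with h | h
    · rw [h]; exact he'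
    · rw [h]; exact neg_mem he'
  · apply IntermediateField.adjoin_le_iff.2
    intro z hz
    rw [Set.mem_singleton_iff.1 hz]
    exact IntermediateField.subset_adjoin ℚ _ he

lemma quadField_nf (m : ℤ) (e : ℂ) (he : e ^ 2 = m) : NumberField (quadField m) := by
  rw [quadField_eq m e he]
  have : IsIntegral ℚ e := ⟨Polynomial.X ^ 2 - Polynomial.C (m : ℚ), Polynomial.monic_X_pow_sub_C _ (by norm_num), by
    rw [Polynomial.eval₂_sub, Polynomial.eval₂_pow, Polynomial.eval₂_X, Polynomial.eval₂_C, he]; simp⟩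
  exact { to_charZero := inferInstance, to_finiteDimensional := IntermediateField.adjoin.finiteDimensional this }

lemma adjoin_top_of {K : IntermediateField ℚ ℂ} (S : Set K) (h : K ≤ IntermediateField.adjoin ℚ ((fun x : K => (x : ℂ)) '' S)) :
    IntermediateField.adjoin ℚ S = ⊤ := by
  have key : ∀ x ∈ IntermediateField.adjoin ℚ ((fun x : K => (x : ℂ)) '' S),
      ∃ y ∈ IntermediateField.adjoin ℚ S, (y : ℂ) = x := by
    intro x hx
    induction hx using IntermediateField.adjoin_induction with
    | mem y hy =>
      obtain ⟨u, hu, rfl⟩ := hy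
      exact ⟨u, IntermediateField.subset_adjoin ℚ _ hu, rfl⟩
    | algebraMap y => exact ⟨algebraMap ℚ K y, IntermediateField.algebraMap_mem _ _, by simp⟩
    | add y z _ _ hy hz =>
      obtain ⟨u, hu, rfl⟩ := hy
      obtain ⟨v, hv, rfl⟩ := hz
      exact ⟨u + v, add_mem hu hv, rfl⟩
    | inv y _ hy =>
      obtain ⟨u, hu, rfl⟩ := hy
      exact ⟨u⁻¹, inv_mem hu, rfl⟩
    | mul y z _ _ hy hz =>
      obtain ⟨u, hu, rfl⟩ := hy
      obtain ⟨v, hv, rfl⟩ := hz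
      exact ⟨u * v, mul_mem hu hv, rfl⟩
  rw [eq_top_iff]
  intro x _
  obtain ⟨y, hy, hyx⟩ := key x (h x.2)
  rwa [← Subtype.ext hyx]

lemma main_inst (p q : ℕ) (hp : p.Prime) (hq : q.Prime)
    (hp8 : p % 8 = 5) (hq8 : q % 8 = 3) (n : ℕ) (hn : 1 ≤ n) :
    IsCyclic (twoClassGroup (Lfield n ((p : ℤ) * q))) ∧
      Nat.card (twoClassGroup (Lfield n ((p : ℤ) * q))) = 2 ^ n * h2 (-((p : ℤ) * q)) := by
  obtain ⟨w, hw⟩ : ∃ w : ℂ, w ^ 2 = (p : ℂ) * q := IsAlgClosed.exists_pow_nat_eq _ (by norm_num)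
  obtain ⟨z, hz⟩ : ∃ z : ℂ, IsPrimitiveRoot z (2 ^ (n + 2)) := ⟨_, Complex.isPrimitiveRoot_exp (2 ^ (n + 2)) (pow_ne_zero _ two_ne_zero)⟩
  have hi : (z ^ 2 ^ n) ^ 2 = -1 := by
    have h1 : IsPrimitiveRoot (z ^ 2 ^ (n + 1)) 2 := hz.pow (by positivity) (by ring)
    rw [← pow_mul, ← pow_succ]
    exact h1.eq_neg_one_of_two_right
  set i := z ^ 2 ^ n with hidef
  set K := Lfield n ((p : ℤ) * q) with hK
  set Q := quadField (-((p : ℤ) * q)) with hQ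
  have hiw : (i * w) ^ 2 = ((-((p : ℤ) * q) : ℤ) : ℂ) := by
    rw [mul_pow, hi, hw]; push_cast; ring
  have hzK : z ∈ K := IntermediateField.subset_adjoin ℚ _ (Or.inl hz.pow_eq_one)
  have hwK : w ∈ K := IntermediateField.subset_adjoin ℚ _ (Or.inr (by simpa using hw))
  have hiwK : i * w ∈ K := mul_mem (pow_mem hzK _) hwK
  have hiwQ : i * w ∈ Q := IntermediateField.subset_adjoin ℚ _ hiw
  have hQe := quadField_eq _ _ hiw
  have hle : Q ≤ K := by
    rw [hQ, hQe]
    apply IntermediateField.adjoin_le_iff.2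
    intro x hx
    rw [Set.mem_singleton_iff.1 hx]; exact hiwK
  haveI := (Lfield_inst n ((p : ℤ) * q)).1
  haveI hgal := (Lfield_inst n ((p : ℤ) * q)).2
  haveI := quadField_nf _ _ hiw
  have D : LD p q n K ⟨z, hzK⟩ ⟨i * w, hiwK⟩ := by
    refine ⟨hp, hq, hp8, hq8, hn, ?_, ?_, ?_, hgal⟩
    · exact IsPrimitiveRoot.of_map_of_injective (f := algebraMap K ℂ) hz (FaithfulSMul.algebraMap_injective _ _)
    · apply Subtype.ext
      push_cast at hiw ⊢
      exact hiw
    · apply adjoin_top_of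
      rw [Set.image_pair]
      have hz' : z ∈ IntermediateField.adjoin ℚ {z, i * w} := IntermediateField.subset_adjoin ℚ _ (by simp)
      have hi' : i ∈ IntermediateField.adjoin ℚ {z, i * w} := pow_mem hz' _
      have hw' : w ∈ IntermediateField.adjoin ℚ {z, i * w} := by
        have h1 : i * w ∈ IntermediateField.adjoin ℚ {z, i * w} := IntermediateField.subset_adjoin ℚ _ (by simp)
        have : w = - (i * (i * w)) := by rw [← mul_assoc, ← sq, hi]; ring
        have h3 := neg_mem (mul_mem hi' h1)
        rwa [← this] at h3
      apply IntermediateField.adjoin_le_iff.2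
      rintro x (hx | hx)
      · obtain ⟨j, -, rfl⟩ := hz.eq_pow_of_pow_eq_one hx
        exact pow_mem hz' _
      · have h1 : x ^ 2 = w ^ 2 := by rw [hw]; simpa using hx
        rcases sq_eq_sq_iff_eq_or_eq_neg.1 h1 with h | h
        · rw [h]; exact hw'
        · rw [h]; exact neg_mem hw'
  have E : FD p q Q ⟨i * w, hiwQ⟩ := by
    refine ⟨hp, hq, hp8, hq8, ?_, ?_⟩
    · apply Subtype.ext
      push_cast at hiw ⊢
      exact hiw
    · apply adjoin_top_of
      rw [Set.image_singleton]
      exact hQe.le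
  letI : Algebra Q K := (IntermediateField.inclusion hle).toRingHom.toAlgebra
  exact D.order_main E rfl


/-- for primes `p ≡ 5 (mod 8)`, `q ≡ 3 (mod 8)`, `d = pq` and
`2^r = 2·h₂(-pq)` with `r ≥ 1`, the 2-class group of `L_{n,d}` is cyclic,
isomorphic to `ℤ/2^{n+r-1}ℤ`, for all `n ≥ 1`. -/
theorem twoClassGroup_Lfield_pq_cyclic
    (p q : ℕ) (hp : p.Prime) (hq : q.Prime)
    (hp8 : p % 8 = 5) (hq8 : q % 8 = 3)
    (r : ℕ) (hr1 : 1 ≤ r) (hr : 2 ^ r = 2 * h2 (-((p : ℤ) * q))) :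
    ∀ n : ℕ, 1 ≤ n →
      IsCyclic (twoClassGroup (Lfield n ((p : ℤ) * q))) ∧
      Nonempty ((twoClassGroup (Lfield n ((p : ℤ) * q))) ≃*
        Multiplicative (ZMod (2 ^ (n + r - 1)))) := by
  intro n hn
  obtain ⟨h1, h3⟩ := main_inst p q hp hq hp8 hq8 n hn
  refine ⟨h1, ⟨?_⟩⟩
  apply mulEquivOfCyclicCardEq
  rw [h3, Nat.card_congr Multiplicative.toAdd, Nat.card_zmod]
  obtain ⟨k, rfl⟩ : ∃ k, r = k + 1 := ⟨r - 1, by omega⟩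
  rw [pow_succ, mul_comm] at hr
  have := Nat.eq_of_mul_eq_mul_left (by norm_num) hr
  rw [← this, ← pow_add]
  rfl
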